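/- Suppose R is Gorenstein with dim_k H(R) ≥ 2, and let Γ be the AR quiver of D^c(R). Then: (1) each component C of Γ is isomorphic to Z A_∞ as a stable translation quiver; (2) each label (α_μ, β_μ) on Γ is equal to (1,1); (3) if the function φ(M) = dim_k Ext_R(M,k) has value φ₁ on the edge of a component C ≅ Z A_∞, then it has value nφ₁ on the nth horizontal row of vertices of C. -/

import Mathlib

/-!
# Preamble: an interface for the derived category of DG modules over a cochain DG algebra

We formalize the setting of the paper "Calabi-Yau categories and Poincaré duality spaces".
Let `k` be a field and `R` a DG algebra over `k` with `R^{<0} = 0`, `R^0 = k`, `R^1 = 0`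
and `dim_k R < ∞`.  Since the derived category `D(R)` of DG left-`R`-modules (and the derived
category `D(R^o)` of DG right-`R`-modules) is not available in Mathlib, we axiomatize it:
`C` (resp. `Co`) is a `k`-linear triangulated category playing the role of `D(R)`
(resp. `D(R^o)`), and a `DGSetup` records the distinguished objects (`R`, `k = R/R^{≥1}`,
the dual `D(R) = Hom_k(R,k)`, ...) and operations used in the paper, together with the
standing assumptions of the paper, expressed in terms of cohomology.  Cohomology is
faithfully encoded via `H^i(M) = Hom_{D(R)}(R, Σ^i M)`, so that e.g. the graded algebra
structure of `H(R)` is the (Yoneda) composition product, and `Ext^i_R(M,N) = Hom_{D(R)}(M, Σ^i N)`.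
-/

open CategoryTheory CategoryTheory.Limits CategoryTheory.Pretriangulated

universe v u

section Preamble

variable (k : Type u) [Field k]
variable (C : Type u) [Category.{v} C] [Preadditive C] [HasZeroObject C] [HasShift C ℤ]
  [∀ n : ℤ, (shiftFunctor C n).Additive] [Pretriangulated C]
  [Linear k C] [HasFiniteBiproducts C] [∀ n : ℤ, Functor.Linear k (shiftFunctor C n)]

/-- The objects finitely built from `R₀` using distinguished triangles, (de)suspensions,
(finite) coproducts and direct summands, i.e. the thick subcategory generated by `R₀`.
For `R₀ = R` this is the class of compact objects, i.e. the subcategory `D^c(R)`. -/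
inductive FinitelyBuilt (R₀ : C) : C → Prop
  | base : FinitelyBuilt R₀ R₀
  | iso {M N : C} : (M ≅ N) → FinitelyBuilt R₀ M → FinitelyBuilt R₀ N
  | shift {M : C} (n : ℤ) : FinitelyBuilt R₀ M → FinitelyBuilt R₀ (M⟦n⟧)
  | cone {X Y Z : C} (f : X ⟶ Y) (g : Y ⟶ Z) (h : Z ⟶ X⟦(1 : ℤ)⟧) :
      (Triangle.mk f g h ∈ distTriang C) → FinitelyBuilt R₀ X → FinitelyBuilt R₀ Y →
      FinitelyBuilt R₀ Z
  | retract {M N : C} (i : N ⟶ M) (r : M ⟶ N) : i ≫ r = 𝟙 N →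
      FinitelyBuilt R₀ M → FinitelyBuilt R₀ N

/-- An Auslander-Reiten triangle `X → Y → Z → ΣX` in the full subcategory of a pretriangulated
category determined by the class of objects `P`: a distinguished triangle with nonzero
connecting map, such that every morphism out of `X` (in the subcategory) which is not a split
monomorphism factors through `f`, and every morphism into `Z` which is not a split epimorphism
factors through `g`. -/
structure IsARTriangle (P : Set C) {X Y Z : C} (f : X ⟶ Y) (g : Y ⟶ Z)
    (h : Z ⟶ X⟦(1 : ℤ)⟧) : Prop where
  memX : X ∈ P
  memY : Y ∈ P
  memZ : Z ∈ P
  dist : Triangle.mk f g h ∈ distTriang C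
  h_ne : h ≠ 0
  fac_left : ∀ N' : C, N' ∈ P → ∀ u : X ⟶ N',
      ¬ (∃ r : N' ⟶ X, u ≫ r = 𝟙 X) → ∃ v : Y ⟶ N', f ≫ v = u
  fac_right : ∀ N' : C, N' ∈ P → ∀ v : N' ⟶ Z,
      ¬ (∃ s : Z ⟶ N', s ≫ v = 𝟙 Z) → ∃ u : N' ⟶ Y, u ≫ g = v

/-- The subcategory of objects `P` has right AR triangles: for every object `Z` of `P` with
local endomorphism ring there is an AR triangle ending in `Z`. -/
def HasRightARTriangles (P : Set C) : Prop :=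
  ∀ Z : C, Z ∈ P → IsLocalRing (End Z) →
    ∃ (X Y : C) (f : X ⟶ Y) (g : Y ⟶ Z) (h : Z ⟶ X⟦(1 : ℤ)⟧), IsARTriangle C P f g h

/-- The subcategory of objects `P` has left AR triangles: for every object `X` of `P` with
local endomorphism ring there is an AR triangle starting in `X`. -/
def HasLeftARTriangles (P : Set C) : Prop :=
  ∀ X : C, X ∈ P → IsLocalRing (End X) →
    ∃ (Y Z : C) (f : X ⟶ Y) (g : Y ⟶ Z) (h : Z ⟶ X⟦(1 : ℤ)⟧), IsARTriangle C P f g h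

/-- The subcategory of objects `P` has AR triangles if it has both right and left ones. -/
def HasARTriangles (P : Set C) : Prop :=
  HasRightARTriangles C P ∧ HasLeftARTriangles C P

/-- An object is indecomposable if it is nonzero and in any direct sum decomposition one
of the summands vanishes. -/
def Indec (M : C) : Prop :=
  ¬ IsZero M ∧ ∀ A B : C, Nonempty (M ≅ A ⊞ B) → IsZero A ∨ IsZero B

/-- An irreducible morphism in the full subcategory of objects `P`: a non-isomorphism such
that in any factorization through an object of `P`, the first factor is a split monomorphism
or the second factor is a split epimorphism. -/
def IrredMor (P : Set C) {M N : C} (f : M ⟶ N) : Prop :=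
  ¬ IsIso f ∧ ∀ L : C, L ∈ P → ∀ (σ : M ⟶ L) (ρ : L ⟶ N), σ ≫ ρ = f →
    (∃ s : N ⟶ L, s ≫ ρ = 𝟙 N) ∨ (∃ r : L ⟶ M, σ ≫ r = 𝟙 M)

/-- The indecomposable objects belonging to the class `P`. -/
abbrev IndecObj (P : Set C) : Type _ := {M : C // M ∈ P ∧ Indec C M}

/-- Isomorphism, as an equivalence relation on the indecomposable objects in `P`. -/
def isoSetoid (P : Set C) : Setoid (IndecObj C P) where
  r M N := Nonempty (M.1 ≅ N.1)
  iseqv := ⟨fun M => ⟨Iso.refl M.1⟩, fun ⟨e⟩ => ⟨e.symm⟩, fun ⟨e⟩ ⟨e'⟩ => ⟨e ≪≫ e'⟩⟩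

/-- The vertices of the AR quiver of the full subcategory of objects `P`: isomorphism
classes of indecomposable objects in `P`. -/
def ARVertex (P : Set C) : Type _ := Quotient (isoSetoid C P)

/-- The vertex of the AR quiver given by an indecomposable object. -/
def vertexOf (P : Set C) (M : IndecObj C P) : ARVertex C P :=
  Quotient.mk (isoSetoid C P) M

/-- There is an arrow `[M] → [N]` in the AR quiver iff there is an irreducible morphism
`M → N` between representatives. -/
def VArrow (P : Set C) (v w : ARVertex C P) : Prop :=
  ∃ (M N : IndecObj C P) (f : M.1 ⟶ N.1),
    IrredMor C P f ∧ vertexOf C P M = v ∧ vertexOf C P N = w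

/-- Two vertices of the AR quiver lie in the same component iff they are connected by a
finite zigzag of arrows. -/
def sameComponent (P : Set C) (v w : ARVertex C P) : Prop :=
  Relation.EqvGen (fun v w => VArrow C P v w ∨ VArrow C P w v) v w

/-- The set of components of the AR quiver of the full subcategory of objects `P`. -/
def ARComponents (P : Set C) : Type _ :=
  Quotient (Relation.EqvGen.setoid (fun v w => VArrow C P v w ∨ VArrow C P w v))

/-- The component of the AR quiver containing a given vertex. -/
def componentOf (P : Set C) (v₀ : ARVertex C P) : Set (ARVertex C P) :=
  {v | sameComponent C P v v₀}

/-- An AR translation for the subcategory of objects `P`: the assignment `N ↦ τN` on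
indecomposable objects given by the left hand end terms of AR triangles.  (The end terms
of an AR triangle determine each other up to isomorphism, so `τ` is well defined up to
isomorphism; accordingly any choice satisfies `iso_congr`.) -/
structure ARTranslation (P : Set C) where
  τ : IndecObj C P → IndecObj C P
  triangle : ∀ N : IndecObj C P, ∃ (Y : C) (f : (τ N).1 ⟶ Y) (g : Y ⟶ N.1)
      (h : N.1 ⟶ ((τ N).1)⟦(1 : ℤ)⟧), IsARTriangle C P f g h
  iso_congr : ∀ M N : IndecObj C P, Nonempty (M.1 ≅ N.1) → Nonempty ((τ M).1 ≅ (τ N).1)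

/-- The vertices of the repetitive quiver `ℤA∞`: pairs `(p, n)`, `p ∈ ℤ`, `n ≥ 1`. -/
abbrev ZAVertex : Type := ℤ × ℕ+

/-- The arrows of `ℤA∞`: `(p, n) → (p, n+1)` and `(p, n+1) → (p-1, n)`. -/
def ZAArrow (v w : ZAVertex) : Prop :=
  (w.1 = v.1 ∧ w.2 = v.2 + 1) ∨ (w.1 = v.1 - 1 ∧ v.2 = w.2 + 1)

/-- The translation of the stable translation quiver `ℤA∞`: `τ(p, n) = (p+1, n)`. -/
def ZATrans (v : ZAVertex) : ZAVertex := (v.1 + 1, v.2)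

/-- A set of vertices (a component) of the AR quiver, with translation `τv`, is isomorphic
to `ℤA∞` as a stable translation quiver: it is stable under the translation and there is a
bijection with the vertices of `ℤA∞` matching arrows with arrows and translation with
translation. -/
def IsZAInftyComponent (P : Set C) (τv : ARVertex C P → ARVertex C P)
    (comp : Set (ARVertex C P)) : Prop :=
  ∃ (hτ : ∀ v ∈ comp, τv v ∈ comp) (θ : comp ≃ ZAVertex),
    (∀ v w : comp, VArrow C P v.1 w.1 ↔ ZAArrow (θ v) (θ w)) ∧
    (∀ v : comp, θ ⟨τv v.1, hτ v.1 v.2⟩ = ZATrans (θ v))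

/-- A functor `F` is a Serre functor for the full subcategory of objects `P` of the `k`-linear
category `C`: it preserves `P` and there are isomorphisms
`Hom_k(Hom(M,N), k) ≅ Hom(N, F M)` natural in `M` and `N`. -/
def IsSerreFunctorOn (P : Set C) (F : C ⥤ C) : Prop :=
  (∀ M : C, M ∈ P → F.obj M ∈ P) ∧
  ∃ η : ∀ M N : C, M ∈ P → N ∈ P → Module.Dual k (M ⟶ N) ≃ₗ[k] (N ⟶ F.obj M),
    (∀ (M N N' : C) (hM : M ∈ P) (hN : N ∈ P) (hN' : N' ∈ P) (g : N' ⟶ N)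
        (ψ : Module.Dual k (M ⟶ N)),
        η M N' hM hN' (ψ.comp (Linear.rightComp k M g)) = g ≫ η M N hM hN ψ) ∧
    (∀ (M M' N : C) (hM : M ∈ P) (hM' : M' ∈ P) (hN : N ∈ P) (f : M ⟶ M')
        (ψ : Module.Dual k (M ⟶ N)),
        η M' N hM' hN (ψ.comp (Linear.leftComp k N f)) = η M N hM hN ψ ≫ F.map f)

/-- The `n`-th power of the suspension is a Serre functor for the subcategory of objects `P`. -/
def IsSerreShift (P : Set C) (n : ℤ) : Prop :=
  IsSerreFunctorOn k C P (shiftFunctor C n)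

/-- The full subcategory of objects `P` is an `n`-Calabi-Yau category: `n` is the smallest
non-negative integer such that `Σ^n` is a Serre functor. -/
def IsCalabiYau (P : Set C) (n : ℤ) : Prop :=
  0 ≤ n ∧ IsSerreShift k C P n ∧ ∀ m : ℤ, 0 ≤ m → m < n → ¬ IsSerreShift k C P m

/-- The full subcategory of objects `P` is a Krull-Schmidt category: every object is a finite
direct sum of objects with local endomorphism rings, and such a decomposition is unique up to
isomorphism and permutation of the summands. -/
def KrullSchmidtClass (P : Set C) : Prop :=
  (∀ M : C, M ∈ P → ∃ (n : ℕ) (Ys : Fin n → C),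
      (∀ j, Ys j ∈ P ∧ IsLocalRing (End (Ys j))) ∧ Nonempty (M ≅ ⨁ Ys)) ∧
  (∀ (n m : ℕ) (Ys : Fin n → C) (Zs : Fin m → C),
      (∀ j, IsLocalRing (End (Ys j))) → (∀ j, IsLocalRing (End (Zs j))) →
      Nonempty ((⨁ Ys) ≅ ⨁ Zs) →
      ∃ σ : Fin n ≃ Fin m, ∀ j, Nonempty (Ys j ≅ Zs (σ j)))

/-- Total finite dimensionality of `Ext(M,N) = ⊕_i Hom(M, Σ^i N)` over `k`. -/
def FinTotalExt (M N : C) : Prop :=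
  (∀ i : ℤ, FiniteDimensional k (M ⟶ N⟦i⟧)) ∧
    Set.Finite {i : ℤ | Nontrivial (M ⟶ N⟦i⟧)}

/-- The composition of a chain of morphisms `⋯ → Ms 2 → Ms 1 → Ms 0`. -/
def chainComp (Ms : ℕ → C) (fs : ∀ i, Ms (i + 1) ⟶ Ms i) : ∀ q, Ms q ⟶ Ms 0
  | 0 => 𝟙 (Ms 0)
  | (q + 1) => fs q ≫ chainComp Ms fs q

end Preamble

section Preamble2

variable {C : Type u} [Category.{v} C] [Preadditive C] [HasZeroObject C] [HasShift C ℤ]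
  [∀ n : ℤ, (shiftFunctor C n).Additive] [Pretriangulated C] [HasFiniteBiproducts C]

/-- The action of the AR translation on the vertices of the AR quiver. -/
def ARTranslation.vmap {P : Set C} (t : ARTranslation C P) :
    ARVertex C P → ARVertex C P :=
  Quotient.map t.τ fun M N h => t.iso_congr M N h

end Preamble2
section Setup

variable (k : Type u) [Field k]
variable (C : Type u) [Category.{v} C] [Preadditive C] [HasZeroObject C] [HasShift C ℤ]
  [∀ n : ℤ, (shiftFunctor C n).Additive] [Pretriangulated C]
  [Linear k C] [HasFiniteBiproducts C] [∀ n : ℤ, Functor.Linear k (shiftFunctor C n)]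
variable (Co : Type u) [Category.{v} Co] [Preadditive Co] [HasZeroObject Co] [HasShift Co ℤ]
  [∀ n : ℤ, (shiftFunctor Co n).Additive] [Pretriangulated Co]
  [Linear k Co] [HasFiniteBiproducts Co] [∀ n : ℤ, Functor.Linear k (shiftFunctor Co n)]

/-- The data of the paper's setting.  `C` plays the role of the derived category `D(R)` of DG
left modules over the cochain DG algebra `R` (with `R^{<0} = 0`, `R^0 = k`, `R^1 = 0` and
`dim_k R < ∞`), and `Co` plays the role of the derived category `D(R^o)` of DG right modules.
The fields record the objects and functors used in the paper, and the axioms record the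
standing assumptions, with cohomology encoded as `H^i(M) = Hom_{D(R)}(R, Σ^i M)`. -/
structure DGSetup where
  /-- the free DG module `R` as an object of `D(R)` -/
  R : C
  /-- the free DG module `R` as an object of `D(R^o)` -/
  Ro : Co
  /-- the DG bi-`R`-module `k = R/R^{≥1}` viewed as an object of `D(R)` -/
  kMod : C
  /-- `k = R/R^{≥1}` viewed as an object of `D(R^o)` -/
  kModo : Co
  /-- the dual `D(R) = Hom_k(R,k)` as a DG left module, i.e. as an object of `D(R)` -/
  DR : C
  /-- the dual `D(R) = Hom_k(R,k)` as a DG right module, i.e. as an object of `D(R^o)` -/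
  DRo : Co
  /-- the DG left module `RHom_{R^o}(D(R), R)` -/
  RHomDRR : C
  /-- the functor `D(R) ⊗^L_R - : D(R) → D(R)`, where the tensor product inherits the
  left `R`-structure from the DG bi-`R`-module `D(R)` -/
  tensDR : C ⥤ C
  /-- the functor `Σ RHom_{R^o}(D(R), R) ⊗^L_R - : D(R) → D(R)` -/
  homDR : C ⥤ C
  /-- the cohomology `H^i(M ⊗^L_R N)` of the derived tensor product of a DG right module
  `M` and a DG left module `N` -/
  Htensor : Co → C → ℤ → ModuleCat.{v} k
  /-- the supremum `d = sup { i | H^i(R) ≠ 0 }` -/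
  d : ℤ
  /-- the dimension `dim_k R` of the underlying DG algebra -/
  dimR : ℕ
  /-- `H^i(R) = 0` for `i < 0` -/
  HR_neg : ∀ i : ℤ, i < 0 → Subsingleton (R ⟶ R⟦i⟧)
  /-- `H^0(R) ≅ k` -/
  HR_zero : Nonempty ((R ⟶ R⟦(0 : ℤ)⟧) ≃ₗ[k] k)
  /-- `H^1(R) = 0` -/
  HR_one : Subsingleton (R ⟶ R⟦(1 : ℤ)⟧)
  /-- `dim_k H(R) < ∞`, degreewise finiteness -/
  HR_findim : ∀ i : ℤ, FiniteDimensional k (R ⟶ R⟦i⟧)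
  /-- `dim_k H(R) < ∞`, boundedness -/
  HR_bdd : Set.Finite {i : ℤ | Nontrivial (R ⟶ R⟦i⟧)}
  /-- `H^i(R) = 0` for `i < 0`, in `D(R^o)` -/
  HRo_neg : ∀ i : ℤ, i < 0 → Subsingleton (Ro ⟶ Ro⟦i⟧)
  /-- `H^0(R) ≅ k`, in `D(R^o)` -/
  HRo_zero : Nonempty ((Ro ⟶ Ro⟦(0 : ℤ)⟧) ≃ₗ[k] k)
  /-- `H^1(R) = 0`, in `D(R^o)` -/
  HRo_one : Subsingleton (Ro ⟶ Ro⟦(1 : ℤ)⟧)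
  /-- `dim_k H(R) < ∞`, degreewise finiteness, in `D(R^o)` -/
  HRo_findim : ∀ i : ℤ, FiniteDimensional k (Ro ⟶ Ro⟦i⟧)
  /-- `dim_k H(R) < ∞`, boundedness, in `D(R^o)` -/
  HRo_bdd : Set.Finite {i : ℤ | Nontrivial (Ro ⟶ Ro⟦i⟧)}
  /-- `H^d(R) ≠ 0` -/
  d_mem : Nontrivial (R ⟶ R⟦d⟧)
  /-- `d` bounds the degrees of the nonvanishing cohomology of `R` -/
  d_greatest : ∀ i : ℤ, Nontrivial (R ⟶ R⟦i⟧) → i ≤ d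
  /-- `H^0(k) ≅ k` -/
  Hk_zero : Nonempty ((R ⟶ kMod⟦(0 : ℤ)⟧) ≃ₗ[k] k)
  /-- `H^i(k) = 0` for `i ≠ 0` -/
  Hk_ne : ∀ i : ℤ, i ≠ 0 → Subsingleton (R ⟶ kMod⟦i⟧)
  /-- `H^0(k) ≅ k`, in `D(R^o)` -/
  Hko_zero : Nonempty ((Ro ⟶ kModo⟦(0 : ℤ)⟧) ≃ₗ[k] k)
  /-- `H^i(k) = 0` for `i ≠ 0`, in `D(R^o)` -/
  Hko_ne : ∀ i : ℤ, i ≠ 0 → Subsingleton (Ro ⟶ kModo⟦i⟧)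
  /-- `R ≠ 0`, so `dim_k R ≥ 1` -/
  dimR_pos : 0 < dimR
  /-- `D(R) ⊗^L_R R ≅ D(R)` -/
  tensDR_R : Nonempty (tensDR.obj R ≅ DR)
  /-- `Σ RHom_{R^o}(D(R), R) ⊗^L_R R ≅ Σ RHom_{R^o}(D(R), R)` -/
  homDR_R : Nonempty (homDR.obj R ≅ RHomDRR⟦(1 : ℤ)⟧)
  /-- `H(R ⊗^L_R N) ≅ H(N)` -/
  Htensor_R : ∀ (N : C) (i : ℤ), Nonempty ((Htensor Ro N i : Type v) ≃ₗ[k] (R ⟶ N⟦i⟧))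
  /-- `H(M ⊗^L_R R) ≅ H(M)` -/
  Htensor_Ro : ∀ (M : Co) (i : ℤ), Nonempty ((Htensor M R i : Type v) ≃ₗ[k] (Ro ⟶ M⟦i⟧))

namespace DGSetup

variable {k C Co}
variable (S : DGSetup k C Co)

/-- The cohomology `H^i(M) = Hom_{D(R)}(R, Σ^i M)` of a DG left module, a `k`-vector space. -/
abbrev H (M : C) (i : ℤ) : Type v := S.R ⟶ M⟦i⟧

/-- The cohomology `H^i(M) = Hom_{D(R^o)}(R, Σ^i M)` of a DG right module. -/
abbrev Ho (M : Co) (i : ℤ) : Type v := S.Ro ⟶ M⟦i⟧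

/-- `M` belongs to `D^f(R)`, the full subcategory of DG modules with `dim_k H(M) < ∞`. -/
def memDf (M : C) : Prop :=
  (∀ i : ℤ, FiniteDimensional k (S.H M i)) ∧ Set.Finite {i : ℤ | Nontrivial (S.H M i)}

/-- `M` belongs to `D^f(R^o)`. -/
def memDfo (M : Co) : Prop :=
  (∀ i : ℤ, FiniteDimensional k (S.Ho M i)) ∧ Set.Finite {i : ℤ | Nontrivial (S.Ho M i)}

/-- `M` belongs to `D^c(R)`, the full subcategory of compact objects, i.e. the objects
finitely built from `R`. -/
def memDc (M : C) : Prop := FinitelyBuilt C S.R M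

/-- `M` belongs to `D^c(R^o)`. -/
def memDco (M : Co) : Prop := FinitelyBuilt Co S.Ro M

/-- `D^f(R)` as a class of objects. -/
def Df : Set C := {M | S.memDf M}

/-- `D^c(R)` as a class of objects. -/
def Dc : Set C := {M | S.memDc M}

/-- `D^f(R^o)` as a class of objects. -/
def Dfo : Set Co := {M | S.memDfo M}

/-- `D^c(R^o)` as a class of objects. -/
def Dco : Set Co := {M | S.memDco M}

/-- The total dimension `dim_k H(R)` of the cohomology of `R`. -/
noncomputable def dimH : Cardinal :=
  Cardinal.sum fun i : ℤ => Module.rank k (S.H S.R i)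

/-- The invariant `φ(M) = dim_k Ext_R(M, k)`, with `Ext^i_R(M,k) = Hom_{D(R)}(M, Σ^i k)`. -/
noncomputable def phi (M : C) : Cardinal :=
  Cardinal.sum fun i : ℤ => Module.rank k (M ⟶ S.kMod⟦i⟧)

/-- `R` is a Gorenstein DG algebra: `D(R) ≅ Σ^d R` in `D(R)` and in `D(R^o)`. -/
def Gorenstein : Prop :=
  Nonempty (S.DR ≅ S.R⟦S.d⟧) ∧ Nonempty (S.DRo ≅ S.Ro⟦S.d⟧)

/-- The left action `H^i(R) × H^j(M) → H^{i+j}(M)` of the cohomology algebra of `R` on the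
cohomology of a DG left module, given by (shifted) composition in `D(R)`. -/
noncomputable def hsmul (M : C) {i j : ℤ} (a : S.H S.R i) (x : S.H M j) : S.H M (i + j) :=
  a ≫ (shiftFunctor C i).map x ≫ (shiftFunctorAdd' C j i (i + j) (by omega)).inv.app M

/-- The product on the cohomology algebra `H(R)`, given by composition in `D(R)`. -/
noncomputable def hmul {i j : ℤ} (a : S.H S.R i) (x : S.H S.R j) : S.H S.R (i + j) :=
  S.hsmul S.R a x

/-- Transport of cohomology along an equality of degrees. -/
def hcast (M : C) {i j : ℤ} (h : i = j) : S.H M i →ₗ[k] S.H M j := by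
  subst h; exact LinearMap.id

/-- Right multiplication `x ↦ x · a` on the cohomology algebra, as a linear map. -/
noncomputable def mulRight {m i : ℤ} (a : S.H S.R i) : S.H S.R m →ₗ[k] S.H S.R (m + i) :=
  Linear.rightComp k S.R
    ((shiftFunctor C m).map a ≫ (shiftFunctorAdd' C i m (m + i) (by omega)).inv.app S.R)

/-- Left multiplication `x ↦ a · x` on the cohomology algebra, as a linear map. -/
noncomputable def mulLeft {i m : ℤ} (a : S.H S.R i) : S.H S.R m →ₗ[k] S.H S.R (i + m) :=
  (Linear.rightComp k S.R ((shiftFunctorAdd' C m i (i + m) (by omega)).inv.app S.R)).comp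
    (((Linear.leftComp k ((S.R⟦m⟧)⟦i⟧) a).comp ((shiftFunctor C i).mapLinearMap k)))

/-- There is an isomorphism `D(H(R)) ≅ Σ^n H(R)` of graded left `H(R)`-modules, where
`D(-) = Hom_k(-, k)`: in degree `j` an isomorphism `Hom_k(H^{n-j}(R), k) ≅ H^j(R)`,
compatible with the left action of `H(R)` (the action on the dual being induced by right
multiplication). -/
def dualIsoShiftLeft (n : ℤ) : Prop :=
  ∃ e : ∀ j : ℤ, Module.Dual k (S.H S.R (n - j)) ≃ₗ[k] S.H S.R j,
    ∀ (i j : ℤ) (a : S.H S.R i) (f : Module.Dual k (S.H S.R (n - j))),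
      e (i + j) (f.comp ((S.hcast S.R (show n - (i + j) + i = n - j by omega)).comp
        (S.mulRight a))) = S.hmul a (e j f)

/-- There is an isomorphism `D(H(R)) ≅ Σ^n H(R)` of graded right `H(R)`-modules. -/
def dualIsoShiftRight (n : ℤ) : Prop :=
  ∃ e : ∀ j : ℤ, Module.Dual k (S.H S.R (n - j)) ≃ₗ[k] S.H S.R j,
    ∀ (i j : ℤ) (a : S.H S.R i) (f : Module.Dual k (S.H S.R (n - j))),
      e (j + i) (f.comp ((S.hcast S.R (show i + (n - (j + i)) = n - j by omega)).comp
        (S.mulLeft a))) = S.hmul (e j f) a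

end DGSetup

end Setup

set_option linter.unusedSectionVars false

section ExactSequences

open Module

/-- Finite-dimensionality and dimension estimate for the middle term of an exact sequence. -/
lemma finrank_le_of_exact {K U V W : Type*} [Field K] [AddCommGroup U] [AddCommGroup V]
    [AddCommGroup W] [Module K U] [Module K V] [Module K W] (f : U →ₗ[K] V) (g : V →ₗ[K] W)
    (hfg : ∀ v, g v = 0 → ∃ u, f u = v) [FiniteDimensional K U] [FiniteDimensional K W] :
    FiniteDimensional K V ∧ finrank K V ≤ finrank K U + finrank K (LinearMap.range g) := by
  have hker : LinearMap.ker g ≤ LinearMap.range f := fun v hv => hfg v hv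
  have : FiniteDimensional K (LinearMap.ker g) := Submodule.finiteDimensional_of_le hker
  have hV : FiniteDimensional K V := by
    have e := g.quotKerEquivRange
    have : FiniteDimensional K (V ⧸ LinearMap.ker g) := e.symm.finiteDimensional
    exact Module.Finite.of_submodule_quotient (LinearMap.ker g)
  refine ⟨hV, ?_⟩
  have h1 := LinearMap.finrank_range_add_finrank_ker g
  have h2 := Submodule.finrank_mono hker
  have h3 := LinearMap.finrank_range_le f
  omega

/-- The dimension of the middle term of a short exact sequence. -/
lemma finrank_eq_of_exact {K U V W : Type*} [Field K] [AddCommGroup U] [AddCommGroup V]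
    [AddCommGroup W] [Module K U] [Module K V] [Module K W] (f : U →ₗ[K] V) (g : V →ₗ[K] W)
    (hfg : ∀ v, g v = 0 → ∃ u, f u = v) (hgf : ∀ u, g (f u) = 0)
    (hf : Function.Injective f) (hg : Function.Surjective g) [FiniteDimensional K V] :
    finrank K V = finrank K U + finrank K W := by
  have h1 := LinearMap.finrank_range_add_finrank_ker g
  have hker : LinearMap.ker g = LinearMap.range f := by
    apply le_antisymm
    · exact fun v hv => hfg v hv
    · rintro _ ⟨u, rfl⟩
      exact hgf u
  have h2 := LinearMap.finrank_range_of_inj hf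
  have h3 : finrank K (LinearMap.range g) = finrank K W := by
    rw [LinearMap.range_eq_top.2 hg, finrank_top]
  rw [hker] at h1
  omega

/-- A linear functional vanishing on the kernel of `g` factors through `g`. -/
lemma exists_functional_comp_eq {K V W : Type*} [Field K] [AddCommGroup V]
    [AddCommGroup W] [Module K V] [Module K W] (g : V →ₗ[K] W) (f : V →ₗ[K] K)
    (h : ∀ v, g v = 0 → f v = 0) : ∃ l : W →ₗ[K] K, ∀ v, l (g v) = f v := by
  let f' : LinearMap.range g →ₗ[K] K :=
    ((LinearMap.ker g).liftQ f (fun v hv => h v hv)).comp g.quotKerEquivRange.symm.toLinearMap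
  obtain ⟨l, hl⟩ := LinearMap.exists_extend f'
  refine ⟨l, fun v => ?_⟩
  have := LinearMap.congr_fun hl ⟨g v, v, rfl⟩
  simp only [LinearMap.comp_apply, Submodule.subtype_apply] at this
  rw [this]
  have h2 : g.quotKerEquivRange.symm ⟨g v, v, rfl⟩ = (LinearMap.ker g).mkQ v := by
    rw [LinearEquiv.symm_apply_eq]
    rfl
  simp only [f', LinearMap.comp_apply, LinearEquiv.coe_coe, h2]
  rfl

variable {k : Type u} [Field k]
variable {C : Type u} [Category.{v} C] [Preadditive C] [HasZeroObject C] [HasShift C ℤ]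
  [∀ n : ℤ, (shiftFunctor C n).Additive] [Pretriangulated C]
  [Linear k C] [HasFiniteBiproducts C] [∀ n : ℤ, Functor.Linear k (shiftFunctor C n)]

variable (k) in
/-- The shift functor acts bijectively and linearly on morphisms. -/
noncomputable def shiftHomEquiv (X Y : C) (n : ℤ) : (X ⟶ Y) ≃ₗ[k] (X⟦n⟧ ⟶ Y⟦n⟧) :=
  LinearEquiv.ofBijective ((shiftFunctor C n).mapLinearMap k)
    ⟨fun _ _ h => (shiftFunctor C n).map_injective h, fun g => (shiftFunctor C n).map_surjective g⟩

variable (k) in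
/-- Moving a shift from the target to the source. -/
lemma nonempty_shiftHom_right (X Y : C) (a b c : ℤ) (h : c + a = b) :
    Nonempty ((X⟦a⟧ ⟶ Y⟦b⟧) ≃ₗ[k] (X ⟶ Y⟦c⟧)) :=
  ⟨(Linear.homCongr k (Iso.refl _) ((shiftFunctorAdd' C c a b h).app Y)).trans
    (shiftHomEquiv k X (Y⟦c⟧) a).symm⟩

variable (k) in
/-- Moving a shift from the source to the target. -/
lemma nonempty_shiftHom_left (X Y : C) (a b c : ℤ) (h : c + b = a) :
    Nonempty ((X⟦a⟧ ⟶ Y⟦b⟧) ≃ₗ[k] (X⟦c⟧ ⟶ Y)) :=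
  ⟨(Linear.homCongr k ((shiftFunctorAdd' C c b a h).app X) (Iso.refl _)).trans
    (shiftHomEquiv k (X⟦c⟧) Y b).symm⟩

section Triangles

variable {X Y Z : C} {f : X ⟶ Y} {g : Y ⟶ Z} {h : Z ⟶ X⟦(1 : ℤ)⟧}

lemma dist_comp₁₂ (hT : Triangle.mk f g h ∈ distTriang C) : f ≫ g = 0 :=
  comp_distTriang_mor_zero₁₂ _ hT

lemma dist_comp₂₃ (hT : Triangle.mk f g h ∈ distTriang C) : g ≫ h = 0 :=
  comp_distTriang_mor_zero₂₃ _ hT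

lemma dist_comp₃₁ (hT : Triangle.mk f g h ∈ distTriang C) : h ≫ f⟦(1 : ℤ)⟧' = 0 :=
  comp_distTriang_mor_zero₃₁ _ hT

lemma dist_rotate (hT : Triangle.mk f g h ∈ distTriang C) :
    Triangle.mk g h (-(f⟦(1 : ℤ)⟧')) ∈ distTriang C :=
  rot_of_distTriang _ hT

lemma dist_lift₂ (hT : Triangle.mk f g h ∈ distTriang C) {W : C} (x : W ⟶ Y)
    (hx : x ≫ g = 0) : ∃ u : W ⟶ X, x = u ≫ f :=
  Triangle.coyoneda_exact₂ _ hT x hx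

lemma dist_lift₃ (hT : Triangle.mk f g h ∈ distTriang C) {W : C} (x : W ⟶ Z)
    (hx : x ≫ h = 0) : ∃ u : W ⟶ Y, x = u ≫ g :=
  Triangle.coyoneda_exact₃ _ hT x hx

lemma dist_lift₄ (hT : Triangle.mk f g h ∈ distTriang C) {W : C} (x : W ⟶ X⟦(1 : ℤ)⟧)
    (hx : x ≫ f⟦(1 : ℤ)⟧' = 0) : ∃ u : W ⟶ Z, x = u ≫ h :=
  Triangle.coyoneda_exact₁ _ hT x hx

lemma dist_desc₂ (hT : Triangle.mk f g h ∈ distTriang C) {W : C} (x : Y ⟶ W)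
    (hx : f ≫ x = 0) : ∃ u : Z ⟶ W, x = g ≫ u :=
  Triangle.yoneda_exact₂ _ hT x hx

lemma dist_desc₃ (hT : Triangle.mk f g h ∈ distTriang C) {W : C} (x : Z ⟶ W)
    (hx : g ≫ x = 0) : ∃ u : X⟦(1 : ℤ)⟧ ⟶ W, x = h ≫ u :=
  Triangle.yoneda_exact₃ _ hT x hx

lemma dist_desc₄ (hT : Triangle.mk f g h ∈ distTriang C) {W : C} (x : X⟦(1 : ℤ)⟧ ⟶ W)
    (hx : h ≫ x = 0) : ∃ u : Y⟦(1 : ℤ)⟧ ⟶ W, x = f⟦(1 : ℤ)⟧' ≫ u := by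
  obtain ⟨u, hu⟩ := dist_desc₃ (dist_rotate hT) x hx
  exact ⟨-u, by rw [hu, Preadditive.neg_comp, Preadditive.comp_neg]⟩

end Triangles

lemma subsingleton_hom_iff {X Y : C} : Subsingleton (X ⟶ Y) ↔ ∀ f : X ⟶ Y, f = 0 :=
  ⟨fun _ _ => Subsingleton.elim _ _, fun h => ⟨fun f g => by rw [h f, h g]⟩⟩

/-- A covariant dimension estimate for a distinguished triangle. -/
lemma finrank_hom_to_mid_le {X Y Z : C} {f : X ⟶ Y} {g : Y ⟶ Z} {h : Z ⟶ X⟦(1 : ℤ)⟧}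
    (hT : Triangle.mk f g h ∈ distTriang C) (W : C)
    [FiniteDimensional k (W ⟶ X)] [FiniteDimensional k (W ⟶ Z)] :
    FiniteDimensional k (W ⟶ Y) ∧
    finrank k (W ⟶ Y) ≤ finrank k (W ⟶ X) +
      finrank k (LinearMap.range (Linear.rightComp k W g)) := by
  refine finrank_le_of_exact (Linear.rightComp k W f) (Linear.rightComp k W g) ?_
  intro v hv
  obtain ⟨g, hg⟩ := dist_lift₂ hT v hv
  exact ⟨g, hg.symm⟩

/-- A contravariant dimension estimate for a distinguished triangle. -/
lemma finrank_hom_from_mid_le {X Y Z : C} {f : X ⟶ Y} {g : Y ⟶ Z} {h : Z ⟶ X⟦(1 : ℤ)⟧}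
    (hT : Triangle.mk f g h ∈ distTriang C) (W : C)
    [FiniteDimensional k (X ⟶ W)] [FiniteDimensional k (Z ⟶ W)] :
    FiniteDimensional k (Y ⟶ W) ∧
    finrank k (Y ⟶ W) ≤ finrank k (Z ⟶ W) + finrank k (X ⟶ W) := by
  have := finrank_le_of_exact (Linear.leftComp k W g) (Linear.leftComp k W f) ?_
  · refine ⟨this.1, this.2.trans ?_⟩
    have := Submodule.finrank_le (LinearMap.range (Linear.leftComp k W f))
    omega
  intro v hv
  obtain ⟨g, hg⟩ := dist_desc₂ hT v hv
  exact ⟨g, hg.symm⟩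

/-- If a triangle induces a short exact sequence of contravariant morphism spaces, then
dimensions add up. -/
lemma finrank_hom_from_mid_eq {X Y Z : C} {f : X ⟶ Y} {g : Y ⟶ Z} {h : Z ⟶ X⟦(1 : ℤ)⟧}
    (hT : Triangle.mk f g h ∈ distTriang C) (W : C)
    [FiniteDimensional k (Y ⟶ W)]
    (h₁ : ∀ x : Z ⟶ W, g ≫ x = 0 → x = 0)
    (h₂ : ∀ v : X ⟶ W, ∃ w : Y ⟶ W, f ≫ w = v) :
    finrank k (Y ⟶ W) = finrank k (Z ⟶ W) + finrank k (X ⟶ W) := by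
  refine finrank_eq_of_exact (Linear.leftComp k W g) (Linear.leftComp k W f)
    ?_ ?_ ?_ h₂
  · intro v hv
    obtain ⟨g, hg⟩ := dist_desc₂ hT v hv
    exact ⟨g, hg.symm⟩
  · intro u
    change f ≫ g ≫ u = 0
    rw [← Category.assoc, dist_comp₁₂ hT, zero_comp]
  · rw [injective_iff_map_eq_zero]
    exact h₁

end ExactSequences

section CompactObjects

variable {k : Type u} [Field k]
variable {C : Type u} [Category.{v} C] [Preadditive C] [HasZeroObject C] [HasShift C ℤ]
  [∀ n : ℤ, (shiftFunctor C n).Additive] [Pretriangulated C]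
  [Linear k C] [HasFiniteBiproducts C] [∀ n : ℤ, Functor.Linear k (shiftFunctor C n)]
variable {Co : Type u} [Category.{v} Co] [Preadditive Co] [HasZeroObject Co] [HasShift Co ℤ]
  [∀ n : ℤ, (shiftFunctor Co n).Additive] [Pretriangulated Co]
  [Linear k Co] [HasFiniteBiproducts Co] [∀ n : ℤ, Functor.Linear k (shiftFunctor Co n)]

open Module

lemma LinearEquiv.forall_eq_zero {K A B : Type*} [Field K] [AddCommGroup A] [AddCommGroup B]
    [Module K A] [Module K B] (e : A ≃ₗ[K] B) (h : ∀ b : B, b = 0) (a : A) : a = 0 :=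
  e.injective (by rw [map_zero, h (e a)])

lemma cardinal_sum_natCast {n : ℤ → ℕ} (hn : n.support.Finite) :
    Cardinal.sum (fun i => (n i : Cardinal.{v})) = ((∑ᶠ i, n i : ℕ) : Cardinal.{v}) := by
  have e : (Σ i : ℤ, ULift.{v} (Fin (n i))) ≃ Σ i : hn.toFinset, Fin (n i) :=
    { toFun := fun x => ⟨⟨x.1, by
          rw [Set.Finite.mem_toFinset, Function.mem_support]
          have := x.2.down.2
          omega⟩, x.2.down⟩
      invFun := fun x => ⟨x.1, ⟨x.2⟩⟩
      left_inv := fun _ => rfl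
      right_inv := fun _ => rfl }
  have h1 := Cardinal.mk_sigma (fun i : ℤ => ULift.{v} (Fin (n i)))
  have h2 : ∀ i, Cardinal.mk (ULift.{v} (Fin (n i))) = n i := fun i => by simp
  simp only [h2] at h1
  rw [← h1, ← Cardinal.lift_id'.{0, v} (Cardinal.mk (Σ i : ℤ, ULift.{v} (Fin (n i)))),
    Cardinal.mk_congr_lift e, finsum_eq_sum _ hn]
  rw [Cardinal.mk_fintype, Fintype.card_sigma, Cardinal.lift_natCast]
  simp only [Fintype.card_fin]
  rw [Finset.sum_coe_sort hn.toFinset n]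

namespace FinitelyBuilt

variable {R₀ : C}

lemma of_cone₁ {X Y Z : C} (f : X ⟶ Y) (g : Y ⟶ Z) (h : Z ⟶ X⟦(1 : ℤ)⟧)
    (hT : Triangle.mk f g h ∈ distTriang C) (hY : FinitelyBuilt C R₀ Y)
    (hZ : FinitelyBuilt C R₀ Z) : FinitelyBuilt C R₀ X :=
  (((hY.cone g h _ (dist_rotate hT) hZ).shift (-1))).iso
    ((shiftFunctorCompIsoId C (1 : ℤ) (-1) (by omega)).app X)

lemma of_cone₂ {X Y Z : C} (f : X ⟶ Y) (g : Y ⟶ Z) (h : Z ⟶ X⟦(1 : ℤ)⟧)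
    (hT : Triangle.mk f g h ∈ distTriang C) (hX : FinitelyBuilt C R₀ X)
    (hZ : FinitelyBuilt C R₀ Z) : FinitelyBuilt C R₀ Y :=
  of_cone₁ g h _ (dist_rotate hT) hZ (hX.shift 1)

lemma of_isZero (hne : FinitelyBuilt C R₀ R₀) {Z : C} (hZ : IsZero Z) : FinitelyBuilt C R₀ Z :=
  hne.retract 0 0 (hZ.eq_of_src _ _)

lemma biprod {X Y : C} (hX : FinitelyBuilt C R₀ X) (hY : FinitelyBuilt C R₀ Y) :
    FinitelyBuilt C R₀ (X ⊞ Y) :=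
  of_cone₂ _ _ _ (binaryBiproductTriangle_distinguished X Y) hX hY

end FinitelyBuilt

namespace DGSetup

variable (S : DGSetup k C Co)

/-- The sphere object whose covariant functor computes `H^j`. -/
abbrev cell (j : ℤ) : C := S.R⟦-j⟧

lemma cell_mem (j : ℤ) : S.cell j ∈ S.Dc := FinitelyBuilt.base.shift _

lemma nonempty_cell_cell (i j : ℤ) :
    Nonempty ((S.cell i ⟶ S.cell j) ≃ₗ[k] (S.R ⟶ S.R⟦i - j⟧)) :=
  nonempty_shiftHom_right k S.R S.R _ _ _ (by omega)

lemma nonempty_cell_shift (V : C) (i j l : ℤ) (h : i + j = l) :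
    Nonempty ((S.cell i ⟶ V⟦j⟧) ≃ₗ[k] (S.cell l ⟶ V)) :=
  nonempty_shiftHom_left k S.R V _ _ _ (by omega)

lemma nonempty_cell_eq (V : C) (i : ℤ) :
    Nonempty ((S.cell i ⟶ V) ≃ₗ[k] (S.R ⟶ V⟦i⟧)) := by
  obtain ⟨e⟩ := nonempty_shiftHom_left k S.R V 0 i (-i) (by omega)
  exact ⟨e.symm.trans (Linear.homCongr k ((shiftFunctorZero C ℤ).app S.R) (Iso.refl _))⟩

/-- The cohomology of `M` vanishes in degrees below `i`. -/
def InfGE (M : C) (i : ℤ) : Prop := ∀ j < i, ∀ f : S.cell j ⟶ M, f = 0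

variable {S}

lemma InfGE.mono {M : C} {i j : ℤ} (h : S.InfGE M i) (hij : j ≤ i) : S.InfGE M j :=
  fun l hl => h l (by omega)

lemma InfGE.shift {M : C} {i : ℤ} (h : S.InfGE M i) (n l : ℤ) (hl : l = i - n) :
    S.InfGE (M⟦n⟧) l := by
  intro j hj
  obtain ⟨e⟩ := S.nonempty_cell_shift M j n (j + n) rfl
  exact e.forall_eq_zero (h _ (by omega))

variable (S)

lemma exists_infGE_forall_eq_zero {M : C} (hM : M ∈ S.Dc) :
    ∃ c : ℤ, ∀ V : C, S.InfGE V c → ∀ f : M ⟶ V, f = 0 := by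
  have key : ∀ {M : C}, (∃ c : ℤ, ∀ V : C, S.InfGE V c → ∀ f : M ⟶ V, f = 0) → ∀ n : ℤ,
      ∃ c : ℤ, ∀ V : C, S.InfGE V c → ∀ f : M⟦n⟧ ⟶ V, f = 0 := by
    rintro M ⟨c, hc⟩ n
    refine ⟨c - n, fun V hV => ?_⟩
    obtain ⟨e⟩ := nonempty_shiftHom_right k M (V⟦-n⟧) n 0 (-n) (by omega)
    let e' : (M⟦n⟧ ⟶ V) ≃ₗ[k] (M ⟶ V⟦-n⟧) :=
      (shiftHomEquiv k _ _ (-n)).trans (Linear.homCongr k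
        ((shiftFunctorCompIsoId C n (-n) (by omega)).app M) (Iso.refl _))
    exact e'.forall_eq_zero (hc _ (hV.shift (-n) _ (by omega)))
  change FinitelyBuilt C S.R M at hM
  induction hM with
  | base =>
    refine ⟨1, fun V hV => ?_⟩
    exact (Linear.homCongr k ((shiftFunctorZero' C (-0 : ℤ) (by simp)).app S.R).symm
      (Iso.refl V)).forall_eq_zero (hV 0 (by omega))
  | iso e _ ih =>
    obtain ⟨c, hc⟩ := ih
    refine ⟨c, fun V hV f => ?_⟩
    rw [← cancel_epi e.hom, hc V hV (e.hom ≫ f), comp_zero]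
  | shift n _ ih => exact key ih n
  | cone f g h hT _ _ ih₁ ih₂ =>
    obtain ⟨c₁, hc₁⟩ := key ih₁ 1
    obtain ⟨c₂, hc₂⟩ := ih₂
    refine ⟨max c₁ c₂, fun V hV x => ?_⟩
    obtain ⟨y, hy⟩ := dist_desc₃ hT x (hc₂ V (hV.mono (le_max_right _ _)) _)
    rw [hy]
    have := hc₁ V (hV.mono (le_max_left _ _)) y
    rw [this, comp_zero]
  | retract i r hir _ ih =>
    obtain ⟨c, hc⟩ := ih
    refine ⟨c, fun V hV f => ?_⟩
    rw [← Category.id_comp f, ← hir, Category.assoc, hc V hV (r ≫ f), comp_zero]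

lemma isZero_of_forall_infGE {M : C} (hM : M ∈ S.Dc) (h : ∀ j, ∀ f : S.cell j ⟶ M, f = 0) :
    IsZero M := by
  obtain ⟨c, hc⟩ := S.exists_infGE_forall_eq_zero hM
  exact (IsZero.iff_id_eq_zero M).2 (hc M (fun j _ => h j) _)

/-- `V` has finite-dimensional total cohomology. -/
def FinCoh (V : C) : Prop :=
  (∀ j : ℤ, FiniteDimensional k (S.cell j ⟶ V)) ∧ {j : ℤ | ∃ f : S.cell j ⟶ V, f ≠ 0}.Finite

lemma finTotalExt_of_finCoh {V : C} (hV : S.FinCoh V) {M : C} (hM : M ∈ S.Dc) :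
    (∀ i : ℤ, FiniteDimensional k (M ⟶ V⟦i⟧)) ∧ {i : ℤ | ∃ f : M ⟶ V⟦i⟧, f ≠ 0}.Finite := by
  have key : ∀ {M : C}, ((∀ i : ℤ, FiniteDimensional k (M ⟶ V⟦i⟧)) ∧
      {i : ℤ | ∃ f : M ⟶ V⟦i⟧, f ≠ 0}.Finite) → ∀ n : ℤ,
      ((∀ i : ℤ, FiniteDimensional k (M⟦n⟧ ⟶ V⟦i⟧)) ∧
      {i : ℤ | ∃ f : M⟦n⟧ ⟶ V⟦i⟧, f ≠ 0}.Finite) := by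
    rintro M ⟨h₁, h₂⟩ n
    have e := fun i => nonempty_shiftHom_right k M V n i (i - n) (by omega)
    refine ⟨fun i => ?_, (h₂.image (fun j => j + n)).subset ?_⟩
    · have := h₁ (i - n)
      exact (e i).some.symm.finiteDimensional
    · rintro i ⟨f, hf⟩
      refine ⟨i - n, ⟨(e i).some f, ?_⟩, by simp⟩
      rwa [Ne, LinearEquiv.map_eq_zero_iff]
  change FinitelyBuilt C S.R M at hM
  induction hM with
  | base =>
    have e := fun i => S.nonempty_cell_eq V i
    refine ⟨fun i => ?_, hV.2.subset ?_⟩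
    · have := hV.1 i
      exact (e i).some.finiteDimensional
    · rintro i ⟨f, hf⟩
      refine ⟨(e i).some.symm f, ?_⟩
      rwa [Ne, LinearEquiv.map_eq_zero_iff]
  | iso e _ ih =>
    refine ⟨fun i => ?_, ih.2.subset ?_⟩
    · have := ih.1 i
      exact (Linear.homCongr k e (Iso.refl (V⟦i⟧))).finiteDimensional
    · rintro i ⟨f, hf⟩
      refine ⟨e.hom ≫ f, ?_⟩
      simpa using hf
  | shift n _ ih => exact key ih n
  | cone f g h hT _ _ ih₁ ih₂ =>
    replace ih₁ := key ih₁ 1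
    have hT' := dist_rotate hT
    refine ⟨fun i => ?_, (ih₁.2.union ih₂.2).subset ?_⟩
    · have := ih₁.1 i
      have := ih₂.1 i
      exact (finrank_hom_from_mid_le hT' (V⟦i⟧) (k := k)).1
    · rintro i ⟨x, hx⟩
      by_contra hcon
      simp only [Set.mem_union, Set.mem_ofPred_eq, not_or, not_exists, not_not] at hcon
      obtain ⟨y, hy⟩ := dist_desc₃ hT x (hcon.2 _)
      have := hcon.1 y
      rw [this, comp_zero] at hy
      exact hx hy
  | retract i r hir _ ih =>
    refine ⟨fun j => ?_, ih.2.subset ?_⟩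
    · have := ih.1 j
      refine FiniteDimensional.of_injective (Linear.leftComp k (V⟦j⟧) r) ?_
      intro a b hab
      change r ≫ a = r ≫ b at hab
      rw [← Category.id_comp a, ← hir, Category.assoc, hab, ← Category.assoc, hir,
        Category.id_comp]
    · rintro j ⟨f, hf⟩
      refine ⟨r ≫ f, fun h => hf ?_⟩
      rw [← Category.id_comp f, ← hir, Category.assoc, h, comp_zero]

lemma finCoh_of_mem {V : C} (hV : V ∈ S.Dc) : S.FinCoh V := by
  have key : ∀ {V : C}, S.FinCoh V → ∀ n : ℤ, S.FinCoh (V⟦n⟧) := by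
    rintro V ⟨h₁, h₂⟩ n
    have e := fun i => S.nonempty_cell_shift V i n (i + n) rfl
    refine ⟨fun i => ?_, (h₂.image (fun j => j - n)).subset ?_⟩
    · have := h₁ (i + n)
      exact (e i).some.symm.finiteDimensional
    · rintro i ⟨f, hf⟩
      refine ⟨i + n, ⟨(e i).some f, ?_⟩, by simp⟩
      rwa [Ne, LinearEquiv.map_eq_zero_iff]
  change FinitelyBuilt C S.R V at hV
  induction hV with
  | base =>
    have e := fun i => S.nonempty_cell_eq S.R i
    refine ⟨fun i => ?_, S.HR_bdd.subset ?_⟩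
    · have := S.HR_findim i
      exact (e i).some.symm.finiteDimensional
    · rintro i ⟨f, hf⟩
      refine ⟨(e i).some f, 0, ?_⟩
      rwa [Ne, LinearEquiv.map_eq_zero_iff]
  | iso e _ ih =>
    refine ⟨fun i => ?_, ih.2.subset ?_⟩
    · have := ih.1 i
      exact (Linear.homCongr k (Iso.refl (S.cell i)) e).finiteDimensional
    · rintro i ⟨f, hf⟩
      refine ⟨f ≫ e.inv, ?_⟩
      simpa using hf
  | shift n _ ih => exact key ih n
  | cone f g h hT _ _ ih₁ ih₂ =>
    replace ih₁ := key ih₁ 1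
    have hT' := dist_rotate hT
    refine ⟨fun i => ?_, (ih₁.2.union ih₂.2).subset ?_⟩
    · have := ih₁.1 i
      have := ih₂.1 i
      exact (finrank_hom_to_mid_le hT' (S.cell i) (k := k)).1
    · rintro i ⟨x, hx⟩
      by_contra hcon
      simp only [Set.mem_union, Set.mem_ofPred_eq, not_or, not_exists, not_not] at hcon
      obtain ⟨y, hy⟩ := dist_lift₃ hT x (hcon.1 _)
      have := hcon.2 y
      rw [this, zero_comp] at hy
      exact hx hy
  | retract i r hir _ ih =>
    refine ⟨fun j => ?_, ih.2.subset ?_⟩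
    · have := ih.1 j
      refine FiniteDimensional.of_injective (Linear.rightComp k (S.cell j) i) ?_
      intro a b hab
      change a ≫ i = b ≫ i at hab
      rw [← Category.comp_id a, ← hir, ← Category.assoc, hab, Category.assoc, hir,
        Category.comp_id]
    · rintro j ⟨f, hf⟩
      refine ⟨f ≫ i, fun h => hf ?_⟩
      rw [← Category.comp_id f, ← hir, ← Category.assoc, h, zero_comp]

lemma finCoh_kMod : S.FinCoh S.kMod := by
  have e := fun i => S.nonempty_cell_eq S.kMod i
  have hne : ∀ i : ℤ, i ≠ 0 → ∀ f : S.cell i ⟶ S.kMod, f = 0 := fun i hi =>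
    (e i).some.forall_eq_zero (fun b => (S.Hk_ne i hi).elim _ _)
  refine ⟨fun i => ?_, (Set.finite_singleton (0 : ℤ)).subset ?_⟩
  · by_cases hi : i = 0
    · subst hi
      exact ((e 0).some.trans S.Hk_zero.some).symm.finiteDimensional
    · have := subsingleton_hom_iff.2 (hne i hi)
      infer_instance
  · rintro i ⟨f, hf⟩
    by_contra hi
    exact hf (hne i hi f)

lemma finiteDimensional_hom {M V : C} (hM : M ∈ S.Dc) (hV : V ∈ S.Dc) :
    FiniteDimensional k (M ⟶ V) := by
  have := (S.finTotalExt_of_finCoh (S.finCoh_of_mem hV) hM).1 0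
  exact (Linear.homCongr k (Iso.refl M) ((shiftFunctorZero C ℤ).app V)).finiteDimensional

lemma finiteDimensional_hom_kMod {M : C} (hM : M ∈ S.Dc) (i : ℤ) :
    FiniteDimensional k (M ⟶ S.kMod⟦i⟧) :=
  (S.finTotalExt_of_finCoh S.finCoh_kMod hM).1 i

/-! ### Morphisms between cells -/

lemma cell_cell_eq_zero_of_lt {i j : ℤ} (h : i < j) (f : S.cell i ⟶ S.cell j) : f = 0 :=
  (S.nonempty_cell_cell i j).some.forall_eq_zero
    (fun _ => (S.HR_neg (i - j) (by omega)).elim _ _) f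

lemma cell_cell_eq_zero_of_succ {i j : ℤ} (h : i = j + 1) (f : S.cell i ⟶ S.cell j) : f = 0 := by
  refine (S.nonempty_cell_cell i j).some.forall_eq_zero (fun _ => ?_) f
  have := S.HR_one
  rw [show (1 : ℤ) = i - j by omega] at this
  exact this.elim _ _

lemma cell_cell_eq_zero_of_gt {i j : ℤ} (h : S.d < i - j) (f : S.cell i ⟶ S.cell j) : f = 0 := by
  refine (S.nonempty_cell_cell i j).some.forall_eq_zero (fun b => ?_) f
  by_contra hb
  have := S.d_greatest _ ⟨b, 0, hb⟩
  omega

lemma exists_cell_cell_ne_zero {i j : ℤ} (h : i - j = S.d) : ∃ f : S.cell i ⟶ S.cell j, f ≠ 0 := by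
  obtain ⟨e⟩ := S.nonempty_cell_cell i j
  rw [h] at e
  obtain ⟨a, ha⟩ := @exists_ne _ S.d_mem 0
  refine ⟨e.symm a, ?_⟩
  rwa [Ne, LinearEquiv.map_eq_zero_iff]

lemma finrank_cell_cell (i : ℤ) : finrank k (S.cell i ⟶ S.cell i) = 1 := by
  obtain ⟨e⟩ := S.nonempty_cell_cell i i
  rw [show i - i = 0 by omega] at e
  rw [(e.trans S.HR_zero.some).finrank_eq, finrank_self]

lemma id_cell_ne_zero (i : ℤ) : 𝟙 (S.cell i) ≠ 0 := by
  intro h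
  have h1 := S.finrank_cell_cell i
  have : Subsingleton (S.cell i ⟶ S.cell i) := subsingleton_hom_iff.2 fun f => by
    rw [← Category.id_comp f, h, zero_comp]
  rw [finrank_zero_of_subsingleton] at h1
  omega

lemma exists_smul_id_cell {i : ℤ} (f : S.cell i ⟶ S.cell i) :
    ∃ c : k, f = c • 𝟙 (S.cell i) := by
  obtain ⟨c, hc⟩ := (finrank_eq_one_iff_of_nonzero' (𝟙 (S.cell i)) (S.id_cell_ne_zero i)).1
    (S.finrank_cell_cell i) f
  exact ⟨c, hc.symm⟩

lemma nonempty_cell_kMod (i j : ℤ) :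
    Nonempty ((S.cell i ⟶ S.kMod⟦j⟧) ≃ₗ[k] (S.R ⟶ S.kMod⟦i + j⟧)) :=
  nonempty_shiftHom_right k _ _ _ _ _ (by omega)

lemma cell_kMod_eq_zero {i j : ℤ} (h : i + j ≠ 0) (f : S.cell i ⟶ S.kMod⟦j⟧) : f = 0 :=
  (S.nonempty_cell_kMod i j).some.forall_eq_zero (fun _ => (S.Hk_ne _ h).elim _ _) f

lemma finrank_cell_kMod {i j : ℤ} (h : i + j = 0) : finrank k (S.cell i ⟶ S.kMod⟦j⟧) = 1 := by
  obtain ⟨e⟩ := S.nonempty_cell_kMod i j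
  rw [h] at e
  rw [(e.trans S.Hk_zero.some).finrank_eq, finrank_self]

lemma d_nonneg : 0 ≤ S.d := by
  by_contra h
  have := S.d_mem
  rw [← not_subsingleton_iff_nontrivial] at this
  exact this (S.HR_neg _ (by omega))

lemma two_le_d (h2 : 2 ≤ S.dimH) : 2 ≤ S.d := by
  by_contra h
  have h0 := S.d_nonneg
  have hd : S.d ≠ 1 := by
    intro h1
    have := S.d_mem
    rw [← not_subsingleton_iff_nontrivial, h1] at this
    exact this S.HR_one
  have hd0 : S.d = 0 := by omega
  have hle : S.dimH ≤ 1 := by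
    unfold dimH
    have hz : ∀ i : ℤ, i ≠ 0 → Module.rank k (S.H S.R i) = 0 := by
      intro i hi
      have : Subsingleton (S.H S.R i) := by
        by_contra hc
        rw [not_subsingleton_iff_nontrivial] at hc
        have h1 := S.d_greatest i hc
        have := S.HR_neg i (by omega)
        exact (not_subsingleton_iff_nontrivial.2 hc) this
      exact rank_subsingleton' k _
    have hr : (fun i : ℤ => Module.rank k (S.H S.R i)) =
        fun i => ((finrank k (S.H S.R i) : ℕ) : Cardinal) := by
      funext i
      have := S.HR_findim i
      exact (finrank_eq_rank' k _).symm
    have hz' : ∀ i : ℤ, i ≠ 0 → finrank k (S.H S.R i) = 0 := fun i hi => by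
      rw [finrank, hz i hi, map_zero]
    have h1 : finrank k (S.H S.R 0) = 1 := by rw [S.HR_zero.some.finrank_eq, finrank_self]
    rw [hr, cardinal_sum_natCast ((Set.finite_singleton (0 : ℤ)).subset fun i hi => by
      by_contra hc
      exact hi (hz' i hc)), finsum_eq_single _ 0 hz', h1, Nat.cast_one]
  exact absurd (h2.trans hle) (by norm_num)

end DGSetup

end CompactObjects

section CellInduction

variable {k : Type u} [Field k]
variable {C : Type u} [Category.{v} C] [Preadditive C] [HasZeroObject C] [HasShift C ℤ]
  [∀ n : ℤ, (shiftFunctor C n).Additive] [Pretriangulated C]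
  [Linear k C] [HasFiniteBiproducts C] [∀ n : ℤ, Functor.Linear k (shiftFunctor C n)]
variable {Co : Type u} [Category.{v} Co] [Preadditive Co] [HasZeroObject Co] [HasShift Co ℤ]
  [∀ n : ℤ, (shiftFunctor Co n).Additive] [Pretriangulated Co]
  [Linear k Co] [HasFiniteBiproducts Co] [∀ n : ℤ, Functor.Linear k (shiftFunctor Co n)]

open Module

namespace DGSetup

variable (S : DGSetup k C Co)

/-- The suspension of a cell is a cell. -/
def cellShiftIso (j l : ℤ) (h : l = j + 1) : S.cell j ≅ (S.cell l)⟦(1 : ℤ)⟧ :=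
  (shiftFunctorAdd' C (-l) 1 (-j) (by omega)).app S.R

lemma cell_shift_eq_zero {W : C} (i j : ℤ) (h : ∀ f : S.cell (i + j) ⟶ W, f = 0)
    (f : S.cell i ⟶ W⟦j⟧) : f = 0 :=
  (S.nonempty_cell_shift W i j _ rfl).some.forall_eq_zero h f

variable {S}

lemma smul_comp_ne_zero {i : ℤ} {M : C} {x : S.cell i ⟶ M} (hx : x ≠ 0) (f : S.cell i ⟶ S.cell i)
    (hf : f ≫ x = 0) : f = 0 := by
  obtain ⟨c, rfl⟩ := S.exists_smul_id_cell f
  rw [Linear.smul_comp, Category.id_comp] at hf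
  rcases smul_eq_zero.1 hf with h | h
  · rw [h, zero_smul]
  · exact absurd h hx

lemma infGE_cone {i : ℤ} {M M₁ : C} (hM : S.InfGE M i) {x : S.cell i ⟶ M} (hx : x ≠ 0)
    {y : M ⟶ M₁} {z : M₁ ⟶ (S.cell i)⟦(1 : ℤ)⟧} (hT : Triangle.mk x y z ∈ distTriang C) :
    S.InfGE M₁ i := by
  intro j hj f
  have hz : f ≫ z = 0 := by
    rcases (show j + 1 < i ∨ i = j + 1 by omega) with h | h
    · exact S.cell_shift_eq_zero _ _ (S.cell_cell_eq_zero_of_lt h) _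
    · let e := S.cellShiftIso j i h
      obtain ⟨g, hg⟩ := (shiftFunctor C (1 : ℤ)).map_surjective (e.inv ≫ f ≫ z)
      have h0 : g ≫ x = 0 := by
        apply (shiftFunctor C (1 : ℤ)).map_injective
        rw [Functor.map_comp, hg, Functor.map_zero, Category.assoc, Category.assoc,
          dist_comp₃₁ hT, comp_zero, comp_zero]
      rw [smul_comp_ne_zero hx g h0, Functor.map_zero] at hg
      rw [← cancel_epi e.inv, ← hg, comp_zero]
  obtain ⟨u, rfl⟩ := dist_lift₃ hT f hz
  rw [hM j hj u, zero_comp]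

lemma finrank_cone {i : ℤ} {M M₁ : C} (hMc : M ∈ S.Dc) {x : S.cell i ⟶ M}
    (hx : x ≠ 0) {y : M ⟶ M₁} {z : M₁ ⟶ (S.cell i)⟦(1 : ℤ)⟧}
    (hT : Triangle.mk x y z ∈ distTriang C) :
    finrank k (S.cell i ⟶ M) = finrank k (S.cell i ⟶ M₁) + 1 := by
  have := S.finiteDimensional_hom (S.cell_mem i) hMc
  rw [finrank_eq_of_exact (Linear.rightComp k (S.cell i) x) (Linear.rightComp k (S.cell i) y),
    S.finrank_cell_cell, add_comm]
  · intro v hv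
    obtain ⟨u, hu⟩ := dist_lift₂ hT v hv
    exact ⟨u, hu.symm⟩
  · intro u
    change (u ≫ x) ≫ y = 0
    rw [Category.assoc, dist_comp₁₂ hT, comp_zero]
  · rw [injective_iff_map_eq_zero]
    exact smul_comp_ne_zero hx
  · intro v
    have hv : v ≫ z = 0 := S.cell_shift_eq_zero _ _ (S.cell_cell_eq_zero_of_succ rfl) _
    obtain ⟨u, hu⟩ := dist_lift₃ hT v hv
    exact ⟨u, hu.symm⟩

lemma exists_infGE_succ {i : ℤ} {M : C} (hMc : M ∈ S.Dc) (hM : S.InfGE M i) :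
    ∃ M' ∈ S.Dc, S.InfGE M' (i + 1) ∧ ∃ y : M ⟶ M', ∀ j : ℤ, j ≠ -i →
      ∀ v : M ⟶ S.kMod⟦j⟧, ∃ w, v = y ≫ w := by
  obtain ⟨n, hn⟩ : ∃ n, finrank k (S.cell i ⟶ M) = n := ⟨_, rfl⟩
  induction n generalizing M with
  | zero =>
    refine ⟨M, hMc, fun j hj => ?_, 𝟙 M, fun j _ v => ⟨v, by simp⟩⟩
    rcases (show j < i ∨ j = i by omega) with h | rfl
    · exact hM j h
    · have := S.finiteDimensional_hom (S.cell_mem j) hMc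
      have := finrank_zero_iff.1 hn
      exact subsingleton_hom_iff.1 this
  | succ n ih =>
    obtain ⟨x, hx⟩ : ∃ x : S.cell i ⟶ M, x ≠ 0 := by
      by_contra hc
      push Not at hc
      have := subsingleton_hom_iff.2 hc
      rw [finrank_zero_of_subsingleton] at hn
      omega
    obtain ⟨M₁, y, z, hT⟩ := distinguished_cocone_triangle x
    obtain ⟨M', hM', hi, y', hy'⟩ := ih (FinitelyBuilt.cone x y z hT (S.cell_mem i) hMc)
      (infGE_cone hM hx hT) (by have := finrank_cone hMc hx hT; omega)
    refine ⟨M', hM', hi, y ≫ y', fun j hj v => ?_⟩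
    obtain ⟨v₁, rfl⟩ := dist_desc₂ hT v (S.cell_kMod_eq_zero (by omega) _)
    obtain ⟨w, rfl⟩ := hy' j hj v₁
    exact ⟨w, (Category.assoc _ _ _).symm⟩

/-- Vanishing of `Ext(M, k)` in degrees above minus the infimum of `M`. -/
lemma InfGE.hom_kMod_eq_zero {i : ℤ} {M : C} (hM : S.InfGE M i) (hMc : M ∈ S.Dc) {j : ℤ}
    (hj : -i < j) (v : M ⟶ S.kMod⟦j⟧) : v = 0 := by
  obtain ⟨c, hc⟩ := S.exists_infGE_forall_eq_zero hMc
  have key : ∀ n : ℕ, ∃ M' ∈ S.Dc, S.InfGE M' (i + n) ∧ ∃ (y : M ⟶ M')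
      (w : M' ⟶ S.kMod⟦j⟧), v = y ≫ w := by
    intro n
    induction n with
    | zero => exact ⟨M, hMc, by simpa using hM, 𝟙 M, v, by simp⟩
    | succ n ih =>
      obtain ⟨M', hM', hi, y, w, rfl⟩ := ih
      obtain ⟨M'', hM'', hi', y', hy'⟩ := exists_infGE_succ hM' hi
      obtain ⟨w', rfl⟩ := hy' j (by omega) w
      exact ⟨M'', hM'', by push_cast; rwa [← add_assoc], y ≫ y', w', (Category.assoc _ _ _).symm⟩
  obtain ⟨M', -, hi, y, w, rfl⟩ := key (c - i).toNat
  rw [hc M' (hi.mono (by omega)) y, zero_comp]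

variable (S)

/-- The total dimension of `Ext(M, k)`, as a natural number. -/
noncomputable def phiN (M : C) : ℕ := ∑ᶠ i : ℤ, finrank k (M ⟶ S.kMod⟦i⟧)

lemma support_phiN {M : C} (hM : M ∈ S.Dc) :
    (Function.support fun i : ℤ => finrank k (M ⟶ S.kMod⟦i⟧)).Finite := by
  refine (S.finTotalExt_of_finCoh S.finCoh_kMod hM).2.subset fun i hi => ?_
  by_contra hc
  simp only [Set.mem_ofPred_eq, not_exists, not_not] at hc
  have := subsingleton_hom_iff.2 hc
  exact hi finrank_zero_of_subsingleton

lemma phi_eq {M : C} (hM : M ∈ S.Dc) : S.phi M = (S.phiN M : Cardinal) := by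
  unfold phi phiN
  rw [← cardinal_sum_natCast (S.support_phiN hM)]
  congr 1
  funext i
  have := S.finiteDimensional_hom_kMod hM i
  exact (finrank_eq_rank' k _).symm

lemma phiN_congr {M N : C} (e : M ≅ N) : S.phiN M = S.phiN N :=
  finsum_congr fun i => (Linear.homCongr k e (Iso.refl (S.kMod⟦i⟧))).finrank_eq

lemma phiN_of_isZero {M : C} (hM : IsZero M) : S.phiN M = 0 := by
  unfold phiN
  rw [finsum_eq_zero_of_forall_eq_zero]
  intro i
  have := subsingleton_hom_iff.2 fun f : M ⟶ S.kMod⟦i⟧ => hM.eq_of_src f 0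
  exact finrank_zero_of_subsingleton

lemma phiN_cell (i : ℤ) : S.phiN (S.cell i) = 1 := by
  unfold phiN
  rw [finsum_eq_single _ (-i), S.finrank_cell_kMod (by omega)]
  intro j hj
  have := subsingleton_hom_iff.2 (S.cell_kMod_eq_zero (i := i) (j := j) (by omega))
  exact finrank_zero_of_subsingleton

/-- `φ` is additive on triangles inducing short exact sequences on `Ext(-, k)`. -/
lemma phiN_eq_add {X Y Z : C} {f : X ⟶ Y} {g : Y ⟶ Z} {h : Z ⟶ X⟦(1 : ℤ)⟧}
    (hT : Triangle.mk f g h ∈ distTriang C) (hX : X ∈ S.Dc) (hY : Y ∈ S.Dc) (hZ : Z ∈ S.Dc)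
    (hh : ∀ (j : ℤ) (v : X⟦(1 : ℤ)⟧ ⟶ S.kMod⟦j⟧), h ≫ v = 0) :
    S.phiN Y = S.phiN Z + S.phiN X := by
  unfold phiN
  rw [← finsum_add_distrib (S.support_phiN hZ) (S.support_phiN hX)]
  refine finsum_congr fun j => ?_
  have := S.finiteDimensional_hom_kMod hY j
  refine finrank_hom_from_mid_eq hT _ ?_ ?_
  · intro x hx
    obtain ⟨u, rfl⟩ := dist_desc₃ hT x hx
    exact hh j u
  · intro v
    let e := (shiftFunctorAdd' C j 1 (j + 1) rfl).app S.kMod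
    have h0 : h ≫ v⟦(1 : ℤ)⟧' = 0 := by
      rw [← cancel_mono e.inv, Category.assoc, zero_comp]
      exact hh (j + 1) (v⟦(1 : ℤ)⟧' ≫ e.inv)
    obtain ⟨u, hu⟩ := dist_desc₄ hT _ h0
    obtain ⟨w, rfl⟩ := (shiftFunctor C (1 : ℤ)).map_surjective u
    refine ⟨w, (shiftFunctor C (1 : ℤ)).map_injective ?_⟩
    rw [hu, Functor.map_comp]

lemma phiN_cone {i : ℤ} {M M₁ : C} (hMc : M ∈ S.Dc) (hM₁ : M₁ ∈ S.Dc) (hi : S.InfGE M₁ i)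
    {x : S.cell i ⟶ M} {y : M ⟶ M₁} {z : M₁ ⟶ (S.cell i)⟦(1 : ℤ)⟧}
    (hT : Triangle.mk x y z ∈ distTriang C) :
    S.phiN M = S.phiN M₁ + 1 := by
  rw [S.phiN_eq_add hT (S.cell_mem i) hMc hM₁, S.phiN_cell]
  intro j v
  by_cases hj : -i < j
  · exact hi.hom_kMod_eq_zero hM₁ hj _
  · have : v = 0 := by
      let e := S.cellShiftIso (i - 1) i (by omega)
      rw [← cancel_epi e.hom, S.cell_kMod_eq_zero (by omega) (e.hom ≫ v), comp_zero]
    rw [this, comp_zero]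

lemma exists_infGE {M : C} (hMc : M ∈ S.Dc) (hM : ¬ IsZero M) :
    ∃ i, S.InfGE M i ∧ ∃ x : S.cell i ⟶ M, x ≠ 0 := by
  have hfin := (S.finCoh_of_mem hMc).2
  have hne : {j : ℤ | ∃ f : S.cell j ⟶ M, f ≠ 0}.Nonempty := by
    by_contra hc
    refine hM (S.isZero_of_forall_infGE hMc fun j f => ?_)
    by_contra hf
    exact hc ⟨j, f, hf⟩
  obtain ⟨i, hi, hmin⟩ := hfin.exists_minimal hne
  refine ⟨i, fun j hj f => ?_, hi⟩
  by_contra hf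
  have := hmin (show j ∈ _ from ⟨f, hf⟩) hj.le
  omega

variable {S}

/-- Building a compact object by attaching one cell at a time. -/
theorem cell_induction {Q : C → Prop} (zero : ∀ M, IsZero M → Q M)
    (step : ∀ (i : ℤ) (M M₁ : C) (x : S.cell i ⟶ M) (y : M ⟶ M₁)
      (z : M₁ ⟶ (S.cell i)⟦(1 : ℤ)⟧), Triangle.mk x y z ∈ distTriang C → M ∈ S.Dc →
      M₁ ∈ S.Dc → S.InfGE M i → S.InfGE M₁ i → x ≠ 0 → S.phiN M = S.phiN M₁ + 1 → Q M₁ → Q M)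
    {M : C} (hM : M ∈ S.Dc) : Q M := by
  obtain ⟨n, hn⟩ : ∃ n, S.phiN M = n := ⟨_, rfl⟩
  induction n using Nat.strong_induction_on generalizing M with
  | _ n ih =>
    by_cases h0 : IsZero M
    · exact zero M h0
    obtain ⟨i, hi, x, hx⟩ := S.exists_infGE hM h0
    obtain ⟨M₁, y, z, hT⟩ := distinguished_cocone_triangle x
    have hM₁ : M₁ ∈ S.Dc := FinitelyBuilt.cone x y z hT (S.cell_mem i) hM
    have hi₁ := infGE_cone hi hx hT
    have hphi := S.phiN_cone hM hM₁ hi₁ hT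
    exact step i M M₁ x y z hT hM hM₁ hi hi₁ hx hphi (ih _ (by omega) hM₁ rfl)

lemma phiN_pos {M : C} (hM : M ∈ S.Dc) (h0 : ¬ IsZero M) : 0 < S.phiN M := by
  revert h0
  refine cell_induction (Q := fun M => ¬ IsZero M → 0 < S.phiN M) (fun M h h' => absurd h h')
    ?_ hM
  intros
  omega

lemma InfGE.le_of_ne_zero {M : C} {c i : ℤ} (h : S.InfGE M c) {x : S.cell i ⟶ M} (hx : x ≠ 0) :
    c ≤ i := by
  by_contra hc
  exact hx (h i (by omega) x)

lemma hom_eq_zero_of_infGE {X V : C} (hX : X ∈ S.Dc) {c : ℤ} (hc : S.InfGE X c)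
    (hV : ∀ j, c ≤ j → ∀ f : S.cell j ⟶ V, f = 0) (f : X ⟶ V) : f = 0 := by
  revert hc f
  refine cell_induction (Q := fun X => S.InfGE X c → ∀ f : X ⟶ V, f = 0)
    (fun M h _ f => h.eq_of_src _ _) ?_ hX
  intro i M M₁ x y z hT _ _ _ hi₁ hx _ ih hc f
  have hci := hc.le_of_ne_zero hx
  obtain ⟨u, rfl⟩ := dist_desc₂ hT f (hV i hci _)
  rw [ih (hi₁.mono hci) u, comp_zero]

/-- A nonzero compact object has cohomology at least `d` degrees above its infimum. -/
lemma InfGE.exists_ne_zero {X : C} {c : ℤ} (hc : S.InfGE X c) (hX : X ∈ S.Dc)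
    (h0 : ¬ IsZero X) : ∃ j, c + S.d ≤ j ∧ ∃ f : S.cell j ⟶ X, f ≠ 0 := by
  revert c h0
  refine cell_induction (Q := fun X => ∀ {c : ℤ}, S.InfGE X c → ¬ IsZero X →
    ∃ j, c + S.d ≤ j ∧ ∃ f : S.cell j ⟶ X, f ≠ 0) (fun M h _ _ h' => absurd h h') ?_ hX
  intro i M M₁ x y z hT _ _ _ hi₁ hx _ ih c hc _
  have hci := hc.le_of_ne_zero hx
  by_cases hz : IsZero M₁
  · have : IsIso x := (Triangle.isZero₃_iff_isIso₁ _ hT).1 hz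
    obtain ⟨f, hf⟩ := S.exists_cell_cell_ne_zero (i := i + S.d) (j := i) (by omega)
    refine ⟨i + S.d, by omega, f ≫ x, fun h => hf ?_⟩
    rw [← cancel_mono x, h, zero_comp]
  · obtain ⟨j, hj, f, hf⟩ := ih hi₁ hz
    have hfz : f ≫ z = 0 :=
      S.cell_shift_eq_zero _ _ (S.cell_cell_eq_zero_of_gt (by omega)) _
    obtain ⟨u, rfl⟩ := dist_lift₃ hT f hfz
    refine ⟨j, by omega, u, fun h => hf ?_⟩
    rw [h, zero_comp]

end DGSetup

end CellInduction

section SerrePairs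

variable {k : Type u} [Field k]
variable {C : Type u} [Category.{v} C] [Preadditive C] [HasZeroObject C] [HasShift C ℤ]
  [∀ n : ℤ, (shiftFunctor C n).Additive] [Pretriangulated C]
  [Linear k C] [HasFiniteBiproducts C] [∀ n : ℤ, Functor.Linear k (shiftFunctor C n)]
variable {Co : Type u} [Category.{v} Co] [Preadditive Co] [HasZeroObject Co] [HasShift Co ℤ]
  [∀ n : ℤ, (shiftFunctor Co n).Additive] [Pretriangulated Co]
  [Linear k Co] [HasFiniteBiproducts Co] [∀ n : ℤ, Functor.Linear k (shiftFunctor Co n)]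

open Module

namespace DGSetup

variable (S : DGSetup k C Co)

/-- The functional `l` on `Hom(N, P)` makes `P` represent the dual of `Hom(N, -)` on compact
objects. -/
structure SerrePair (N P : C) (l : (N ⟶ P) →ₗ[k] k) : Prop where
  memN : N ∈ S.Dc
  memP : P ∈ S.Dc
  right : ∀ W ∈ S.Dc, ∀ x : N ⟶ W, (∀ y : W ⟶ P, l (x ≫ y) = 0) → x = 0
  left : ∀ W ∈ S.Dc, ∀ y : W ⟶ P, (∀ x : N ⟶ W, l (x ≫ y) = 0) → y = 0

variable {S}

namespace SerrePair

variable {N P : C} {l : (N ⟶ P) →ₗ[k] k}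

/-- The composition pairing of a Serre pair. -/
noncomputable def pairing (l : (N ⟶ P) →ₗ[k] k) (W : C) :
    (N ⟶ W) →ₗ[k] (W ⟶ P) →ₗ[k] k :=
  LinearMap.mk₂ k (fun x y => l (x ≫ y)) (by intros; simp) (by intros; simp) (by intros; simp)
    (by intros; simp)

lemma injective_pairing (hS : S.SerrePair N P l) {W : C} (hW : W ∈ S.Dc) :
    Function.Injective (pairing l W) := by
  rw [injective_iff_map_eq_zero]
  exact fun x hx => hS.right W hW x fun y => LinearMap.congr_fun hx y

lemma injective_flip_pairing (hS : S.SerrePair N P l) {W : C} (hW : W ∈ S.Dc) :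
    Function.Injective (pairing l W).flip := by
  rw [injective_iff_map_eq_zero]
  exact fun y hy => hS.left W hW y fun x => LinearMap.congr_fun hy x

lemma finrank_eq (hS : S.SerrePair N P l) {W : C} (hW : W ∈ S.Dc) :
    finrank k (N ⟶ W) = finrank k (W ⟶ P) := by
  have := S.finiteDimensional_hom hS.memN hW
  have := S.finiteDimensional_hom hW hS.memP
  apply le_antisymm
  · have := LinearMap.finrank_le_finrank_of_injective (hS.injective_pairing hW)
    rwa [Subspace.dual_finrank_eq] at this
  · have := LinearMap.finrank_le_finrank_of_injective (hS.injective_flip_pairing hW)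
    rwa [Subspace.dual_finrank_eq] at this

lemma exists_right (hS : S.SerrePair N P l) {W : C} (hW : W ∈ S.Dc) (F : (W ⟶ P) →ₗ[k] k) :
    ∃ x : N ⟶ W, ∀ y, F y = l (x ≫ y) := by
  have := S.finiteDimensional_hom hS.memN hW
  have := S.finiteDimensional_hom hW hS.memP
  have hs : Function.Surjective (pairing l W) :=
    (LinearMap.injective_iff_surjective_of_finrank_eq_finrank (by
      rw [Subspace.dual_finrank_eq, hS.finrank_eq hW])).1 (hS.injective_pairing hW)
  obtain ⟨x, rfl⟩ := hs F
  exact ⟨x, fun y => rfl⟩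

lemma exists_left (hS : S.SerrePair N P l) {W : C} (hW : W ∈ S.Dc) (F : (N ⟶ W) →ₗ[k] k) :
    ∃ y : W ⟶ P, ∀ x, F x = l (x ≫ y) := by
  have := S.finiteDimensional_hom hS.memN hW
  have := S.finiteDimensional_hom hW hS.memP
  have hs : Function.Surjective (pairing l W).flip :=
    (LinearMap.injective_iff_surjective_of_finrank_eq_finrank (by
      rw [Subspace.dual_finrank_eq, hS.finrank_eq hW])).1 (hS.injective_flip_pairing hW)
  obtain ⟨x, rfl⟩ := hs F
  exact ⟨x, fun y => rfl⟩

lemma nonempty_iso_right {P' : C} {l' : (N ⟶ P') →ₗ[k] k} (hS : S.SerrePair N P l)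
    (hS' : S.SerrePair N P' l') : Nonempty (P ≅ P') := by
  obtain ⟨y, hy⟩ := hS.exists_left hS'.memP l'
  obtain ⟨y', hy'⟩ := hS'.exists_left hS.memP l
  refine ⟨⟨y', y, ?_, ?_⟩⟩
  · rw [← sub_eq_zero]
    refine hS.left P hS.memP _ fun x => ?_
    rw [Preadditive.comp_sub, Category.comp_id, map_sub, sub_eq_zero, ← Category.assoc, ← hy, ← hy']
  · rw [← sub_eq_zero]
    refine hS'.left P' hS'.memP _ fun x => ?_
    rw [Preadditive.comp_sub, Category.comp_id, map_sub, sub_eq_zero, ← Category.assoc, ← hy', ← hy]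

lemma nonempty_iso_left {N' : C} {l' : (N' ⟶ P) →ₗ[k] k} (hS : S.SerrePair N P l)
    (hS' : S.SerrePair N' P l') : Nonempty (N ≅ N') := by
  obtain ⟨x, hx⟩ := hS.exists_right hS'.memN l'
  obtain ⟨x', hx'⟩ := hS'.exists_right hS.memN l
  refine ⟨⟨x, x', ?_, ?_⟩⟩
  · rw [← sub_eq_zero]
    refine hS.right N hS.memN _ fun y => ?_
    rw [Preadditive.sub_comp, Category.id_comp, map_sub, sub_eq_zero, Category.assoc, ← hx, ← hx']
  · rw [← sub_eq_zero]
    refine hS'.right N' hS'.memN _ fun y => ?_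
    rw [Preadditive.sub_comp, Category.id_comp, map_sub, sub_eq_zero, Category.assoc, ← hx', ← hx]

lemma of_iso {N' P' : C} (hS : S.SerrePair N P l) (e : N ≅ N') (e' : P ≅ P') :
    S.SerrePair N' P' (l.comp (Linear.homCongr k e.symm e'.symm).toLinearMap) where
  memN := hS.memN.iso e
  memP := hS.memP.iso e'
  right W hW x hx := by
    rw [← cancel_epi e.hom, comp_zero]
    refine hS.right W hW _ fun y => ?_
    have := hx (y ≫ e'.hom)
    simpa [Linear.homCongr_apply] using this
  left W hW y hy := by
    rw [← cancel_mono e'.inv, zero_comp]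
    refine hS.left W hW _ fun x => ?_
    have := hy (e.inv ≫ x)
    simpa [Linear.homCongr_apply] using this

/-- The functional on shifted morphism spaces. -/
noncomputable def shiftFunctional (l : (N ⟶ P) →ₗ[k] k) (n : ℤ) : (N⟦n⟧ ⟶ P⟦n⟧) →ₗ[k] k :=
  l.comp (shiftHomEquiv k N P n).symm.toLinearMap

lemma shiftFunctional_map (l : (N ⟶ P) →ₗ[k] k) (n : ℤ) (x : N ⟶ P) :
    shiftFunctional l n (x⟦n⟧') = l x := by
  change l ((shiftHomEquiv k N P n).symm (shiftHomEquiv k N P n x)) = l x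
  rw [LinearEquiv.symm_apply_apply]

lemma shift (hS : S.SerrePair N P l) (n : ℤ) :
    S.SerrePair (N⟦n⟧) (P⟦n⟧) (shiftFunctional l n) where
  memN := hS.memN.shift n
  memP := hS.memP.shift n
  right W hW x hx := by
    let e : (W⟦-n⟧)⟦n⟧ ≅ W := (shiftFunctorCompIsoId C (-n) n (by omega)).app W
    obtain ⟨x', hx'⟩ := (shiftFunctor C n).map_surjective (x ≫ e.inv)
    rw [← cancel_mono e.inv, ← hx', zero_comp, hS.right (W⟦-n⟧) (hW.shift _) x', Functor.map_zero]
    intro y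
    have := hx (e.inv ≫ y⟦n⟧')
    rwa [← Category.assoc, ← hx', ← Functor.map_comp, shiftFunctional_map] at this
  left W hW y hy := by
    let e : (W⟦-n⟧)⟦n⟧ ≅ W := (shiftFunctorCompIsoId C (-n) n (by omega)).app W
    obtain ⟨y', hy'⟩ := (shiftFunctor C n).map_surjective (e.hom ≫ y)
    rw [← cancel_epi e.hom, ← hy', comp_zero, hS.left (W⟦-n⟧) (hW.shift _) y', Functor.map_zero]
    intro x
    have := hy (x⟦n⟧' ≫ e.hom)
    rwa [Category.assoc, ← hy', ← Functor.map_comp, shiftFunctional_map] at this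

/-- Serre pairs are stable under cones of adjoint morphisms. -/
theorem cone {N₁ N₂ N₃ L₁ L₂ L₃ : C} {l₁ : (N₁ ⟶ L₁) →ₗ[k] k} {l₂ : (N₂ ⟶ L₂) →ₗ[k] k}
    (h₁ : S.SerrePair N₁ L₁ l₁) (h₂ : S.SerrePair N₂ L₂ l₂) {m : N₁ ⟶ N₂} {a : L₁ ⟶ L₂}
    (adj : ∀ x : N₂ ⟶ L₁, l₁ (m ≫ x) = l₂ (x ≫ a))
    {n : N₂ ⟶ N₃} {b : N₃ ⟶ N₁⟦(1 : ℤ)⟧} (hN : Triangle.mk m n b ∈ distTriang C)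
    {c : L₂ ⟶ L₃} {e : L₃ ⟶ L₁⟦(1 : ℤ)⟧} (hL : Triangle.mk a c e ∈ distTriang C) :
    ∃ l₃, S.SerrePair N₃ L₃ l₃ := by
  have h₁' := h₁.shift 1
  have h₂' := h₂.shift 1
  let Φ : ((N₃ ⟶ L₂) × (N₁⟦(1 : ℤ)⟧ ⟶ L₃)) →ₗ[k] (N₃ ⟶ L₃) :=
    LinearMap.coprod (Linear.rightComp k N₃ c) (Linear.leftComp k L₃ b)
  let F : ((N₃ ⟶ L₂) × (N₁⟦(1 : ℤ)⟧ ⟶ L₃)) →ₗ[k] k :=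
    LinearMap.coprod (l₂.comp (Linear.leftComp k L₂ n))
      (-((shiftFunctional l₁ 1).comp (Linear.rightComp k _ e)))
  have hF : ∀ v, Φ v = 0 → F v = 0 := by
    rintro ⟨z, z'⟩ hz
    change z ≫ c + b ≫ z' = 0 at hz
    change l₂ (n ≫ z) + -(shiftFunctional l₁ 1 (z' ≫ e)) = 0
    have h0 : (n ≫ z) ≫ c = 0 := by
      have : n ≫ (z ≫ c + b ≫ z') = 0 := by rw [hz, comp_zero]
      rwa [Preadditive.comp_add, ← Category.assoc n b, dist_comp₂₃ hN, zero_comp, add_zero,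
        ← Category.assoc] at this
    obtain ⟨u, hu⟩ := dist_lift₂ hL _ h0
    obtain ⟨w, hw₁, hw₂⟩ : ∃ w : N₁⟦(1 : ℤ)⟧ ⟶ L₃, b ≫ w = z ≫ c ∧
        (-(m⟦(1 : ℤ)⟧')) ≫ u⟦(1 : ℤ)⟧' = w ≫ e :=
      complete_distinguished_triangle_morphism _ _ (dist_rotate hN) hL u z hu
    obtain ⟨v, hv⟩ := dist_desc₄ hN (z' + w) (by
      rw [Preadditive.comp_add, hw₁, add_comm, hz])
    obtain ⟨r, hr⟩ := (shiftFunctor C (1 : ℤ)).map_surjective (v ≫ e)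
    have hra : r ≫ a = 0 := by
      apply (shiftFunctor C (1 : ℤ)).map_injective
      rw [Functor.map_comp, hr, Category.assoc, dist_comp₃₁ hL, comp_zero, Functor.map_zero]
    have hz' : z' ≫ e = (m ≫ r)⟦(1 : ℤ)⟧' + (m ≫ u)⟦(1 : ℤ)⟧' := by
      have h3 : z' = m⟦(1 : ℤ)⟧' ≫ v - w := eq_sub_of_add_eq hv
      rw [h3, Preadditive.sub_comp, ← hw₂, Preadditive.neg_comp, sub_neg_eq_add, Category.assoc,
        ← hr, Functor.map_comp, Functor.map_comp]
    rw [hz', map_add, shiftFunctional_map, shiftFunctional_map, adj, adj, hra, map_zero,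
      zero_add, hu, add_neg_cancel]
  obtain ⟨l₃, hl₃⟩ := exists_functional_comp_eq Φ F hF
  have hl₃a : ∀ z : N₃ ⟶ L₂, l₃ (z ≫ c) = l₂ (n ≫ z) := fun z => by
    have := hl₃ (z, 0)
    simpa [Φ, F] using this
  have hl₃b : ∀ z : N₁⟦(1 : ℤ)⟧ ⟶ L₃, l₃ (b ≫ z) = -(shiftFunctional l₁ 1 (z ≫ e)) := fun z => by
    have := hl₃ (0, z)
    simpa [Φ, F] using this
  refine ⟨l₃, FinitelyBuilt.cone m n b hN h₁.memN h₂.memN,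
    FinitelyBuilt.cone a c e hL h₁.memP h₂.memP, ?_, ?_⟩
  · intro W hW x hx
    have h0 : n ≫ x = 0 := h₂.right W hW _ fun y => by
      rw [Category.assoc, ← hl₃a, Category.assoc, hx]
    obtain ⟨x₁, rfl⟩ := dist_desc₃ hN x h0
    obtain ⟨G, hG⟩ := exists_functional_comp_eq (Linear.rightComp k W (a⟦(1 : ℤ)⟧'))
      ((shiftFunctional l₁ 1).comp (Linear.leftComp k (L₁⟦(1 : ℤ)⟧) x₁)) (by
        intro v hv
        obtain ⟨y, rfl⟩ := dist_lift₄ hL v hv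
        have := hx y
        rw [Category.assoc, hl₃b, neg_eq_zero, Category.assoc] at this
        exact this)
    obtain ⟨x₂, hx₂⟩ := h₂'.exists_right hW G
    have h3 : x₁ = m⟦(1 : ℤ)⟧' ≫ x₂ := by
      rw [← sub_eq_zero]
      refine h₁'.right W hW _ fun y => ?_
      have h4 : shiftFunctional l₁ 1 (x₁ ≫ y) = shiftFunctional l₂ 1 (x₂ ≫ y ≫ a⟦(1 : ℤ)⟧') := by
        rw [← hx₂]
        exact (hG y).symm
      obtain ⟨q, hq⟩ := (shiftFunctor C (1 : ℤ)).map_surjective (x₂ ≫ y)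
      rw [Preadditive.sub_comp, map_sub, h4, Category.assoc, ← Category.assoc x₂ y, ← hq,
        ← Functor.map_comp, ← Functor.map_comp, shiftFunctional_map, shiftFunctional_map, adj,
        sub_self]
    rw [h3, ← Category.assoc, dist_comp₃₁ hN, zero_comp]
  · intro W hW y hy
    have h0 : y ≫ e = 0 := h₁'.left W hW _ fun x => by
      have := hy (b ≫ x)
      rwa [Category.assoc, hl₃b, neg_eq_zero, Category.assoc] at this
    obtain ⟨y₂, rfl⟩ := dist_lift₃ hL y h0
    obtain ⟨G, hG⟩ := exists_functional_comp_eq (Linear.leftComp k W m)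
      (l₂.comp (Linear.rightComp k N₂ y₂)) (by
        intro v hv
        obtain ⟨x, rfl⟩ := dist_desc₂ hN v hv
        have := hy x
        rw [← Category.assoc, hl₃a, ← Category.assoc] at this
        exact this)
    obtain ⟨y₁, hy₁⟩ := h₁.exists_left hW G
    have h3 : y₂ = y₁ ≫ a := by
      rw [← sub_eq_zero]
      refine h₂.left W hW _ fun x => ?_
      have h4 : l₁ ((m ≫ x) ≫ y₁) = l₂ (x ≫ y₂) := by
        rw [← hy₁]
        exact hG x
      rw [Preadditive.comp_sub, map_sub, ← h4, Category.assoc, adj, Category.assoc, sub_self]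
    rw [h3, Category.assoc, dist_comp₁₂ hL, comp_zero]

lemma exists_adj_right {N₁ N₂ L₁ L₂ : C} {l₁ : (N₁ ⟶ L₁) →ₗ[k] k} {l₂ : (N₂ ⟶ L₂) →ₗ[k] k}
    (h₁ : S.SerrePair N₁ L₁ l₁) (h₂ : S.SerrePair N₂ L₂ l₂) (m : N₁ ⟶ N₂) :
    ∃ a : L₁ ⟶ L₂, ∀ x : N₂ ⟶ L₁, l₁ (m ≫ x) = l₂ (x ≫ a) :=
  h₂.exists_left h₁.memP (l₁.comp (Linear.leftComp k L₁ m))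

lemma exists_adj_left {N₁ N₂ L₁ L₂ : C} {l₁ : (N₁ ⟶ L₁) →ₗ[k] k} {l₂ : (N₂ ⟶ L₂) →ₗ[k] k}
    (h₁ : S.SerrePair N₁ L₁ l₁) (h₂ : S.SerrePair N₂ L₂ l₂) (a : L₁ ⟶ L₂) :
    ∃ m : N₁ ⟶ N₂, ∀ x : N₂ ⟶ L₁, l₁ (m ≫ x) = l₂ (x ≫ a) := by
  obtain ⟨m, hm⟩ := h₁.exists_right h₂.memN (l₂.comp (Linear.rightComp k N₂ a))
  exact ⟨m, fun x => (hm x).symm⟩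

lemma of_isZero (S : DGSetup k C Co) {Z Z' : C} (hZ : IsZero Z) (hZ' : IsZero Z') :
    S.SerrePair Z Z' 0 where
  memN := FinitelyBuilt.base.of_isZero hZ
  memP := FinitelyBuilt.base.of_isZero hZ'
  right _ _ _ _ := hZ.eq_of_src _ _
  left _ _ _ _ := hZ'.eq_of_tgt _ _

end SerrePair

end DGSetup

/-- Every nonzero morphism out of the end term of an Auslander-Reiten triangle can be
prolonged to the connecting morphism. -/
lemma IsARTriangle.exists_comp_eq {R₀ : C} {X Y N : C} {f : X ⟶ Y} {g : Y ⟶ N}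
    {h : N ⟶ X⟦(1 : ℤ)⟧} (hT : IsARTriangle C {M | FinitelyBuilt C R₀ M} f g h) {W : C}
    (hW : FinitelyBuilt C R₀ W) {x : N ⟶ W} (hx : x ≠ 0) : ∃ y, x ≫ y = h := by
  obtain ⟨Z, p, q, hZ⟩ := distinguished_cocone_triangle₁ x
  have hZm : FinitelyBuilt C R₀ Z := FinitelyBuilt.of_cone₁ _ _ _ hZ hT.memZ hW
  obtain ⟨u, hu⟩ := hT.fac_right Z hZm p (by
    rintro ⟨s, hs⟩
    apply hx
    rw [← Category.id_comp x, ← hs, Category.assoc, dist_comp₁₂ hZ, comp_zero])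
  obtain ⟨y, hy⟩ := dist_desc₂ hZ h (by
    rw [← hu, Category.assoc, dist_comp₂₃ hT.dist, comp_zero])
  exact ⟨y, hy.symm⟩

/-- The connecting morphism of an Auslander-Reiten triangle dies under morphisms which are not
split monomorphisms. -/
lemma IsARTriangle.connecting_comp_eq_zero {R₀ : C} {X Y N : C} {f : X ⟶ Y} {g : Y ⟶ N}
    {h : N ⟶ X⟦(1 : ℤ)⟧} (hT : IsARTriangle C {M | FinitelyBuilt C R₀ M} f g h) {V : C}
    (hV : FinitelyBuilt C R₀ V) (q : X⟦(1 : ℤ)⟧ ⟶ V)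
    (hq : ¬ ∃ r : V ⟶ X⟦(1 : ℤ)⟧, q ≫ r = 𝟙 _) : h ≫ q = 0 := by
  let e : (V⟦(-1 : ℤ)⟧)⟦(1 : ℤ)⟧ ≅ V := (shiftFunctorCompIsoId C (-1 : ℤ) 1 (by omega)).app V
  obtain ⟨q', hq'⟩ := (shiftFunctor C (1 : ℤ)).map_surjective (q ≫ e.inv)
  obtain ⟨v, hv⟩ := hT.fac_left (V⟦(-1 : ℤ)⟧) (hV.shift _) q' (by
    rintro ⟨r, hr⟩
    apply hq
    refine ⟨e.inv ≫ r⟦(1 : ℤ)⟧', ?_⟩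
    rw [← Category.assoc, ← hq', ← Functor.map_comp, hr, CategoryTheory.Functor.map_id])
  rw [← cancel_mono e.inv, Category.assoc, ← hq', ← hv, Functor.map_comp, ← Category.assoc,
    dist_comp₃₁ hT.dist, zero_comp, zero_comp]

lemma IsARTriangle.exists_comp_eq' {R₀ : C} {X Y N : C} {f : X ⟶ Y} {g : Y ⟶ N}
    {h : N ⟶ X⟦(1 : ℤ)⟧} (hT : IsARTriangle C {M | FinitelyBuilt C R₀ M} f g h) {W : C}
    (hW : FinitelyBuilt C R₀ W) {y : W ⟶ X⟦(1 : ℤ)⟧} (hy : y ≠ 0) : ∃ x, x ≫ y = h := by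
  obtain ⟨V, q, r, hV⟩ := distinguished_cocone_triangle y
  have hVm : FinitelyBuilt C R₀ V := FinitelyBuilt.cone _ _ _ hV hW (hT.memX.shift 1)
  obtain ⟨x, hx⟩ := dist_lift₂ hV h (hT.connecting_comp_eq_zero hVm q (by
    rintro ⟨s, hs⟩
    apply hy
    rw [← Category.comp_id y, ← hs, ← Category.assoc, dist_comp₁₂ hV, zero_comp]))
  exact ⟨x, hx.symm⟩

namespace DGSetup

variable (S : DGSetup k C Co)

/-- An Auslander-Reiten triangle gives a Serre pair. -/
lemma exists_serrePair_of_AR {X Y N : C} {f : X ⟶ Y} {g : Y ⟶ N}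
    {h : N ⟶ X⟦(1 : ℤ)⟧} (hT : IsARTriangle C S.Dc f g h) :
    ∃ l, S.SerrePair N (X⟦(1 : ℤ)⟧) l := by
  obtain ⟨l, hl⟩ : ∃ l : (N ⟶ X⟦(1 : ℤ)⟧) →ₗ[k] k, l h ≠ 0 := by
    by_contra hc
    push Not at hc
    exact hT.h_ne ((Module.forall_dual_apply_eq_zero_iff k h).1 hc)
  refine ⟨l, hT.memZ, hT.memX.shift 1, fun W hW x hx => ?_, fun W hW y hy => ?_⟩
  · by_contra h0
    obtain ⟨y, rfl⟩ := IsARTriangle.exists_comp_eq (R₀ := S.R) hT hW h0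
    exact hl (hx y)
  · by_contra h0
    obtain ⟨x, rfl⟩ := IsARTriangle.exists_comp_eq' (R₀ := S.R) hT hW h0
    exact hl (hy x)

lemma phiN_biprod {A B : C} (hA : A ∈ S.Dc) (hB : B ∈ S.Dc) :
    S.phiN (A ⊞ B) = S.phiN B + S.phiN A :=
  S.phiN_eq_add (binaryBiproductTriangle_distinguished A B) hA (hA.biprod hB) hB
    (fun _ _ => zero_comp)

lemma mem_of_iso_biprod {M A B : C} (hM : M ∈ S.Dc) (e : M ≅ A ⊞ B) : A ∈ S.Dc ∧ B ∈ S.Dc := by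
  have : FinitelyBuilt C S.R (A ⊞ B) := hM.iso e
  exact ⟨FinitelyBuilt.retract biprod.inl biprod.fst (by simp) this,
    FinitelyBuilt.retract biprod.inr biprod.snd (by simp) this⟩

lemma not_isZero_cell (i : ℤ) : ¬ IsZero (S.cell i) := fun h =>
  S.id_cell_ne_zero i (h.eq_of_src _ _)

lemma indec_cell (i : ℤ) : Indec C (S.cell i) := by
  refine ⟨S.not_isZero_cell i, fun A B ⟨e⟩ => ?_⟩
  obtain ⟨hA, hB⟩ := S.mem_of_iso_biprod (S.cell_mem i) e
  have h1 := S.phiN_cell i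
  rw [S.phiN_congr e, S.phiN_biprod hA hB] at h1
  by_contra hc
  rw [not_or] at hc
  have := phiN_pos hA hc.1
  have := phiN_pos hB hc.2
  omega

variable {S} in
lemma exists_serrePair_cell_zero (t : ARTranslation C S.Dc) :
    ∃ l, S.SerrePair (S.cell 0) (S.cell (-S.d)) l := by
  obtain ⟨Y, f, g, h, hT⟩ := t.triangle ⟨S.cell 0, S.cell_mem 0, S.indec_cell 0⟩
  generalize (t.τ ⟨S.cell 0, S.cell_mem 0, S.indec_cell 0⟩).1 = X at f h hT
  obtain ⟨l, hl⟩ := S.exists_serrePair_of_AR hT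
  generalize X⟦(1 : ℤ)⟧ = P at l hl
  have hdim := fun j => hl.finrank_eq (S.cell_mem j)
  have hzero : ∀ j, (∀ f : S.cell 0 ⟶ S.cell j, f = 0) → ∀ f : S.cell j ⟶ P, f = 0 := by
    intro j hj
    have := subsingleton_hom_iff.2 hj
    have hd := hdim j
    rw [finrank_zero_of_subsingleton] at hd
    have := S.finiteDimensional_hom (S.cell_mem j) hl.memP
    exact subsingleton_hom_iff.1 (finrank_zero_iff.1 hd.symm)
  have hinf : S.InfGE P (-S.d) := fun j hj =>
    hzero j (S.cell_cell_eq_zero_of_gt (by omega))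
  obtain ⟨x, hx⟩ : ∃ x : S.cell (-S.d) ⟶ P, x ≠ 0 := by
    by_contra hc
    push Not at hc
    have := subsingleton_hom_iff.2 hc
    have hd := hdim (-S.d)
    rw [finrank_zero_of_subsingleton (M := (S.cell (-S.d) ⟶ P))] at hd
    have := S.finiteDimensional_hom (S.cell_mem 0) (S.cell_mem (-S.d))
    have h0 := subsingleton_hom_iff.1 (finrank_zero_iff.1 hd)
    obtain ⟨f, hf⟩ := S.exists_cell_cell_ne_zero (i := 0) (j := -S.d) (by omega)
    exact hf (h0 f)
  obtain ⟨P₁, y, z, hP⟩ := distinguished_cocone_triangle x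
  suffices hz : IsZero P₁ by
    have : IsIso x := (Triangle.isZero₃_iff_isIso₁ _ hP).1 hz
    exact ⟨_, hl.of_iso (Iso.refl _) (asIso x).symm⟩
  by_contra hz
  have hP₁ : P₁ ∈ S.Dc := FinitelyBuilt.cone x y z hP (S.cell_mem _) hl.memP
  obtain ⟨j, hj, w, hw⟩ := (infGE_cone hinf hx hP).exists_ne_zero hP₁ hz
  have hwz : w ≫ z = 0 := S.cell_shift_eq_zero _ _ (S.cell_cell_eq_zero_of_gt (by omega)) _
  obtain ⟨u, rfl⟩ := dist_lift₃ hP w hwz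
  rcases (show 0 < j ∨ j = 0 by omega) with hj | rfl
  · rw [hzero j (S.cell_cell_eq_zero_of_lt hj) u, zero_comp] at hw
    exact hw rfl
  · obtain ⟨r, hr⟩ : ∃ r : S.cell 0 ⟶ S.cell (-S.d), l (r ≫ x) ≠ 0 := by
      by_contra hc
      push Not at hc
      exact hx (hl.left _ (S.cell_mem _) x hc)
    have hr0 : r ≫ x ≠ 0 := fun h => hr (by rw [h, map_zero])
    have h1 : finrank k (S.cell 0 ⟶ P) = 1 := by rw [← hdim 0, S.finrank_cell_cell]
    obtain ⟨c, rfl⟩ := (finrank_eq_one_iff_of_nonzero' _ hr0).1 h1 u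
    rw [Linear.smul_comp, Category.assoc, dist_comp₁₂ hP, comp_zero, smul_zero] at hw
    exact hw rfl

variable {S} in
lemma exists_serrePair_cell (t : ARTranslation C S.Dc) (i j : ℤ) (h : i - j = S.d) :
    ∃ l, S.SerrePair (S.cell i) (S.cell j) l := by
  obtain ⟨l, hl⟩ := exists_serrePair_cell_zero t
  exact ⟨_, (hl.shift (-i)).of_iso
    ((shiftFunctorAdd' C (-0) (-i) (-i) (by omega)).app S.R).symm
    ((shiftFunctorAdd' C (-(-S.d)) (-i) (-j) (by omega)).app S.R).symm⟩

lemma phiN_shift (M : C) (n : ℤ) : S.phiN (M⟦n⟧) = S.phiN M := by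
  unfold phiN
  rw [← finsum_comp_equiv (Equiv.addRight n)]
  exact finsum_congr fun i => (nonempty_shiftHom_right k M S.kMod n (i + n) i rfl).some.finrank_eq

lemma phiN_le_add {X Y Z : C} {f : X ⟶ Y} {g : Y ⟶ Z} {h : Z ⟶ X⟦(1 : ℤ)⟧}
    (hT : Triangle.mk f g h ∈ distTriang C) (hX : X ∈ S.Dc) (hY : Y ∈ S.Dc) :
    S.phiN Z ≤ S.phiN X + S.phiN Y := by
  have hX1 : X⟦(1 : ℤ)⟧ ∈ S.Dc := hX.shift 1
  have hZ : Z ∈ S.Dc := FinitelyBuilt.cone f g h hT hX hY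
  rw [← S.phiN_shift X 1]
  unfold phiN
  rw [← finsum_add_distrib (S.support_phiN hX1) (S.support_phiN hY)]
  refine finsum_le_finsum' (S.support_phiN hZ)
    (((S.support_phiN hX1).union (S.support_phiN hY)).subset (Function.support_add _ _)) fun j => ?_
  have := S.finiteDimensional_hom_kMod hX1 j
  have := S.finiteDimensional_hom_kMod hY j
  exact (finrank_hom_from_mid_le (dist_rotate hT) (S.kMod⟦j⟧) (k := k)).2

variable {S}

lemma exists_inv_rotate {X Y Z : C} {f : X ⟶ Y} {g : Y ⟶ Z} {h : Z ⟶ X⟦(1 : ℤ)⟧}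
    (hT : Triangle.mk f g h ∈ distTriang C) :
    ∃ (m : Z⟦(-1 : ℤ)⟧ ⟶ X) (b : Y ⟶ (Z⟦(-1 : ℤ)⟧)⟦(1 : ℤ)⟧),
      Triangle.mk m f b ∈ distTriang C :=
  ⟨_, _, inv_rot_of_distTriang _ hT⟩

/-- Every compact object is the first member of a Serre pair. -/
theorem exists_serrePair_right (t : ARTranslation C S.Dc) {N : C} (hN : N ∈ S.Dc) :
    ∃ P l, S.SerrePair N P l ∧ S.phiN P ≤ S.phiN N := by
  refine cell_induction (Q := fun N => ∃ P l, S.SerrePair N P l ∧ S.phiN P ≤ S.phiN N) ?_ ?_ hN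
  · intro M hM
    exact ⟨M, 0, SerrePair.of_isZero S hM hM, le_rfl⟩
  · intro i M M₁ x y z hT _ _ _ _ _ hphi ⟨P₁, l₁, hl₁, hle⟩
    obtain ⟨m, b, hT'⟩ := exists_inv_rotate hT
    obtain ⟨l₂, hl₂⟩ := exists_serrePair_cell t i (i - S.d) (by omega)
    have hl₁' := hl₁.shift (-1)
    obtain ⟨a, ha⟩ := hl₁'.exists_adj_right hl₂ m
    obtain ⟨P, c, e, hP⟩ := distinguished_cocone_triangle a
    obtain ⟨l, hl⟩ := hl₁'.cone hl₂ ha hT' hP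
    refine ⟨P, l, hl, (S.phiN_le_add hP hl₁'.memP hl₂.memP).trans ?_⟩
    rw [S.phiN_shift, S.phiN_cell]
    omega

/-- Every compact object is the second member of a Serre pair. -/
theorem exists_serrePair_left (t : ARTranslation C S.Dc) {P : C} (hP : P ∈ S.Dc) :
    ∃ N l, S.SerrePair N P l ∧ S.phiN N ≤ S.phiN P := by
  refine cell_induction (Q := fun P => ∃ N l, S.SerrePair N P l ∧ S.phiN N ≤ S.phiN P) ?_ ?_ hP
  · intro M hM
    exact ⟨M, 0, SerrePair.of_isZero S hM hM, le_rfl⟩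
  · intro i M M₁ x y z hT _ _ _ _ _ hphi ⟨N₁, l₁, hl₁, hle⟩
    obtain ⟨a, b, hT'⟩ := exists_inv_rotate hT
    obtain ⟨l₂, hl₂⟩ := exists_serrePair_cell t (i + S.d) i (by omega)
    have hl₁' := hl₁.shift (-1)
    obtain ⟨m, hm⟩ := hl₁'.exists_adj_left hl₂ a
    obtain ⟨N, c, e, hN⟩ := distinguished_cocone_triangle m
    obtain ⟨l, hl⟩ := hl₁'.cone hl₂ hm hN hT'
    refine ⟨N, l, hl, (S.phiN_le_add hN hl₁'.memN hl₂.memN).trans ?_⟩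
    rw [S.phiN_shift, S.phiN_cell]
    omega

namespace SerrePair

variable {N P : C} {l : (N ⟶ P) →ₗ[k] k}

lemma phiN_eq (t : ARTranslation C S.Dc) (hl : S.SerrePair N P l) : S.phiN N = S.phiN P := by
  apply le_antisymm
  · obtain ⟨N', l', hl', hle⟩ := exists_serrePair_left t hl.memP
    obtain ⟨e⟩ := hl.nonempty_iso_left hl'
    rwa [S.phiN_congr e]
  · obtain ⟨P', l', hl', hle⟩ := exists_serrePair_right t hl.memN
    obtain ⟨e⟩ := hl.nonempty_iso_right hl'
    rwa [S.phiN_congr e]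

/-- The dimension of morphism spaces is invariant under passing to Serre partners. -/
lemma finrank_hom_eq {N' P' : C} {l' : (N' ⟶ P') →ₗ[k] k} (hl : S.SerrePair N P l)
    (hl' : S.SerrePair N' P' l') : finrank k (P ⟶ P') = finrank k (N ⟶ N') := by
  rw [hl.finrank_eq hl'.memN, hl'.finrank_eq hl.memP]

end SerrePair

end DGSetup

end SerrePairs

section Decompositions

variable {k : Type u} [Field k]
variable {C : Type u} [Category.{v} C] [Preadditive C] [HasZeroObject C] [HasShift C ℤ]
  [∀ n : ℤ, (shiftFunctor C n).Additive] [Pretriangulated C]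
  [Linear k C] [HasFiniteBiproducts C] [∀ n : ℤ, Functor.Linear k (shiftFunctor C n)]
variable {Co : Type u} [Category.{v} Co] [Preadditive Co] [HasZeroObject Co] [HasShift Co ℤ]
  [∀ n : ℤ, (shiftFunctor Co n).Additive] [Pretriangulated Co]
  [Linear k Co] [HasFiniteBiproducts Co] [∀ n : ℤ, Functor.Linear k (shiftFunctor Co n)]

open Module

lemma isIso_of_comp_eq_id {M : C} [FiniteDimensional k (M ⟶ M)] {s v : M ⟶ M}
    (h : s ≫ v = 𝟙 M) : IsIso v := by
  have hinj : Function.Injective (Linear.leftComp k M v) := fun x y hxy => by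
    rw [← Category.id_comp x, ← Category.id_comp y, ← h, Category.assoc, Category.assoc]
    exact congrArg (s ≫ ·) hxy
  obtain ⟨x, hx⟩ := (LinearMap.injective_iff_surjective.1 hinj) (𝟙 M)
  change v ≫ x = 𝟙 M at hx
  have hsx : s = x := by
    rw [← Category.comp_id s, ← hx, ← Category.assoc, h, Category.id_comp]
  exact ⟨x, hx, by rw [← hsx, h]⟩

/-- A split monomorphism from a nonzero object to an indecomposable object is an
isomorphism. -/
lemma Indec.isIso_of_split_mono {M Z : C} (hZ : Indec C Z) (hM : ¬ IsZero M) {s : M ⟶ Z}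
    {b : Z ⟶ M} (h : s ≫ b = 𝟙 M) : IsIso s := by
  obtain ⟨W, q, r, hT⟩ := distinguished_cocone_triangle s
  have hr : r = 0 := by
    have h1 := dist_comp₃₁ hT
    have h2 := congrArg (· ≫ b⟦(1 : ℤ)⟧') h1
    rwa [Category.assoc, ← Functor.map_comp, h, CategoryTheory.Functor.map_id, Category.comp_id,
      zero_comp] at h2
  obtain ⟨e, -, -⟩ := exists_iso_binaryBiproduct_of_distTriang _ hT hr
  rcases hZ.2 _ _ ⟨e⟩ with h0 | h0
  · exact absurd h0 hM
  · exact (Triangle.isZero₃_iff_isIso₁ _ hT).1 h0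

lemma Indec.isIso_of_split_epi {M Z : C} (hZ : Indec C Z) (hM : ¬ IsZero M) {s : M ⟶ Z}
    {b : Z ⟶ M} (h : s ≫ b = 𝟙 M) : IsIso b := by
  have := hZ.isIso_of_split_mono hM h
  have : b = inv s := by rw [← cancel_epi s, h, IsIso.hom_inv_id]
  rw [this]
  infer_instance

lemma Indec.of_iso {M N : C} (hM : Indec C M) (e : M ≅ N) : Indec C N :=
  ⟨fun h => hM.1 (h.of_iso e), fun A B ⟨e'⟩ => hM.2 A B ⟨e ≪≫ e'⟩⟩

lemma isZero_of_isZero_shift {A : C} {n : ℤ} (h : IsZero (A⟦n⟧)) : IsZero A := by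
  rw [IsZero.iff_id_eq_zero] at h ⊢
  apply (shiftFunctor C n).map_injective
  rw [CategoryTheory.Functor.map_id, h, Functor.map_zero]

lemma Indec.shift {M : C} (hM : Indec C M) (n : ℤ) : Indec C (M⟦n⟧) := by
  refine ⟨fun h => hM.1 (isZero_of_isZero_shift h), fun A B ⟨e⟩ => ?_⟩
  have : PreservesBinaryBiproducts (shiftFunctor C (-n)) :=
    preservesBinaryBiproducts_of_preservesBiproducts _
  have e' : M ≅ A⟦-n⟧ ⊞ B⟦-n⟧ :=
    ((shiftFunctorCompIsoId C n (-n) (by omega)).app M).symm ≪≫ (shiftFunctor C (-n)).mapIso e ≪≫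
      (shiftFunctor C (-n)).mapBiprod A B
  exact (hM.2 _ _ ⟨e'⟩).imp isZero_of_isZero_shift isZero_of_isZero_shift

/-- The morphisms `ι` and `π` exhibit `M` as the direct sum of the family `Z`. -/
structure IsDirectSum {J : Type} [Fintype J] {M : C} {Z : J → C} (ι : ∀ j, Z j ⟶ M)
    (π : ∀ j, M ⟶ Z j) : Prop where
  comp_self : ∀ j, ι j ≫ π j = 𝟙 (Z j)
  comp_ne : ∀ i j, i ≠ j → ι i ≫ π j = 0
  total : ∑ j, π j ≫ ι j = 𝟙 M

namespace IsDirectSum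

variable {J : Type} [Fintype J] {M : C} {Z : J → C} {ι : ∀ j, Z j ⟶ M} {π : ∀ j, M ⟶ Z j}

lemma finrank_hom_to (h : IsDirectSum ι π) (W : C) (hW : ∀ j, FiniteDimensional k (W ⟶ Z j)) :
    finrank k (W ⟶ M) = ∑ j, finrank k (W ⟶ Z j) := by
  classical
  rw [← finrank_pi_fintype]
  refine LinearEquiv.finrank_eq
    { LinearMap.pi fun j => Linear.rightComp k W (π j) with
      invFun := fun x => ∑ j, x j ≫ ι j
      left_inv := fun x => ?_
      right_inv := fun x => ?_ }
  · change ∑ j, (x ≫ π j) ≫ ι j = x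
    simp_rw [Category.assoc]
    rw [← Preadditive.comp_sum, h.total, Category.comp_id]
  · funext i
    change (∑ j, x j ≫ ι j) ≫ π i = x i
    rw [Preadditive.sum_comp, Finset.sum_eq_single i, Category.assoc, h.comp_self,
      Category.comp_id]
    · intro j _ hj
      rw [Category.assoc, h.comp_ne _ _ hj, comp_zero]
    · simp

lemma finrank_hom_from (h : IsDirectSum ι π) (W : C) (hW : ∀ j, FiniteDimensional k (Z j ⟶ W)) :
    finrank k (M ⟶ W) = ∑ j, finrank k (Z j ⟶ W) := by
  classical
  rw [← finrank_pi_fintype]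
  refine LinearEquiv.finrank_eq
    { LinearMap.pi fun j => Linear.leftComp k W (ι j) with
      invFun := fun x => ∑ j, π j ≫ x j
      left_inv := fun x => ?_
      right_inv := fun x => ?_ }
  · change ∑ j, π j ≫ ι j ≫ x = x
    simp_rw [← Category.assoc]
    rw [← Preadditive.sum_comp, h.total, Category.id_comp]
  · funext i
    change ι i ≫ (∑ j, π j ≫ x j) = x i
    rw [Preadditive.comp_sum, Finset.sum_eq_single i, ← Category.assoc, h.comp_self,
      Category.id_comp]
    · intro j _ hj
      rw [← Category.assoc, h.comp_ne _ _ hj.symm, zero_comp]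
    · simp

lemma sumElim {J' : Type} [Fintype J'] {M' T : C} {Z' : J' → C} {ι' : ∀ j, Z' j ⟶ M'}
    {π' : ∀ j, M' ⟶ Z' j} (h : IsDirectSum ι π) (h' : IsDirectSum ι' π') (e : T ≅ M ⊞ M') :
    IsDirectSum (Z := Sum.elim Z Z')
      (fun j => match j with
        | .inl j => ι j ≫ biprod.inl ≫ e.inv
        | .inr j => ι' j ≫ biprod.inr ≫ e.inv)
      (fun j => match j with
        | .inl j => e.hom ≫ biprod.fst ≫ π j
        | .inr j => e.hom ≫ biprod.snd ≫ π' j) where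
  comp_self j := by
    rcases j with j | j
    · simpa using h.comp_self j
    · simpa using h'.comp_self j
  comp_ne i j hij := by
    rcases i with i | i <;> rcases j with j | j
    · change (ι i ≫ biprod.inl ≫ e.inv) ≫ e.hom ≫ biprod.fst ≫ π j = (0 : Z i ⟶ Z j)
      simpa using h.comp_ne i j (fun hc => hij (by rw [hc]))
    · change (ι i ≫ biprod.inl ≫ e.inv) ≫ e.hom ≫ biprod.snd ≫ π' j = (0 : Z i ⟶ Z' j)
      simp
    · change (ι' i ≫ biprod.inr ≫ e.inv) ≫ e.hom ≫ biprod.fst ≫ π j = (0 : Z' i ⟶ Z j)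
      simp
    · change (ι' i ≫ biprod.inr ≫ e.inv) ≫ e.hom ≫ biprod.snd ≫ π' j = (0 : Z' i ⟶ Z' j)
      simpa using h'.comp_ne i j (fun hc => hij (by rw [hc]))
  total := by
    rw [Fintype.sum_sum_type]
    have h1 : ∑ j, (e.hom ≫ biprod.fst ≫ π j) ≫ ι j ≫ biprod.inl ≫ e.inv =
        e.hom ≫ (biprod.fst ≫ biprod.inl) ≫ e.inv := by
      have := congrArg (fun f => e.hom ≫ biprod.fst ≫ f ≫ biprod.inl ≫ e.inv) h.total
      simpa [Preadditive.comp_sum, Preadditive.sum_comp] using this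
    have h2 : ∑ j, (e.hom ≫ biprod.snd ≫ π' j) ≫ ι' j ≫ biprod.inr ≫ e.inv =
        e.hom ≫ (biprod.snd ≫ biprod.inr) ≫ e.inv := by
      have := congrArg (fun f => e.hom ≫ biprod.snd ≫ f ≫ biprod.inr ≫ e.inv) h'.total
      simpa [Preadditive.comp_sum, Preadditive.sum_comp] using this
    refine (congrArg₂ (· + ·) h1 h2).trans ?_
    rw [← Preadditive.comp_add, ← Preadditive.add_comp, biprod.total]
    simp

lemma of_iso_biproduct {m : ℕ} {Z : Fin m → C} (e : M ≅ ⨁ Z) :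
    IsDirectSum (fun j => biproduct.ι Z j ≫ e.inv) (fun j => e.hom ≫ biproduct.π Z j) where
  comp_self j := by simp
  comp_ne i j hij := by simp [biproduct.ι_π_ne Z hij]
  total := by
    have : e.hom ≫ (∑ j, biproduct.π Z j ≫ biproduct.ι Z j) ≫ e.inv = 𝟙 M := by
      rw [biproduct.total, Category.id_comp, e.hom_inv_id]
    simpa only [Preadditive.comp_sum, Preadditive.sum_comp, Category.assoc] using this

end IsDirectSum

namespace DGSetup

variable (S : DGSetup k C Co)

lemma exists_isDirectSum {M : C} (hM : M ∈ S.Dc) :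
    ∃ (J : Type) (_ : Fintype J) (Z : J → C) (ι : ∀ j, Z j ⟶ M) (π : ∀ j, M ⟶ Z j),
      IsDirectSum ι π ∧ ∀ j, Indec C (Z j) := by
  obtain ⟨n, hn⟩ : ∃ n, S.phiN M = n := ⟨_, rfl⟩
  induction n using Nat.strong_induction_on generalizing M with
  | _ n ih =>
  by_cases h0 : IsZero M
  · exact ⟨Empty, inferInstance, fun j => j.elim, fun j => j.elim, fun j => j.elim,
      ⟨fun j => j.elim, fun j => j.elim, h0.eq_of_src _ _⟩, fun j => j.elim⟩
  by_cases hi : Indec C M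
  · exact ⟨Unit, inferInstance, fun _ => M, fun _ => 𝟙 M, fun _ => 𝟙 M,
      ⟨fun j => by simp, fun i j hij => absurd rfl hij, by simp⟩, fun _ => hi⟩
  obtain ⟨A, B, ⟨e⟩, hA, hB⟩ : ∃ A B : C, Nonempty (M ≅ A ⊞ B) ∧ ¬ IsZero A ∧ ¬ IsZero B := by
    by_contra hc
    push Not at hc
    exact hi ⟨h0, fun A B e => or_iff_not_imp_left.2 (hc A B e)⟩
  obtain ⟨hAm, hBm⟩ := S.mem_of_iso_biprod hM e
  have h1 := S.phiN_congr e
  rw [S.phiN_biprod hAm hBm, hn] at h1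
  have hA0 := phiN_pos hAm hA
  have hB0 := phiN_pos hBm hB
  obtain ⟨J, _, Z, ι, π, h, hZ⟩ := ih _ (by omega) hAm rfl
  obtain ⟨J', _, Z', ι', π', h', hZ'⟩ := ih _ (by omega) hBm rfl
  exact ⟨J ⊕ J', inferInstance, _, _, _, h.sumElim h' e, fun j => by
    rcases j with j | j
    · exact hZ j
    · exact hZ' j⟩

variable {S}

lemma mem_of_isDirectSum {J : Type} [Fintype J] {M : C} {Z : J → C} {ι : ∀ j, Z j ⟶ M}
    {π : ∀ j, M ⟶ Z j} (hM : M ∈ S.Dc) (h : IsDirectSum ι π) (j : J) : Z j ∈ S.Dc :=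
  FinitelyBuilt.retract (ι j) (π j) (h.comp_self j) hM

lemma phiN_eq_sum {J : Type} [Fintype J] {M : C} {Z : J → C} {ι : ∀ j, Z j ⟶ M}
    {π : ∀ j, M ⟶ Z j} (hM : M ∈ S.Dc) (h : IsDirectSum ι π) :
    S.phiN M = ∑ j, S.phiN (Z j) := by
  unfold phiN
  rw [← finsum_sum_comm _ _ fun j _ => S.support_phiN (mem_of_isDirectSum hM h j)]
  exact finsum_congr fun i => h.finrank_hom_from _ fun j =>
    S.finiteDimensional_hom_kMod (mem_of_isDirectSum hM h j) i

namespace SerrePair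

variable {N P : C} {l : (N ⟶ P) →ₗ[k] k}

lemma isZero_left (hl : S.SerrePair N P l) (h : IsZero P) : IsZero N :=
  (IsZero.iff_id_eq_zero N).2 (hl.right N hl.memN _ fun y => by
    rw [h.eq_of_tgt (𝟙 N ≫ y) 0, map_zero])

lemma biprod {N' P' : C} {l' : (N' ⟶ P') →ₗ[k] k} (hl : S.SerrePair N P l)
    (hl' : S.SerrePair N' P' l') : ∃ l₀, S.SerrePair (N ⊞ N') (P ⊞ P') l₀ := by
  let F : (N ⊞ N' ⟶ P ⊞ P') →ₗ[k] k :=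
    l.comp ((Linear.leftComp k P biprod.inl).comp (Linear.rightComp k _ biprod.fst)) +
    l'.comp ((Linear.leftComp k P' biprod.inr).comp (Linear.rightComp k _ biprod.snd))
  have hF : ∀ x, F x = l (biprod.inl ≫ x ≫ biprod.fst) + l' (biprod.inr ≫ x ≫ biprod.snd) :=
    fun x => rfl
  refine ⟨F, FinitelyBuilt.biprod hl.memN hl'.memN, FinitelyBuilt.biprod hl.memP hl'.memP,
    fun W hW x hx => ?_, fun W hW y hy => ?_⟩
  · ext
    · rw [comp_zero]
      refine hl.right W hW _ fun y => ?_
      simpa [hF] using hx (y ≫ biprod.inl)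
    · rw [comp_zero]
      refine hl'.right W hW _ fun y => ?_
      simpa [hF] using hx (y ≫ biprod.inr)
  · ext
    · rw [zero_comp]
      refine hl.left W hW _ fun x => ?_
      simpa [hF] using hy (biprod.fst ≫ x)
    · rw [zero_comp]
      refine hl'.left W hW _ fun x => ?_
      simpa [hF] using hy (biprod.snd ≫ x)

lemma indec_left (t : ARTranslation C S.Dc) (hl : S.SerrePair N P l) (hP : Indec C P) :
    Indec C N := by
  refine ⟨fun h => ?_, fun A B ⟨e⟩ => ?_⟩
  · have h1 := hl.phiN_eq t
    rw [S.phiN_of_isZero h] at h1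
    have := phiN_pos hl.memP hP.1
    omega
  · obtain ⟨hA, hB⟩ := S.mem_of_iso_biprod hl.memN e
    obtain ⟨PA, lA, hlA, -⟩ := exists_serrePair_right t hA
    obtain ⟨PB, lB, hlB, -⟩ := exists_serrePair_right t hB
    obtain ⟨l₀, hl₀⟩ := hlA.biprod hlB
    exact (hP.2 _ _ ((hl.of_iso e (Iso.refl _)).nonempty_iso_right hl₀)).imp
      hlA.isZero_left hlB.isZero_left

end SerrePair

end DGSetup

end Decompositions

section AuslanderReitenTriangles

variable {k : Type u} [Field k]
variable {C : Type u} [Category.{v} C] [Preadditive C] [HasZeroObject C] [HasShift C ℤ]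
  [∀ n : ℤ, (shiftFunctor C n).Additive] [Pretriangulated C]
  [Linear k C] [HasFiniteBiproducts C] [∀ n : ℤ, Functor.Linear k (shiftFunctor C n)]
variable {Co : Type u} [Category.{v} Co] [Preadditive Co] [HasZeroObject Co] [HasShift Co ℤ]
  [∀ n : ℤ, (shiftFunctor Co n).Additive] [Pretriangulated Co]
  [Linear k Co] [HasFiniteBiproducts Co] [∀ n : ℤ, Functor.Linear k (shiftFunctor Co n)]

open Module

namespace IsARTriangle

variable {P : Set C} {X Y N : C} {f : X ⟶ Y} {g : Y ⟶ N} {h : N ⟶ X⟦(1 : ℤ)⟧}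

lemma exists_section (hT : IsARTriangle C P f g h) {W : C} (hW : W ∈ P) {v : W ⟶ N}
    (hv : v ≫ h ≠ 0) : ∃ s : N ⟶ W, s ≫ v = 𝟙 N := by
  by_contra hc
  obtain ⟨u, rfl⟩ := hT.fac_right W hW v hc
  exact hv (by rw [Category.assoc, dist_comp₂₃ hT.dist, comp_zero])

lemma not_section_right (hT : IsARTriangle C P f g h) (s : N ⟶ Y) : s ≫ g ≠ 𝟙 N := fun hs =>
  hT.h_ne (by rw [← Category.id_comp h, ← hs, Category.assoc, dist_comp₂₃ hT.dist, comp_zero])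

lemma not_retraction_left (hT : IsARTriangle C P f g h) (r : Y ⟶ X) : f ≫ r ≠ 𝟙 X := fun hr => by
  refine hT.h_ne ?_
  have h1 := congrArg (· ≫ r⟦(1 : ℤ)⟧') (dist_comp₃₁ hT.dist)
  rwa [Category.assoc, ← Functor.map_comp, hr, CategoryTheory.Functor.map_id, Category.comp_id,
    zero_comp] at h1

lemma exists_section_of_sum (hT : IsARTriangle C P f g h) {J : Type} [Fintype J] {Z : J → C}
    (hZ : ∀ j, Z j ∈ P) (a : ∀ j, N ⟶ Z j) (b : ∀ j, Z j ⟶ N) (hab : ∑ j, a j ≫ b j = 𝟙 N) :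
    ∃ j, ∃ s : N ⟶ Z j, s ≫ b j = 𝟙 N := by
  by_contra hc
  push Not at hc
  refine hT.h_ne ?_
  rw [← Category.id_comp h, ← hab, Preadditive.sum_comp]
  refine Finset.sum_eq_zero fun j _ => ?_
  have : b j ≫ h = 0 := by
    by_contra h0
    obtain ⟨s, hs⟩ := hT.exists_section (hZ j) h0
    exact hc j s hs
  rw [Category.assoc, this, comp_zero]

end IsARTriangle

namespace DGSetup

variable {S : DGSetup k C Co}

lemma isIso_or_isIso_of_add (t : ARTranslation C S.Dc) {M : C} (hM : M ∈ S.Dc) (hi : Indec C M)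
    {a b : M ⟶ M} (hab : a + b = 𝟙 M) : IsIso a ∨ IsIso b := by
  obtain ⟨Y, f, g, h, hT⟩ := t.triangle ⟨M, hM, hi⟩
  have := S.finiteDimensional_hom hM hM
  by_cases ha : a ≫ h = 0
  · have hb : b ≫ h ≠ 0 := fun hb => hT.h_ne (by
      rw [← Category.id_comp h, ← hab, Preadditive.add_comp, ha, hb, add_zero])
    obtain ⟨s, hs⟩ := hT.exists_section hM hb
    exact Or.inr (isIso_of_comp_eq_id (k := k) hs)
  · obtain ⟨s, hs⟩ := hT.exists_section hM ha
    exact Or.inl (isIso_of_comp_eq_id (k := k) hs)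

/-- A summand of an indecomposable object appears in every decomposition of the identity. -/
lemma exists_iso_of_sum (t : ARTranslation C S.Dc) {M : C} (hM : M ∈ S.Dc) (hi : Indec C M)
    {J : Type} [Fintype J] {Z : J → C} (hZ : ∀ j, Z j ∈ S.Dc) (hZi : ∀ j, Indec C (Z j))
    (a : ∀ j, M ⟶ Z j) (b : ∀ j, Z j ⟶ M) (hab : ∑ j, a j ≫ b j = 𝟙 M) :
    ∃ j, Nonempty (M ≅ Z j) := by
  obtain ⟨Y, f, g, h, hT⟩ := t.triangle ⟨M, hM, hi⟩
  obtain ⟨j, s, hs⟩ := hT.exists_section_of_sum hZ a b hab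
  have := (hZi j).isIso_of_split_mono hi.1 hs
  exact ⟨j, ⟨asIso s⟩⟩

section Triangle

variable {X Y N : C} {f : X ⟶ Y} {g : Y ⟶ N} {h : N ⟶ X⟦(1 : ℤ)⟧}

variable {J : Type} [Fintype J] {Z : J → C} {ι : ∀ j, Z j ⟶ Y} {π : ∀ j, Y ⟶ Z j}

/-- The indecomposable summands of the middle term of an Auslander-Reiten triangle are the
sources of irreducible morphisms to its end term. -/
theorem exists_irredMor_to_iff (t : ARTranslation C S.Dc) (hT : IsARTriangle C S.Dc f g h)
    (hX : Indec C X) (hN : Indec C N) (hD : IsDirectSum ι π) (hZ : ∀ j, Indec C (Z j)) {M : C}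
    (hM : M ∈ S.Dc) (hMi : Indec C M) :
    (∃ p : M ⟶ N, IrredMor C S.Dc p) ↔ ∃ j, Nonempty (M ≅ Z j) := by
  have hZm := mem_of_isDirectSum hT.memY hD
  constructor
  · rintro ⟨p, hp, hfac⟩
    obtain ⟨u, rfl⟩ := hT.fac_right M hM p (by
      rintro ⟨s, hs⟩
      exact hp (hMi.isIso_of_split_epi hN.1 hs))
    rcases hfac Y hT.memY u g rfl with ⟨s, hs⟩ | ⟨r, hr⟩
    · exact absurd hs (hT.not_section_right s)
    · refine exists_iso_of_sum t hM hMi hZm hZ (fun j => u ≫ π j) (fun j => ι j ≫ r) ?_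
      have := congrArg (fun v => u ≫ v ≫ r) hD.total
      simpa only [Preadditive.comp_sum, Preadditive.sum_comp, Category.assoc, Category.id_comp,
        hr] using this
  · rintro ⟨j, ⟨e⟩⟩
    refine ⟨e.hom ≫ ι j ≫ g, fun hiso => ?_, fun L hL σ ρ hσρ => ?_⟩
    · refine hT.not_section_right (inv (e.hom ≫ ι j ≫ g) ≫ e.hom ≫ ι j) ?_
      simp only [Category.assoc, IsIso.inv_hom_id]
    · by_contra hc
      rw [not_or] at hc
      obtain ⟨u, rfl⟩ := hT.fac_right L hL ρ hc.1
      obtain ⟨w, hw⟩ := dist_lift₂ hT.dist (e.hom ≫ ι j - σ ≫ u) (by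
        rw [Preadditive.sub_comp, Category.assoc, Category.assoc, hσρ, sub_self])
      have h1 : σ ≫ u ≫ π j ≫ e.inv + w ≫ f ≫ π j ≫ e.inv = 𝟙 M := by
        have h2 : w ≫ f ≫ π j ≫ e.inv = (w ≫ f) ≫ π j ≫ e.inv := by rw [Category.assoc]
        rw [h2, ← hw, Preadditive.sub_comp]
        simp only [Category.assoc, add_sub_cancel]
        rw [← Category.assoc (ι j), hD.comp_self, Category.id_comp, e.hom_inv_id]
      rcases isIso_or_isIso_of_add t hM hMi h1 with h2 | h2
      · refine hc.2 ⟨(u ≫ π j ≫ e.inv) ≫ inv (σ ≫ u ≫ π j ≫ e.inv), ?_⟩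
        rw [← Category.assoc, IsIso.hom_inv_id]
      · have h3 : (inv (w ≫ f ≫ π j ≫ e.inv) ≫ w) ≫ (f ≫ π j ≫ e.inv) = 𝟙 M := by
          rw [Category.assoc, IsIso.inv_hom_id]
        have h4 := hX.isIso_of_split_epi hMi.1 h3
        refine hT.not_retraction_left ((π j ≫ e.inv) ≫ inv (f ≫ π j ≫ e.inv)) ?_
        rw [← Category.assoc, IsIso.hom_inv_id]

/-- The indecomposable summands of the middle term of an Auslander-Reiten triangle are the
targets of irreducible morphisms from its first term. -/
theorem exists_irredMor_from_iff (t : ARTranslation C S.Dc) (hT : IsARTriangle C S.Dc f g h)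
    (hX : Indec C X) (hN : Indec C N) (hD : IsDirectSum ι π) (hZ : ∀ j, Indec C (Z j)) {M : C}
    (hM : M ∈ S.Dc) (hMi : Indec C M) :
    (∃ p : X ⟶ M, IrredMor C S.Dc p) ↔ ∃ j, Nonempty (M ≅ Z j) := by
  have hZm := mem_of_isDirectSum hT.memY hD
  constructor
  · rintro ⟨p, hp, hfac⟩
    obtain ⟨u, rfl⟩ := hT.fac_left M hM p (by
      rintro ⟨s, hs⟩
      exact hp (hMi.isIso_of_split_mono hX.1 hs))
    rcases hfac Y hT.memY f u rfl with ⟨r, hr⟩ | ⟨s, hs⟩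
    · refine exists_iso_of_sum t hM hMi hZm hZ (fun j => r ≫ π j) (fun j => ι j ≫ u) ?_
      have := congrArg (fun v => r ≫ v ≫ u) hD.total
      simpa only [Preadditive.comp_sum, Preadditive.sum_comp, Category.assoc, Category.id_comp,
        hr] using this
    · exact absurd hs (hT.not_retraction_left s)
  · rintro ⟨j, ⟨e⟩⟩
    refine ⟨f ≫ π j ≫ e.inv, fun hiso => ?_, fun L hL σ ρ hσρ => ?_⟩
    · refine hT.not_retraction_left ((π j ≫ e.inv) ≫ inv (f ≫ π j ≫ e.inv)) ?_
      rw [← Category.assoc, IsIso.hom_inv_id]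
    · by_contra hc
      rw [not_or] at hc
      obtain ⟨u, rfl⟩ := hT.fac_left L hL σ hc.2
      obtain ⟨w, hw⟩ := dist_desc₂ hT.dist (π j ≫ e.inv - u ≫ ρ) (by
        rw [Preadditive.comp_sub, ← Category.assoc f u, hσρ, sub_self])
      have h1 : (e.hom ≫ ι j ≫ u) ≫ ρ + (e.hom ≫ ι j ≫ g) ≫ w = 𝟙 M := by
        have h2 : (e.hom ≫ ι j ≫ g) ≫ w = e.hom ≫ ι j ≫ g ≫ w := by simp only [Category.assoc]
        rw [h2, ← hw, Preadditive.comp_sub, Preadditive.comp_sub]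
        simp only [Category.assoc, add_sub_cancel]
        rw [← Category.assoc (ι j), hD.comp_self, Category.id_comp, e.hom_inv_id]
      rcases isIso_or_isIso_of_add t hM hMi h1 with h2 | h2
      · refine hc.1 ⟨inv ((e.hom ≫ ι j ≫ u) ≫ ρ) ≫ (e.hom ≫ ι j ≫ u), ?_⟩
        rw [Category.assoc, IsIso.inv_hom_id]
      · have h3 : (e.hom ≫ ι j ≫ g) ≫ w ≫ inv ((e.hom ≫ ι j ≫ g) ≫ w) = 𝟙 M := by
          rw [← Category.assoc, IsIso.hom_inv_id]
        have h4 := hN.isIso_of_split_mono hMi.1 h3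
        refine hT.not_section_right (inv (e.hom ≫ ι j ≫ g) ≫ e.hom ≫ ι j) ?_
        simp only [Category.assoc, IsIso.inv_hom_id]

/-- The invariant `φ` is additive on Auslander-Reiten triangles. -/
theorem phiN_of_isARTriangle (hd : 0 < S.d) (hT : IsARTriangle C S.Dc f g h) :
    S.phiN Y = S.phiN N + S.phiN X := by
  refine S.phiN_eq_add hT.dist hT.memX hT.memY hT.memZ fun j v => ?_
  have hX1 : X⟦(1 : ℤ)⟧ ∈ S.Dc := hT.memX.shift 1
  have h0 : ¬ IsZero (X⟦(1 : ℤ)⟧) := fun h0 => hT.h_ne (h0.eq_of_tgt _ _)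
  obtain ⟨m, hm, x, hx⟩ : ∃ m, m ≠ -j ∧ ∃ x : S.cell m ⟶ X⟦(1 : ℤ)⟧, x ≠ 0 := by
    obtain ⟨c, hc, x, hx⟩ := S.exists_infGE hX1 h0
    obtain ⟨i, hi, y, hy⟩ := hc.exists_ne_zero hX1 h0
    by_cases hcj : c = -j
    · exact ⟨i, by omega, y, hy⟩
    · exact ⟨c, hcj, x, hx⟩
  obtain ⟨V, q, r, hV⟩ := distinguished_cocone_triangle x
  have hVm : V ∈ S.Dc := FinitelyBuilt.cone x q r hV (S.cell_mem m) hX1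
  obtain ⟨w, rfl⟩ := dist_desc₂ hV v (S.cell_kMod_eq_zero (by omega) _)
  rw [← Category.assoc, IsARTriangle.connecting_comp_eq_zero (R₀ := S.R) hT hVm q, zero_comp]
  rintro ⟨r, hr⟩
  apply hx
  rw [← Category.comp_id x, ← hr, ← Category.assoc, dist_comp₁₂ hV, zero_comp]

lemma finrank_hom_middle_le (hT : IsARTriangle C S.Dc f g h) {W : C} (hW : W ∈ S.Dc) :
    finrank k (W ⟶ Y) ≤ finrank k (W ⟶ X) + finrank k (W ⟶ N) := by
  have := S.finiteDimensional_hom hW hT.memX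
  have := S.finiteDimensional_hom hW hT.memZ
  have h1 := (finrank_hom_to_mid_le (k := k) hT.dist W).2
  have := Submodule.finrank_le (LinearMap.range (Linear.rightComp k W g))
  omega

lemma finrank_hom_middle_lt (hT : IsARTriangle C S.Dc f g h) {W : C} (e : W ≅ N) :
    finrank k (W ⟶ Y) < finrank k (W ⟶ X) + finrank k (W ⟶ N) := by
  have hW : W ∈ S.Dc := FinitelyBuilt.iso e.symm hT.memZ
  have := S.finiteDimensional_hom hW hT.memX
  have := S.finiteDimensional_hom hW hT.memZ
  have h1 := (finrank_hom_to_mid_le (k := k) hT.dist W).2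
  have := Submodule.finrank_lt (s := LinearMap.range (Linear.rightComp k W g)) (by
    intro htop
    obtain ⟨s, hs⟩ := (LinearMap.range_eq_top.1 htop) e.hom
    change s ≫ g = e.hom at hs
    refine hT.not_section_right (e.inv ≫ s) ?_
    rw [Category.assoc, hs, e.inv_hom_id])
  omega

end Triangle

end DGSetup

end AuslanderReitenTriangles

section TranslationQuivers

namespace Multiset

variable {V : Type*}

lemma apply_le_sum_map {m : Multiset V} {a : V} (ha : a ∈ m) (f : V → ℕ) : f a ≤ (m.map f).sum := by
  obtain ⟨m, rfl⟩ := exists_cons_of_mem ha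
  simp

lemma apply_add_apply_le_sum_map {m : Multiset V} {a b : V} (ha : a ∈ m) (hb : b ∈ m)
    (hab : a ≠ b) (f : V → ℕ) : f a + f b ≤ (m.map f).sum := by
  obtain ⟨m, rfl⟩ := exists_cons_of_mem ha
  have := apply_le_sum_map ((mem_cons.1 hb).resolve_left hab.symm) f
  simpa using this

lemma eq_of_forall_le_of_sum_map_le {m : Multiset V} {f g : V → ℕ} (hle : ∀ z ∈ m, f z ≤ g z)
    (hsum : (m.map g).sum ≤ (m.map f).sum) {a : V} (ha : a ∈ m) : f a = g a := by
  obtain ⟨m, rfl⟩ := exists_cons_of_mem ha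
  have h1 := hle a ha
  have h2 : (m.map f).sum ≤ (m.map g).sum :=
    sum_map_le_sum_map f g fun z hz => hle z (mem_cons_of_mem hz)
  simp only [map_cons, sum_cons] at hsum
  omega

end Multiset

/-- A stable translation quiver, all of whose meshes are finite, with a positive additive function
`φ` and, for each vertex `w`, a subadditive function `Ψ w` which is not additive at `w`. -/
structure TranslationData (V : Type*) where
  τ : Equiv.Perm V
  Arrow : V → V → Prop
  φ : V → ℕ
  mid : V → Multiset V
  Ψ : V → V → ℕ
  mem_mid : ∀ x y, x ∈ mid y ↔ Arrow x y
  arrow_iff : ∀ x y, Arrow x y ↔ Arrow (τ y) x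
  sum_φ : ∀ y, ((mid y).map φ).sum = 2 * φ y
  φ_τ : ∀ y, φ (τ y) = φ y
  φ_pos : ∀ y, 0 < φ y
  Ψ_τ : ∀ w y, Ψ w (τ y) = Ψ w y
  Ψ_le : ∀ w y, ((mid y).map (Ψ w)).sum ≤ 2 * Ψ w y
  Ψ_lt : ∀ w, ((mid w).map (Ψ w)).sum < 2 * Ψ w w
  free : ∀ (y : V) (p : ℤ), (τ ^ p) y = y → p = 0

namespace TranslationData

variable {V : Type*} (D : TranslationData V)

/-- Two vertices are connected by a zigzag of arrows. -/
def Conn (v w : V) : Prop := Relation.EqvGen (fun v w => D.Arrow v w ∨ D.Arrow w v) v w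

variable {D}

lemma Conn.refl (v : V) : D.Conn v v := Relation.EqvGen.refl v

lemma Conn.symm {v w : V} (h : D.Conn v w) : D.Conn w v := Relation.EqvGen.symm _ _ h

lemma Conn.trans {v w x : V} (h : D.Conn v w) (h' : D.Conn w x) : D.Conn v x :=
  Relation.EqvGen.trans _ _ _ h h'

lemma conn_of_arrow {v w : V} (h : D.Arrow v w) : D.Conn v w := Relation.EqvGen.rel _ _ (Or.inl h)

variable (D)

lemma arrow_τ_iff (x y : V) : D.Arrow (D.τ x) (D.τ y) ↔ D.Arrow x y := by
  rw [D.arrow_iff x y, D.arrow_iff (D.τ y) x]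

lemma exists_arrow_to (y : V) : ∃ x, D.Arrow x y := by
  by_contra hc
  push Not at hc
  have h0 : D.mid y = 0 := Multiset.eq_zero_of_forall_notMem fun x hx => hc x ((D.mem_mid x y).1 hx)
  have h1 := D.sum_φ y
  have := D.φ_pos y
  rw [h0] at h1
  simp at h1
  omega

lemma conn_τ (y : V) : D.Conn (D.τ y) y := by
  obtain ⟨x, hx⟩ := D.exists_arrow_to y
  exact (conn_of_arrow ((D.arrow_iff x y).1 hx)).trans (conn_of_arrow hx)

lemma conn_induction {U : V → Prop} (hτ : ∀ x, U (D.τ x) → U x)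
    (hA : ∀ x y, D.Arrow x y → U y → U x) {v w : V} (h : D.Conn v w) : U v ↔ U w := by
  induction h with
  | rel x y h =>
    have key : ∀ x y, D.Arrow x y → (U x ↔ U y) := fun x y h =>
      ⟨fun hx => hτ y (hA _ _ ((D.arrow_iff x y).1 h) hx), hA x y h⟩
    rcases h with h | h
    · exact key x y h
    · exact (key y x h).symm
  | refl x => rfl
  | symm x y _ ih => exact ih.symm
  | trans x y z _ _ ih ih' => exact ih.trans ih'

lemma exists_lt_φ (v : V) (K : ℕ) : ∃ w, D.Conn w v ∧ K < D.φ w := by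
  by_contra hc
  push Not at hc
  have hdvd : ∀ w, D.Conn w v → K.factorial / D.φ w * D.φ w = K.factorial := fun w hw =>
    Nat.div_mul_cancel (Nat.dvd_factorial (D.φ_pos w) (hc w hw))
  obtain ⟨w₀, hw₀, hmin⟩ : ∃ w₀, D.Conn w₀ v ∧ ∀ w, D.Conn w v →
      D.Ψ v w₀ * (K.factorial / D.φ w₀) ≤ D.Ψ v w * (K.factorial / D.φ w) := by
    let s : Set V := {w | D.Conn w v}
    have hs : s.Nonempty := ⟨v, Conn.refl v⟩
    let f : V → ℕ := fun w => D.Ψ v w * (K.factorial / D.φ w)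
    exact ⟨Function.argminOn f s hs, Function.argminOn_mem f s hs,
      fun w hw => Function.argminOn_le f s hw⟩
  have hle : ∀ w, D.Conn w v → D.Ψ v w₀ * D.φ w ≤ D.φ w₀ * D.Ψ v w := by
    intro w hw
    have h1 := Nat.mul_le_mul_right (D.φ w₀ * D.φ w) (hmin w hw)
    have h2 : D.Ψ v w₀ * (K.factorial / D.φ w₀) * (D.φ w₀ * D.φ w) =
        K.factorial * (D.Ψ v w₀ * D.φ w) := by
      rw [← congrArg (· * (D.Ψ v w₀ * D.φ w)) (hdvd w₀ hw₀)]; ring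
    have h3 : D.Ψ v w * (K.factorial / D.φ w) * (D.φ w₀ * D.φ w) =
        K.factorial * (D.φ w₀ * D.Ψ v w) := by
      rw [← congrArg (· * (D.φ w₀ * D.Ψ v w)) (hdvd w hw)]; ring
    rw [h2, h3] at h1
    exact Nat.le_of_mul_le_mul_left h1 K.factorial_pos
  have hconn : ∀ x y, D.Conn y v → x ∈ D.mid y → D.Conn x v := fun x y hy hx =>
    (conn_of_arrow ((D.mem_mid x y).1 hx)).trans hy
  have hsum : ∀ y, D.Conn y v → ((D.mid y).map fun z => D.Ψ v w₀ * D.φ z).sum ≤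
      ((D.mid y).map fun z => D.φ w₀ * D.Ψ v z).sum := fun y hy =>
    Multiset.sum_map_le_sum_map _ _ fun z hz => hle z (hconn z y hy hz)
  have hU := (D.conn_induction
    (U := fun w => D.Conn w v ∧ D.Ψ v w₀ * D.φ w = D.φ w₀ * D.Ψ v w) ?_ ?_ hw₀).1 ⟨hw₀, mul_comm _ _⟩
  · have h1 := hsum v (Conn.refl v)
    have h2 := D.Ψ_lt v
    have h3 := D.φ_pos w₀
    rw [Multiset.sum_map_mul_left, Multiset.sum_map_mul_left, D.sum_φ] at h1
    have h4 := hU.2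
    have h5 := Nat.mul_lt_mul_of_pos_left h2 h3
    nlinarith
  · rintro x ⟨hx, hx'⟩
    rw [D.φ_τ, D.Ψ_τ] at hx'
    exact ⟨(D.conn_τ x).symm.trans hx, hx'⟩
  · rintro x y hxy ⟨hy, hy'⟩
    have hx := (D.mem_mid x y).2 hxy
    refine ⟨hconn x y hy hx, ?_⟩
    refine Multiset.eq_of_forall_le_of_sum_map_le (f := fun z => D.Ψ v w₀ * D.φ z)
      (g := fun z => D.φ w₀ * D.Ψ v z) (fun z hz => hle z (hconn z y hy hz)) ?_ hx
    rw [Multiset.sum_map_mul_left, Multiset.sum_map_mul_left, D.sum_φ]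
    have h1 := Nat.mul_le_mul_left (D.φ w₀) (D.Ψ_le v y)
    nlinarith

/-- The vertices reached from the translation orbit of `y` along arrows on which `φ` does not
increase. -/
inductive Descends (y : V) : V → Prop
  | base : Descends y y
  | tau (x : V) : Descends y x → Descends y (D.τ x)
  | tau_inv (x : V) : Descends y (D.τ x) → Descends y x
  | step (x z : V) : Descends y x → D.Arrow z x → D.φ z ≤ D.φ x → Descends y z

lemma exists_upper (y : V) : ∃ z, D.Arrow z y ∧ D.φ y < D.φ z := by
  by_contra hc
  push Not at hc
  have hclosed : ∀ x, D.Descends y x → ∀ z, D.Arrow z x → D.Descends y z := by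
    intro x hx
    induction hx with
    | base => exact fun z hz => .step _ _ .base hz (hc z hz)
    | tau x _ ih =>
      intro z hz
      obtain ⟨z, rfl⟩ := D.τ.surjective z
      exact .tau _ (ih z ((D.arrow_τ_iff z x).1 hz))
    | tau_inv x _ ih => exact fun z hz => .tau_inv _ (ih _ ((D.arrow_τ_iff z x).2 hz))
    | step x z hx hzx hle _ =>
      intro w hw
      by_cases hwx : w = D.τ x
      · exact hwx ▸ .tau _ hx
      · refine .step _ _ (.step _ _ hx hzx hle) hw ?_
        have h1 := Multiset.apply_add_apply_le_sum_map ((D.mem_mid _ _).2 hw)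
          ((D.mem_mid _ _).2 ((D.arrow_iff _ _).1 hzx)) hwx D.φ
        rw [D.sum_φ, D.φ_τ] at h1
        omega
  have hle : ∀ x, D.Descends y x → D.φ x ≤ D.φ y := by
    intro x hx
    induction hx with
    | base => exact le_rfl
    | tau x _ ih => rwa [D.φ_τ]
    | tau_inv x _ ih => rwa [D.φ_τ] at ih
    | step x z _ _ h ih => exact h.trans ih
  obtain ⟨w, hw, hlt⟩ := D.exists_lt_φ y (D.φ y)
  have := hle w ((D.conn_induction (fun x => .tau_inv x) (fun x z h hz => hclosed z hz x h) hw).2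
    .base)
  omega

lemma φ_le_two_mul {z y : V} (h : D.Arrow z y) : D.φ y ≤ 2 * D.φ z := by
  have := Multiset.apply_le_sum_map ((D.mem_mid _ _).2 ((D.arrow_iff _ _).1 h)) D.φ
  rwa [D.sum_φ, D.φ_τ] at this

lemma φ_ne {z y : V} (h : D.Arrow z y) : D.φ z ≠ D.φ y := by
  intro he
  obtain ⟨u, hu, hlt⟩ := D.exists_upper y
  have := Multiset.apply_add_apply_le_sum_map ((D.mem_mid _ _).2 h) ((D.mem_mid _ _).2 hu)
    (by rintro rfl; omega) D.φ
  rw [D.sum_φ] at this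
  omega

/-- The shape of the middle term of a mesh. -/
theorem middle_eq {y : V} {m : Multiset V} (hm : ∀ x, x ∈ m ↔ D.Arrow x y)
    (hsum : (m.map D.φ).sum = 2 * D.φ y) :
    ∃ u, D.φ y < D.φ u ∧ (m = {u} ∨ ∃ l, D.φ l < D.φ y ∧ m = {u, l}) := by
  obtain ⟨u, hu, hlt⟩ := D.exists_upper y
  obtain ⟨m', rfl⟩ := Multiset.exists_cons_of_mem ((hm u).2 hu)
  rw [Multiset.map_cons, Multiset.sum_cons] at hsum
  refine ⟨u, hlt, ?_⟩
  induction m' using Multiset.induction_on with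
  | empty => exact Or.inl rfl
  | cons l m' _ =>
    rw [Multiset.map_cons, Multiset.sum_cons] at hsum
    have hl := D.φ_ne ((hm l).1 (by simp))
    refine Or.inr ⟨l, by omega, ?_⟩
    rcases Multiset.empty_or_exists_mem m' with rfl | ⟨l', hl'⟩
    · rfl
    · have h1 := D.φ_le_two_mul ((hm l).1 (by simp))
      have h2 := D.φ_le_two_mul ((hm l').1 (by simp [hl']))
      have h3 := Multiset.apply_le_sum_map hl' D.φ
      omega

theorem nodup_middle {y : V} {m : Multiset V} (hm : ∀ x, x ∈ m ↔ D.Arrow x y)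
    (hsum : (m.map D.φ).sum = 2 * D.φ y) : m.Nodup := by
  obtain ⟨u, hu, rfl | ⟨l, hl, rfl⟩⟩ := D.middle_eq hm hsum
  · simp
  · simp only [Multiset.insert_eq_cons, Multiset.nodup_cons, Multiset.mem_singleton,
      Multiset.nodup_singleton, and_true]
    rintro rfl
    omega

lemma exists_next (y : V) : ∃ z, D.Arrow (D.τ z) y ∧ D.φ y < D.φ z := by
  obtain ⟨u, hu, hlt⟩ := D.exists_upper y
  obtain ⟨z, rfl⟩ := D.τ.surjective u
  exact ⟨z, hu, by rwa [D.φ_τ] at hlt⟩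

/-- The successor of `y` with larger value of `φ`. -/
noncomputable def next (y : V) : V := (D.exists_next y).choose

lemma arrow_τ_next (y : V) : D.Arrow (D.τ (D.next y)) y := (D.exists_next y).choose_spec.1

lemma lt_φ_next (y : V) : D.φ y < D.φ (D.next y) := (D.exists_next y).choose_spec.2

lemma arrow_next (y : V) : D.Arrow y (D.next y) := (D.arrow_iff _ _).2 (D.arrow_τ_next y)

lemma arrow_to_iff_of_lower {l y : V} (hl : D.Arrow l y) (hlt : D.φ l < D.φ y) :
    (∀ x, D.Arrow x y ↔ x = D.τ (D.next y) ∨ x = l) ∧ D.φ (D.next y) + D.φ l = 2 * D.φ y := by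
  have h1 := D.arrow_τ_next y
  have h2 := D.lt_φ_next y
  have hsum := D.sum_φ y
  obtain ⟨u, hu, hm | ⟨l', hl', hm⟩⟩ := D.middle_eq (fun x => D.mem_mid x y) (D.sum_φ y) <;>
    simp only [← D.mem_mid, hm, Multiset.insert_eq_cons, Multiset.mem_cons,
      Multiset.mem_singleton, Multiset.map_singleton, Multiset.map_cons, Multiset.sum_singleton,
      Multiset.sum_cons] at *
  · subst hl; omega
  · have hll : l = l' := by
      rcases hl with rfl | rfl
      · omega
      · rfl
    have huu : D.τ (D.next y) = u := by
      rcases h1 with h1 | h1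
      · exact h1
      · have h3 := D.φ_τ (D.next y)
        rw [h1] at h3
        omega
    subst hll huu
    rw [D.φ_τ] at hsum
    exact ⟨fun x => Iff.rfl, hsum⟩

lemma arrow_to_iff_of_not_lower {y : V} (h : ∀ x, D.Arrow x y → D.φ y ≤ D.φ x) :
    (∀ x, D.Arrow x y ↔ x = D.τ (D.next y)) ∧ D.φ (D.next y) = 2 * D.φ y := by
  have h1 := D.arrow_τ_next y
  have hsum := D.sum_φ y
  obtain ⟨u, hu, hm | ⟨l', hl', hm⟩⟩ := D.middle_eq (fun x => D.mem_mid x y) (D.sum_φ y) <;>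
    simp only [← D.mem_mid, hm, Multiset.insert_eq_cons, Multiset.mem_cons,
      Multiset.mem_singleton, Multiset.map_singleton, Multiset.map_cons, Multiset.sum_singleton,
      Multiset.sum_cons] at *
  · subst h1
    rw [D.φ_τ] at hsum
    exact ⟨fun x => Iff.rfl, hsum⟩
  · have := h l' (Or.inr rfl)
    omega

lemma arrow_zpow_iff (p : ℤ) (x y : V) : D.Arrow ((D.τ ^ p) x) ((D.τ ^ p) y) ↔ D.Arrow x y := by
  induction p using Int.induction_on generalizing x y with
  | zero => simp
  | succ n ih =>
    rw [zpow_add_one, Equiv.Perm.mul_apply, Equiv.Perm.mul_apply, ih, D.arrow_τ_iff]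
  | pred n ih =>
    have h := ih (D.τ⁻¹ x) (D.τ⁻¹ y)
    rw [← D.arrow_τ_iff (D.τ⁻¹ x)] at h
    simpa [zpow_sub_one, Equiv.Perm.mul_apply] using h

lemma next_iterate_succ (b : V) (n : ℕ) : D.next^[n + 1] b = D.next (D.next^[n] b) :=
  Function.iterate_succ_apply' _ _ _

lemma φ_next_iterate {b : V} (hb : ∀ x, D.Arrow x b → D.φ b ≤ D.φ x) (n : ℕ) :
    D.φ (D.next^[n] b) = (n + 1) * D.φ b := by
  induction n using Nat.strong_induction_on with
  | _ n ih =>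
    match n with
    | 0 => simp
    | 1 => simpa using (D.arrow_to_iff_of_not_lower hb).2
    | n + 2 =>
      have h1 := ih n (by omega)
      have h2 := ih (n + 1) (by omega)
      have h3 := (D.arrow_to_iff_of_lower (D.arrow_next (D.next^[n] b)) (D.lt_φ_next _)).2
      simp only [← D.next_iterate_succ] at h3
      rw [h1, h2] at h3
      linarith

/-- The vertex in position `(p, n + 1)` of the component of `b`. -/
noncomputable def grid (b : V) (p : ℤ) (n : ℕ) : V := (D.τ ^ p) (D.next^[n] b)

lemma τ_zpow_grid (b : V) (p q : ℤ) (n : ℕ) : (D.τ ^ q) (D.grid b p n) = D.grid b (q + p) n := by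
  rw [grid, grid, zpow_add, Equiv.Perm.mul_apply]

lemma τ_grid (b : V) (p : ℤ) (n : ℕ) : D.τ (D.grid b p n) = D.grid b (p + 1) n := by
  have := D.τ_zpow_grid b p 1 n
  rwa [zpow_one, add_comm] at this

lemma φ_zpow (p : ℤ) (x : V) : D.φ ((D.τ ^ p) x) = D.φ x := by
  induction p using Int.induction_on generalizing x with
  | zero => simp
  | succ n ih => rw [zpow_add_one, Equiv.Perm.mul_apply, ih, D.φ_τ]
  | pred n ih =>
    rw [zpow_sub_one, Equiv.Perm.mul_apply, ih, ← D.φ_τ]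
    simp

lemma φ_grid {b : V} (hb : ∀ x, D.Arrow x b → D.φ b ≤ D.φ x) (p : ℤ) (n : ℕ) :
    D.φ (D.grid b p n) = (n + 1) * D.φ b := by
  rw [grid, D.φ_zpow, D.φ_next_iterate hb]

lemma grid_injective {b : V} (hb : ∀ x, D.Arrow x b → D.φ b ≤ D.φ x) {p q : ℤ} {n m : ℕ}
    (h : D.grid b p n = D.grid b q m) : p = q ∧ n = m := by
  have h1 := congrArg D.φ h
  rw [D.φ_grid hb, D.φ_grid hb] at h1
  have h2 : n = m := by simpa using Nat.eq_of_mul_eq_mul_right (D.φ_pos b) h1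
  subst h2
  have h3 := congrArg (D.τ ^ (-q)) h
  rw [D.τ_zpow_grid, D.τ_zpow_grid, neg_add_cancel] at h3
  have h4 := D.free (D.next^[n] b) (-q + p) (by simpa [grid] using h3)
  exact ⟨by omega, rfl⟩

lemma arrow_grid_iff (b : V) (p : ℤ) (n : ℕ) (x : V) :
    D.Arrow x (D.grid b p n) ↔ D.Arrow ((D.τ ^ (-p)) x) (D.next^[n] b) := by
  rw [← D.arrow_zpow_iff p ((D.τ ^ (-p)) x)]
  simp [grid]

lemma zpow_neg_apply_eq_iff (p : ℤ) (x y : V) : (D.τ ^ (-p)) x = y ↔ x = (D.τ ^ p) y := by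
  rw [zpow_neg, Equiv.Perm.inv_eq_iff_eq, eq_comm, eq_comm]

lemma arrow_grid_zero_iff {b : V} (hb : ∀ x, D.Arrow x b → D.φ b ≤ D.φ x) (p : ℤ) (x : V) :
    D.Arrow x (D.grid b p 0) ↔ x = D.grid b (p + 1) 1 := by
  rw [arrow_grid_iff, Function.iterate_zero_apply, (D.arrow_to_iff_of_not_lower hb).1,
    zpow_neg_apply_eq_iff, grid, zpow_add_one]
  simp

lemma arrow_grid_succ_iff (b : V) (p : ℤ) (n : ℕ) (x : V) :
    D.Arrow x (D.grid b p (n + 1)) ↔ x = D.grid b (p + 1) (n + 2) ∨ x = D.grid b p n := by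
  have h := (D.arrow_to_iff_of_lower (D.arrow_next (D.next^[n] b)) (D.lt_φ_next _)).1
  rw [arrow_grid_iff, next_iterate_succ, h, zpow_neg_apply_eq_iff, zpow_neg_apply_eq_iff, grid,
    zpow_add_one, next_iterate_succ, next_iterate_succ, grid, Equiv.Perm.mul_apply]

lemma exists_eq_grid {b : V} (hb : ∀ x, D.Arrow x b → D.φ b ≤ D.φ x) {v : V} (h : D.Conn v b) :
    ∃ p n, v = D.grid b p n := by
  refine (D.conn_induction (U := fun v => ∃ p n, v = D.grid b p n) ?_ ?_ h).2 ⟨0, 0, ?_⟩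
  · rintro x ⟨p, n, hx⟩
    refine ⟨p - 1, n, D.τ.injective ?_⟩
    rw [hx, τ_grid, sub_add_cancel]
  · rintro x y hxy ⟨p, n, rfl⟩
    cases n with
    | zero => exact ⟨_, _, (D.arrow_grid_zero_iff hb p x).1 hxy⟩
    | succ n =>
      rcases (D.arrow_grid_succ_iff b p n x).1 hxy with h | h
      · exact ⟨_, _, h⟩
      · exact ⟨_, _, h⟩
  · simp [grid]

lemma conn_zpow (p : ℤ) (x : V) : D.Conn ((D.τ ^ p) x) x := by
  induction p using Int.induction_on with
  | zero => exact Conn.refl x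
  | succ n ih =>
    rw [add_comm, zpow_one_add, Equiv.Perm.mul_apply]
    exact (D.conn_τ _).trans ih
  | pred n ih =>
    refine Conn.trans (Conn.symm ?_) ih
    have := D.conn_τ ((D.τ ^ (-(n : ℤ) - 1)) x)
    rwa [← Equiv.Perm.mul_apply, ← zpow_one_add, add_sub_cancel] at this

lemma conn_grid (b : V) (p : ℤ) (n : ℕ) : D.Conn (D.grid b p n) b := by
  refine (D.conn_zpow p _).trans ?_
  induction n with
  | zero => exact Conn.refl b
  | succ n ih =>
    rw [next_iterate_succ]
    exact (conn_of_arrow (D.arrow_next _)).symm.trans ih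

theorem arrow_grid_grid_iff {b : V} (hb : ∀ x, D.Arrow x b → D.φ b ≤ D.φ x) (a c : ZAVertex) :
    D.Arrow (D.grid b a.1 a.2.natPred) (D.grid b c.1 c.2.natPred) ↔ ZAArrow a c := by
  obtain ⟨p, n⟩ := a
  obtain ⟨q, m⟩ := c
  have hinj : ∀ (q' : ℤ) (m' : ℕ), D.grid b p n.natPred = D.grid b q' m' ↔
      p = q' ∧ n.natPred = m' :=
    fun q' m' => ⟨D.grid_injective hb, by rintro ⟨rfl, rfl⟩; rfl⟩
  have hn := n.natPred_add_one
  have hm := m.natPred_add_one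
  simp only [ZAArrow, ← PNat.coe_inj, PNat.add_coe, PNat.one_coe, ← hn, ← hm]
  generalize n.natPred = n' at *
  generalize m.natPred = m' at *
  cases m' with
  | zero =>
    rw [D.arrow_grid_zero_iff hb, hinj]
    omega
  | succ m' =>
    rw [D.arrow_grid_succ_iff, hinj, hinj]
    omega

/-- Each component of a stable translation quiver as in `TranslationData` is `ℤA∞`, and the
function `φ` on it is linear. -/
theorem exists_equiv_ZAVertex (v₀ : V) :
    ∃ (θ : {v // D.Conn v v₀} ≃ ZAVertex) (c : ℕ),
      (∀ v w, D.Arrow v.1 w.1 ↔ ZAArrow (θ v) (θ w)) ∧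
      (∀ v, θ ⟨D.τ v.1, (D.conn_τ v.1).trans v.2⟩ = ZATrans (θ v)) ∧
      ∀ v, D.φ v.1 = (θ v).2 * c := by
  obtain ⟨b, hbv, hb⟩ : ∃ b, D.Conn b v₀ ∧ ∀ w, D.Conn w v₀ → D.φ b ≤ D.φ w := by
    let s : Set V := {w | D.Conn w v₀}
    have hs : s.Nonempty := ⟨v₀, Conn.refl v₀⟩
    exact ⟨Function.argminOn D.φ s hs, Function.argminOn_mem D.φ s hs,
      fun w hw => Function.argminOn_le D.φ s hw⟩
  replace hb : ∀ x, D.Arrow x b → D.φ b ≤ D.φ x := fun x hx =>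
    hb x ((conn_of_arrow hx).trans hbv)
  let F : ZAVertex → {v // D.Conn v v₀} := fun a =>
    ⟨D.grid b a.1 a.2.natPred, (D.conn_grid b _ _).trans hbv⟩
  have hF : Function.Bijective F := by
    constructor
    · intro a c h
      obtain ⟨h1, h2⟩ := D.grid_injective hb (congrArg Subtype.val h)
      refine Prod.ext h1 (PNat.coe_inj.1 ?_)
      rw [← a.2.natPred_add_one, h2, c.2.natPred_add_one]
    · rintro ⟨v, hv⟩
      obtain ⟨p, n, rfl⟩ := D.exists_eq_grid hb (hv.trans hbv.symm)
      exact ⟨(p, n.succPNat), Subtype.ext (by simp [F])⟩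
  let e := Equiv.ofBijective F hF
  have he : ∀ a, (e a).1 = D.grid b a.1 a.2.natPred := fun a => rfl
  refine ⟨e.symm, D.φ b, fun v w => ?_, fun v => ?_, fun v => ?_⟩
  · obtain ⟨a, rfl⟩ := e.surjective v
    obtain ⟨c, rfl⟩ := e.surjective w
    rw [he, he, e.symm_apply_apply, e.symm_apply_apply, D.arrow_grid_grid_iff hb]
  · obtain ⟨a, rfl⟩ := e.surjective v
    rw [Equiv.symm_apply_eq, e.symm_apply_apply]
    exact Subtype.ext (D.τ_grid b _ _)
  · obtain ⟨a, rfl⟩ := e.surjective v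
    rw [e.symm_apply_apply, he, D.φ_grid hb, PNat.natPred_add_one]

end TranslationData

end TranslationQuivers

section Vertices

variable {k : Type u} [Field k]
variable {C : Type u} [Category.{v} C] [Preadditive C] [HasZeroObject C] [HasShift C ℤ]
  [∀ n : ℤ, (shiftFunctor C n).Additive] [Pretriangulated C]
  [Linear k C] [HasFiniteBiproducts C] [∀ n : ℤ, Functor.Linear k (shiftFunctor C n)]
variable {Co : Type u} [Category.{v} Co] [Preadditive Co] [HasZeroObject Co] [HasShift Co ℤ]
  [∀ n : ℤ, (shiftFunctor Co n).Additive] [Pretriangulated Co]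
  [Linear k Co] [HasFiniteBiproducts Co] [∀ n : ℤ, Functor.Linear k (shiftFunctor Co n)]

open Module

namespace DGSetup

variable {S : DGSetup k C Co}

/-- A representative of a vertex of the Auslander-Reiten quiver. -/
noncomputable def rep (v : ARVertex C S.Dc) : IndecObj C S.Dc := Quotient.out v

lemma vertexOf_rep (v : ARVertex C S.Dc) : vertexOf C S.Dc (rep v) = v := Quotient.out_eq v

lemma vertexOf_eq_iff {M N : IndecObj C S.Dc} :
    vertexOf C S.Dc M = vertexOf C S.Dc N ↔ Nonempty (M.1 ≅ N.1) := Quotient.eq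

lemma nonempty_rep_iso (M : IndecObj C S.Dc) : Nonempty ((rep (vertexOf C S.Dc M)).1 ≅ M.1) :=
  vertexOf_eq_iff.1 (vertexOf_rep _)

lemma vmap_vertexOf (t : ARTranslation C S.Dc) (M : IndecObj C S.Dc) :
    t.vmap (vertexOf C S.Dc M) = vertexOf C S.Dc (t.τ M) := rfl

lemma exists_serrePair_τ (t : ARTranslation C S.Dc) (N : IndecObj C S.Dc) :
    ∃ l, S.SerrePair N.1 ((t.τ N).1⟦(1 : ℤ)⟧) l := by
  obtain ⟨Y, f, g, h, hT⟩ := t.triangle N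
  exact S.exists_serrePair_of_AR hT

lemma nonempty_iso_of_shift {X Y : C} (e : X⟦(1 : ℤ)⟧ ≅ Y⟦(1 : ℤ)⟧) : Nonempty (X ≅ Y) :=
  ⟨(shiftFunctor C (1 : ℤ)).preimageIso e⟩

lemma nonempty_τ_iso_of_serrePair (t : ARTranslation C S.Dc) (N : IndecObj C S.Dc) {X : C}
    {l : (N.1 ⟶ X⟦(1 : ℤ)⟧) →ₗ[k] k} (hl : S.SerrePair N.1 (X⟦(1 : ℤ)⟧) l) :
    Nonempty ((t.τ N).1 ≅ X) := by
  obtain ⟨l', hl'⟩ := exists_serrePair_τ t N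
  obtain ⟨e⟩ := hl'.nonempty_iso_right hl
  exact nonempty_iso_of_shift e

lemma vmap_bijective (t : ARTranslation C S.Dc) : Function.Bijective t.vmap := by
  constructor
  · intro v w h
    rw [← vertexOf_rep v, ← vertexOf_rep w, vmap_vertexOf, vmap_vertexOf, vertexOf_eq_iff] at h
    rw [← vertexOf_rep v, ← vertexOf_rep w, vertexOf_eq_iff]
    obtain ⟨e⟩ := h
    obtain ⟨l, hl⟩ := exists_serrePair_τ t (rep v)
    obtain ⟨l', hl'⟩ := exists_serrePair_τ t (rep w)
    exact (hl.of_iso (Iso.refl _) ((shiftFunctor C (1 : ℤ)).mapIso e)).nonempty_iso_left hl'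
  · intro v
    obtain ⟨N, l, hl, -⟩ := exists_serrePair_left t ((rep v).2.1.shift (1 : ℤ))
    have hN : Indec C N := hl.indec_left t ((rep v).2.2.shift 1)
    refine ⟨vertexOf C S.Dc ⟨N, hl.memN, hN⟩, ?_⟩
    refine (vertexOf_eq_iff.2 ?_).trans (vertexOf_rep v)
    exact nonempty_τ_iso_of_serrePair t ⟨N, hl.memN, hN⟩ hl

/-- The translation as a permutation of the vertices of the Auslander-Reiten quiver. -/
noncomputable def vperm (t : ARTranslation C S.Dc) : Equiv.Perm (ARVertex C S.Dc) :=
  Equiv.ofBijective t.vmap (vmap_bijective t)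

lemma vperm_apply (t : ARTranslation C S.Dc) (v : ARVertex C S.Dc) : vperm t v = t.vmap v := rfl

/-- The dimension of the morphism space between two vertices. -/
noncomputable def vhom (v w : ARVertex C S.Dc) : ℕ := finrank k ((rep v).1 ⟶ (rep w).1)

lemma vhom_vertexOf (M N : IndecObj C S.Dc) :
    vhom (vertexOf C S.Dc M) (vertexOf C S.Dc N) = finrank k (M.1 ⟶ N.1) :=
  (Linear.homCongr k (nonempty_rep_iso M).some (nonempty_rep_iso N).some).finrank_eq

lemma vhom_vmap (t : ARTranslation C S.Dc) (v w : ARVertex C S.Dc) :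
    vhom (t.vmap v) (t.vmap w) = vhom v w := by
  rw [← vertexOf_rep v, ← vertexOf_rep w, vmap_vertexOf, vmap_vertexOf, vhom_vertexOf,
    vhom_vertexOf]
  obtain ⟨l, hl⟩ := exists_serrePair_τ t (rep v)
  obtain ⟨l', hl'⟩ := exists_serrePair_τ t (rep w)
  rw [← hl.finrank_hom_eq hl']
  exact (shiftHomEquiv k _ _ 1).finrank_eq

/-- The value of `φ` at a vertex. -/
noncomputable def vphi (v : ARVertex C S.Dc) : ℕ := S.phiN (rep v).1

lemma vphi_vertexOf (M : IndecObj C S.Dc) : vphi (vertexOf C S.Dc M) = S.phiN M.1 :=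
  S.phiN_congr (nonempty_rep_iso M).some

lemma vphi_vmap (t : ARTranslation C S.Dc) (v : ARVertex C S.Dc) : vphi (t.vmap v) = vphi v := by
  rw [← vertexOf_rep v, vmap_vertexOf, vphi_vertexOf, vphi_vertexOf]
  obtain ⟨l, hl⟩ := exists_serrePair_τ t (rep v)
  rw [hl.phiN_eq t, S.phiN_shift]

/-- The dimension of the cohomology of a vertex in a given degree. -/
noncomputable def vcoh (v : ARVertex C S.Dc) (i : ℤ) : ℕ := finrank k (S.cell i ⟶ (rep v).1)

lemma vcoh_vertexOf (M : IndecObj C S.Dc) (i : ℤ) :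
    vcoh (vertexOf C S.Dc M) i = finrank k (S.cell i ⟶ M.1) :=
  (Linear.homCongr k (Iso.refl _) (nonempty_rep_iso M).some).finrank_eq

lemma vcoh_vmap (t : ARTranslation C S.Dc) (v : ARVertex C S.Dc) (i : ℤ) :
    vcoh (t.vmap v) i = vcoh v (i + (S.d - 1)) := by
  rw [← vertexOf_rep v, vmap_vertexOf, vcoh_vertexOf, vcoh_vertexOf]
  obtain ⟨l, hl⟩ := exists_serrePair_τ t (rep v)
  obtain ⟨l', hl'⟩ := S.exists_serrePair_cell t (i + (S.d - 1)) (i - 1) (by ring)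
  rw [← hl'.finrank_hom_eq hl]
  exact (S.nonempty_cell_shift _ (i - 1) 1 i (by ring)).some.finrank_eq.symm

lemma vcoh_zpow (t : ARTranslation C S.Dc) (p : ℤ) (v : ARVertex C S.Dc) (i : ℤ) :
    vcoh ((vperm t ^ p) v) i = vcoh v (i + p * (S.d - 1)) := by
  induction p using Int.induction_on generalizing v with
  | zero => simp
  | succ n ih =>
    rw [zpow_add_one, Equiv.Perm.mul_apply, ih, vperm_apply, vcoh_vmap]
    congr 1
    ring
  | pred n ih =>
    obtain ⟨w, rfl⟩ := (vperm t).surjective v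
    rw [zpow_sub_one, Equiv.Perm.mul_apply, Equiv.Perm.inv_eq_iff_eq.2 rfl, ih, vperm_apply, vcoh_vmap]
    congr 1
    ring

variable (S) in
lemma exists_bounds {V : C} (hV : V ∈ S.Dc) :
    ∃ a b : ℤ, ∀ j, j < a ∨ b < j → ∀ f : S.cell j ⟶ V, f = 0 := by
  have hfin := (S.finCoh_of_mem hV).2
  obtain ⟨a, ha⟩ := hfin.bddBelow
  obtain ⟨b, hb⟩ := hfin.bddAbove
  refine ⟨a, b, fun j hj f => ?_⟩
  by_contra hf
  have h1 := ha ⟨f, hf⟩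
  have h2 := hb ⟨f, hf⟩
  omega

lemma vcoh_eq_zero_iff (v : ARVertex C S.Dc) (i : ℤ) :
    vcoh v i = 0 ↔ ∀ f : S.cell i ⟶ (rep v).1, f = 0 := by
  have := S.finiteDimensional_hom (S.cell_mem i) (rep v).2.1
  rw [vcoh, finrank_zero_iff, subsingleton_hom_iff]

lemma vcoh_bounds (v : ARVertex C S.Dc) : ∃ a b : ℤ, ∀ j, j < a ∨ b < j → vcoh v j = 0 := by
  obtain ⟨a, b, h⟩ := S.exists_bounds (rep v).2.1
  exact ⟨a, b, fun j hj => (vcoh_eq_zero_iff v j).2 (h j hj)⟩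

lemma exists_vcoh_ne_zero (v : ARVertex C S.Dc) : ∃ i, vcoh v i ≠ 0 := by
  by_contra hc
  push Not at hc
  exact (rep v).2.2.1
    (S.isZero_of_forall_infGE (rep v).2.1 fun j => (vcoh_eq_zero_iff v j).1 (hc j))

lemma eq_zero_of_zpow_apply_eq (t : ARTranslation C S.Dc) (hd : 2 ≤ S.d) (v : ARVertex C S.Dc)
    (p : ℤ) (hp : (vperm t ^ p) v = v) : p = 0 := by
  obtain ⟨i, hi⟩ := exists_vcoh_ne_zero v
  obtain ⟨a, b, hab⟩ := vcoh_bounds v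
  have key : ∀ n : ℤ, vcoh v (i + n * p * (S.d - 1)) ≠ 0 := by
    intro n
    have h1 : (vperm t ^ (p * n)) v = v := by
      rw [zpow_mul]
      exact Function.IsFixedPt.perm_zpow (e := vperm t ^ p) hp n
    have h2 := vcoh_zpow t (p * n) v i
    rw [h1] at h2
    rwa [mul_comm n p, ← h2]
  by_contra hp0
  have h1 := key ((|b - i| + 1) * p)
  refine h1 (hab _ (Or.inr ?_))
  have h2 : 1 ≤ p * p := by
    have := mul_self_pos.2 hp0
    omega
  have h3 := abs_nonneg (b - i)
  have h4 := le_abs_self (b - i)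
  nlinarith [mul_le_mul h2 (show (1 : ℤ) ≤ S.d - 1 by omega) (by norm_num) (by nlinarith)]

lemma finite_vhom_zpow (t : ARTranslation C S.Dc) (hd : 2 ≤ S.d) (v w : ARVertex C S.Dc) :
    (Function.support fun p : ℤ => vhom ((vperm t ^ p) v) w).Finite := by
  obtain ⟨a, b, hab⟩ := vcoh_bounds v
  obtain ⟨a', b', hab'⟩ := S.exists_bounds (rep w).2.1
  obtain ⟨N, l, hl, -⟩ := exists_serrePair_left t (rep w).2.1
  obtain ⟨a'', b'', hab''⟩ := S.exists_bounds hl.memN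
  have hzero : ∀ {X Y : C}, (∀ f : X ⟶ Y, f = 0) → finrank k (X ⟶ Y) = 0 := fun h => by
    have := subsingleton_hom_iff.2 h
    exact finrank_zero_of_subsingleton
  refine (Set.finite_Icc (min 0 (a - b' - 1)) (max 0 (b - a'' + 1))).subset fun p hp => ?_
  by_contra hc
  refine hp ?_
  rw [Set.mem_Icc, not_and_or, not_le, not_le, lt_min_iff, max_lt_iff] at hc
  rcases hc with ⟨h1, h2⟩ | ⟨h1, h2⟩
  · refine hzero fun f => ?_
    refine S.hom_eq_zero_of_infGE (rep _).2.1 (c := b' + 1) (fun j hj => ?_)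
      (fun j hj => hab' j (Or.inr (by omega))) f
    rw [← vcoh_eq_zero_iff, vcoh_zpow]
    exact hab _ (Or.inl (by nlinarith))
  · have h3 := hl.finrank_eq (rep ((vperm t ^ p) v)).2.1
    change finrank k _ = 0
    rw [← h3]
    refine hzero fun f => ?_
    refine S.hom_eq_zero_of_infGE hl.memN (c := a'') (fun j hj => hab'' j (Or.inl hj))
      (fun j hj => ?_) f
    rw [← vcoh_eq_zero_iff, vcoh_zpow]
    exact hab _ (Or.inr (by nlinarith))

/-- The dimension of the morphism spaces from the translation orbit of `w` to a vertex. -/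
noncomputable def orbitHom (t : ARTranslation C S.Dc) (w y : ARVertex C S.Dc) : ℕ :=
  ∑ᶠ p : ℤ, vhom ((vperm t ^ p) w) y

lemma orbitHom_vmap (t : ARTranslation C S.Dc) (w y : ARVertex C S.Dc) :
    orbitHom t w (t.vmap y) = orbitHom t w y := by
  unfold orbitHom
  rw [← finsum_comp_equiv (Equiv.addRight (1 : ℤ))]
  refine finsum_congr fun p => ?_
  change vhom ((vperm t ^ (p + 1)) w) _ = _
  rw [add_comm, zpow_one_add, Equiv.Perm.mul_apply, vperm_apply, vhom_vmap]

lemma sum_map_orbitHom (t : ARTranslation C S.Dc) (hd : 2 ≤ S.d) (w : ARVertex C S.Dc)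
    (m : Multiset (ARVertex C S.Dc)) :
    (Function.support fun p : ℤ => (m.map (vhom ((vperm t ^ p) w))).sum).Finite ∧
    (m.map (orbitHom t w)).sum = ∑ᶠ p : ℤ, (m.map (vhom ((vperm t ^ p) w))).sum := by
  induction m using Multiset.induction_on with
  | empty => simp
  | cons a m ih =>
    simp only [Multiset.map_cons, Multiset.sum_cons]
    have ha := finite_vhom_zpow t hd w a
    exact ⟨(ha.union ih.1).subset (Function.support_add _ _),
      by rw [finsum_add_distrib ha ih.1, ih.2, orbitHom]⟩

lemma two_mul_orbitHom (t : ARTranslation C S.Dc) (hd : 2 ≤ S.d) (w y : ARVertex C S.Dc) :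
    2 * orbitHom t w y =
      ∑ᶠ p : ℤ, (vhom ((vperm t ^ p) w) (t.vmap y) + vhom ((vperm t ^ p) w) y) := by
  rw [finsum_add_distrib (finite_vhom_zpow t hd w _) (finite_vhom_zpow t hd w y), two_mul]
  exact congrArg (· + _) (orbitHom_vmap t w y).symm

lemma finite_vhom_add (t : ARTranslation C S.Dc) (hd : 2 ≤ S.d) (w y : ARVertex C S.Dc) :
    (Function.support fun p : ℤ =>
      vhom ((vperm t ^ p) w) (t.vmap y) + vhom ((vperm t ^ p) w) y).Finite :=
  ((finite_vhom_zpow t hd w _).union (finite_vhom_zpow t hd w y)).subset (Function.support_add _ _)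

section Mesh

variable {X Y N : C} {f : X ⟶ Y} {g : Y ⟶ N} {h : N ⟶ X⟦(1 : ℤ)⟧}

lemma nonempty_τ_iso (t : ARTranslation C S.Dc) (hT : IsARTriangle C S.Dc f g h)
    (hN : Indec C N) : Nonempty ((t.τ ⟨N, hT.memZ, hN⟩).1 ≅ X) := by
  obtain ⟨l, hl⟩ := S.exists_serrePair_of_AR hT
  exact nonempty_τ_iso_of_serrePair t ⟨N, hT.memZ, hN⟩ hl

lemma vmap_eq (t : ARTranslation C S.Dc) (hT : IsARTriangle C S.Dc f g h) (hN : Indec C N)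
    (hX : Indec C X) :
    t.vmap (vertexOf C S.Dc ⟨N, hT.memZ, hN⟩) = vertexOf C S.Dc ⟨X, hT.memX, hX⟩ := by
  rw [vmap_vertexOf, vertexOf_eq_iff]
  exact nonempty_τ_iso t hT hN

lemma irredMor_of_iso {M N M' N' : C} {p : M ⟶ N} (hp : IrredMor C S.Dc p) (e : M' ≅ M)
    (e' : N ≅ N') : IrredMor C S.Dc (e.hom ≫ p ≫ e'.hom) := by
  refine ⟨fun hi => hp.1 ?_, fun L hL σ ρ hσρ => ?_⟩
  · have : p = e.inv ≫ (e.hom ≫ p ≫ e'.hom) ≫ e'.inv := by simp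
    rw [this]
    infer_instance
  · have h1 : (e.inv ≫ σ) ≫ (ρ ≫ e'.inv) = p := by
      rw [Category.assoc, reassoc_of% hσρ]
      simp
    rcases hp.2 L hL _ _ h1 with ⟨s, hs⟩ | ⟨r, hr⟩
    · refine Or.inl ⟨e'.inv ≫ s, ?_⟩
      have h2 : s ≫ ρ = e'.hom := by
        rw [← cancel_mono e'.inv, Category.assoc, hs, e'.hom_inv_id]
      rw [Category.assoc, h2, e'.inv_hom_id]
    · refine Or.inr ⟨r ≫ e.inv, ?_⟩
      have h2 : σ ≫ r = e.hom := by
        rw [← cancel_epi e.inv, ← Category.assoc, hr, e.inv_hom_id]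
      rw [← Category.assoc, h2, e.hom_inv_id]

lemma vArrow_iff (M N : IndecObj C S.Dc) :
    VArrow C S.Dc (vertexOf C S.Dc M) (vertexOf C S.Dc N) ↔
      ∃ p : M.1 ⟶ N.1, IrredMor C S.Dc p := by
  constructor
  · rintro ⟨M', N', p, hp, hM, hN⟩
    obtain ⟨e⟩ := vertexOf_eq_iff.1 hM
    obtain ⟨e'⟩ := vertexOf_eq_iff.1 hN
    exact ⟨_, irredMor_of_iso hp e.symm e'⟩
  · rintro ⟨p, hp⟩
    exact ⟨M, N, p, hp, rfl, rfl⟩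

variable {J : Type} [Fintype J] {Z : J → C} {ι : ∀ j, Z j ⟶ Y} {π : ∀ j, Y ⟶ Z j}

/-- The vertices of the indecomposable summands of the middle term of an Auslander-Reiten
triangle. -/
noncomputable def meshMiddle (hT : IsARTriangle C S.Dc f g h) (hD : IsDirectSum ι π)
    (hZ : ∀ j, Indec C (Z j)) : Multiset (ARVertex C S.Dc) :=
  Finset.univ.val.map fun j => vertexOf C S.Dc ⟨Z j, mem_of_isDirectSum hT.memY hD j, hZ j⟩

lemma mem_meshMiddle_vertexOf (hT : IsARTriangle C S.Dc f g h) (hD : IsDirectSum ι π)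
    (hZ : ∀ j, Indec C (Z j)) (M : IndecObj C S.Dc) :
    vertexOf C S.Dc M ∈ meshMiddle hT hD hZ ↔ ∃ j, Nonempty (M.1 ≅ Z j) := by
  simp only [meshMiddle, Multiset.mem_map, Finset.mem_val, Finset.mem_univ, true_and]
  exact exists_congr fun j => eq_comm.trans vertexOf_eq_iff

lemma mem_meshMiddle_iff_to (t : ARTranslation C S.Dc) (hT : IsARTriangle C S.Dc f g h)
    (hN : Indec C N) (hD : IsDirectSum ι π) (hZ : ∀ j, Indec C (Z j)) (v : ARVertex C S.Dc) :
    v ∈ meshMiddle hT hD hZ ↔ VArrow C S.Dc v (vertexOf C S.Dc ⟨N, hT.memZ, hN⟩) := by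
  have hX : Indec C X := (t.τ ⟨N, hT.memZ, hN⟩).2.2.of_iso (nonempty_τ_iso t hT hN).some
  rw [← vertexOf_rep v, mem_meshMiddle_vertexOf, vArrow_iff,
    exists_irredMor_to_iff t hT hX hN hD hZ (rep v).2.1 (rep v).2.2]

lemma mem_meshMiddle_iff_from (t : ARTranslation C S.Dc) (hT : IsARTriangle C S.Dc f g h)
    (hN : Indec C N) (hD : IsDirectSum ι π) (hZ : ∀ j, Indec C (Z j)) (v : ARVertex C S.Dc) :
    v ∈ meshMiddle hT hD hZ ↔ VArrow C S.Dc (t.vmap (vertexOf C S.Dc ⟨N, hT.memZ, hN⟩)) v := by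
  have hX : Indec C X := (t.τ ⟨N, hT.memZ, hN⟩).2.2.of_iso (nonempty_τ_iso t hT hN).some
  rw [vmap_eq t hT hN hX, ← vertexOf_rep v, mem_meshMiddle_vertexOf, vArrow_iff,
    exists_irredMor_from_iff t hT hX hN hD hZ (rep v).2.1 (rep v).2.2]

lemma sum_vphi_meshMiddle (t : ARTranslation C S.Dc) (hd : 0 < S.d)
    (hT : IsARTriangle C S.Dc f g h) (hN : Indec C N) (hD : IsDirectSum ι π)
    (hZ : ∀ j, Indec C (Z j)) :
    ((meshMiddle hT hD hZ).map vphi).sum = 2 * vphi (vertexOf C S.Dc ⟨N, hT.memZ, hN⟩) := by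
  have h1 := phiN_eq_sum hT.memY hD
  rw [phiN_of_isARTriangle hd hT] at h1
  obtain ⟨l, hl⟩ := S.exists_serrePair_of_AR hT
  have h2 := hl.phiN_eq t
  rw [S.phiN_shift] at h2
  simp only [meshMiddle, Multiset.map_map, Function.comp_def, vphi_vertexOf]
  change ∑ j, S.phiN (Z j) = _
  omega

lemma sum_vhom_meshMiddle (hT : IsARTriangle C S.Dc f g h) (hD : IsDirectSum ι π)
    (hZ : ∀ j, Indec C (Z j)) (W : IndecObj C S.Dc) :
    ((meshMiddle hT hD hZ).map (vhom (vertexOf C S.Dc W))).sum = finrank k (W.1 ⟶ Y) := by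
  rw [hD.finrank_hom_to W.1 fun j =>
    S.finiteDimensional_hom W.2.1 (mem_of_isDirectSum hT.memY hD j)]
  simp only [meshMiddle, Multiset.map_map, Function.comp_def, vhom_vertexOf]
  rfl

lemma sum_vhom_meshMiddle_le (t : ARTranslation C S.Dc) (hT : IsARTriangle C S.Dc f g h)
    (hN : Indec C N) (hD : IsDirectSum ι π) (hZ : ∀ j, Indec C (Z j)) (w : ARVertex C S.Dc) :
    ((meshMiddle hT hD hZ).map (vhom w)).sum ≤
      vhom w (t.vmap (vertexOf C S.Dc ⟨N, hT.memZ, hN⟩)) +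
        vhom w (vertexOf C S.Dc ⟨N, hT.memZ, hN⟩) := by
  have hX : Indec C X := (t.τ ⟨N, hT.memZ, hN⟩).2.2.of_iso (nonempty_τ_iso t hT hN).some
  rw [vmap_eq t hT hN hX, ← vertexOf_rep w, sum_vhom_meshMiddle, vhom_vertexOf, vhom_vertexOf]
  exact finrank_hom_middle_le hT (rep w).2.1

lemma sum_vhom_meshMiddle_lt (t : ARTranslation C S.Dc) (hT : IsARTriangle C S.Dc f g h)
    (hN : Indec C N) (hD : IsDirectSum ι π) (hZ : ∀ j, Indec C (Z j)) :
    ((meshMiddle hT hD hZ).map (vhom (vertexOf C S.Dc ⟨N, hT.memZ, hN⟩))).sum <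
      vhom (vertexOf C S.Dc ⟨N, hT.memZ, hN⟩) (t.vmap (vertexOf C S.Dc ⟨N, hT.memZ, hN⟩)) +
        vhom (vertexOf C S.Dc ⟨N, hT.memZ, hN⟩) (vertexOf C S.Dc ⟨N, hT.memZ, hN⟩) := by
  have hX : Indec C X := (t.τ ⟨N, hT.memZ, hN⟩).2.2.of_iso (nonempty_τ_iso t hT hN).some
  rw [vmap_eq t hT hN hX, sum_vhom_meshMiddle, vhom_vertexOf, vhom_vertexOf]
  exact finrank_hom_middle_lt hT (Iso.refl N)

end Mesh

lemma exists_mesh (t : ARTranslation C S.Dc) (hd : 2 ≤ S.d) (y : ARVertex C S.Dc) :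
    ∃ m : Multiset (ARVertex C S.Dc), (∀ x, x ∈ m ↔ VArrow C S.Dc x y) ∧
      (∀ x, x ∈ m ↔ VArrow C S.Dc (t.vmap y) x) ∧ (m.map vphi).sum = 2 * vphi y ∧
      (∀ w, (m.map (vhom w)).sum ≤ vhom w (t.vmap y) + vhom w y) ∧
      (m.map (vhom y)).sum < vhom y (t.vmap y) + vhom y y := by
  obtain ⟨Y, f, g, h, hT⟩ := t.triangle (rep y)
  obtain ⟨J, _, Z, ι, π, hD, hZ⟩ := S.exists_isDirectSum hT.memY
  have hN := (rep y).2.2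
  have key : vertexOf C S.Dc ⟨(rep y).1, hT.memZ, hN⟩ = y := vertexOf_rep y
  rw [← key]
  exact ⟨meshMiddle hT hD hZ, mem_meshMiddle_iff_to t hT hN hD hZ,
    mem_meshMiddle_iff_from t hT hN hD hZ, sum_vphi_meshMiddle t (by omega) hT hN hD hZ,
    sum_vhom_meshMiddle_le t hT hN hD hZ, sum_vhom_meshMiddle_lt t hT hN hD hZ⟩

/-- The Auslander-Reiten quiver of the compact objects as a translation quiver with additive
function `φ`. -/
noncomputable def translationData (t : ARTranslation C S.Dc) (hd : 2 ≤ S.d) :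
    TranslationData (ARVertex C S.Dc) where
  τ := vperm t
  Arrow := VArrow C S.Dc
  φ := vphi
  mid y := (exists_mesh t hd y).choose
  Ψ := orbitHom t
  mem_mid x y := (exists_mesh t hd y).choose_spec.1 x
  arrow_iff x y := ((exists_mesh t hd y).choose_spec.1 x).symm.trans
    ((exists_mesh t hd y).choose_spec.2.1 x)
  sum_φ y := (exists_mesh t hd y).choose_spec.2.2.1
  φ_τ := vphi_vmap t
  φ_pos y := phiN_pos (rep y).2.1 (rep y).2.2.1
  Ψ_τ := orbitHom_vmap t
  Ψ_le w y := by
    rw [two_mul_orbitHom t hd, (sum_map_orbitHom t hd w _).2]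
    exact finsum_le_finsum' (sum_map_orbitHom t hd w _).1 (finite_vhom_add t hd w y)
      fun p => (exists_mesh t hd y).choose_spec.2.2.2.1 _
  Ψ_lt w := by
    obtain ⟨-, -, -, hle, hlt⟩ := (exists_mesh t hd w).choose_spec
    generalize (exists_mesh t hd w).choose = m at hle hlt
    have h1 := (sum_map_orbitHom t hd w m).1
    have h2 := finite_vhom_add t hd w w
    rw [two_mul_orbitHom t hd, (sum_map_orbitHom t hd w m).2,
      finsum_eq_sum_of_support_subset (s := insert 0 (h1.toFinset ∪ h2.toFinset)) _
        (fun p hp => Finset.mem_coe.2 (Finset.mem_insert_of_mem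
          (Finset.mem_union_left _ (h1.mem_toFinset.2 hp)))),
      finsum_eq_sum_of_support_subset (s := insert 0 (h1.toFinset ∪ h2.toFinset)) _
        (fun p hp => Finset.mem_coe.2 (Finset.mem_insert_of_mem
          (Finset.mem_union_right _ (h2.mem_toFinset.2 hp))))]
    exact Finset.sum_lt_sum (fun p _ => hle _) ⟨0, Finset.mem_insert_self _ _, by simpa using hlt⟩
  free := eq_zero_of_zpow_apply_eq t hd

end DGSetup

end Vertices

section Statements

variable {k : Type u} [Field k]
variable {C : Type u} [Category.{v} C] [Preadditive C] [HasZeroObject C] [HasShift C ℤ]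
  [∀ n : ℤ, (shiftFunctor C n).Additive] [Pretriangulated C]
  [Linear k C] [HasFiniteBiproducts C] [∀ n : ℤ, Functor.Linear k (shiftFunctor C n)]
variable {Co : Type u} [Category.{v} Co] [Preadditive Co] [HasZeroObject Co] [HasShift Co ℤ]
  [∀ n : ℤ, (shiftFunctor Co n).Additive] [Pretriangulated Co]
  [Linear k Co] [HasFiniteBiproducts Co] [∀ n : ℤ, Functor.Linear k (shiftFunctor Co n)]
/-- Suppose `R` is Gorenstein with `dim_k H(R) ≥ 2`, and let `Γ` be the AR
quiver of `D^c(R)` with AR translation `τ`.  Then: (1) each component of `Γ` is isomorphic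
to `ℤA∞` as a stable translation quiver; (2) each label `(α_μ, β_μ)` on `Γ` equals `(1,1)`,
i.e. the middle term of any AR triangle in `D^c(R)` is multiplicity free; (3) if
`φ(M) = dim_k Ext_R(M,k)` has value `φ₁` on the edge of a component `C ≅ ℤA∞`, then it has
value `n·φ₁` on the `n`-th horizontal row of vertices of `C`. -/
theorem components_are_ZAinfty (S : DGSetup k C Co) (hG : S.Gorenstein)
    (h2 : 2 ≤ S.dimH) (t : ARTranslation C S.Dc) :
    -- (1)
    (∀ v₀ : ARVertex C S.Dc,
      IsZAInftyComponent C S.Dc t.vmap (componentOf C S.Dc v₀)) ∧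
    -- (2)
    (∀ (X Y N : C) (f : X ⟶ Y) (g : Y ⟶ N) (h : N ⟶ X⟦(1 : ℤ)⟧),
      IsARTriangle C S.Dc f g h → Indec C N →
      ∀ (m : ℕ) (Ys : Fin m → C), (∀ j, Indec C (Ys j)) → Nonempty (Y ≅ ⨁ Ys) →
        ∀ j j', j ≠ j' → IsEmpty (Ys j ≅ Ys j')) ∧
    -- (3)
    (∀ v₀ : ARVertex C S.Dc,
      ∃ (hτ : ∀ v ∈ componentOf C S.Dc v₀, t.vmap v ∈ componentOf C S.Dc v₀)
        (θ : (componentOf C S.Dc v₀) ≃ ZAVertex) (φ₁ : Cardinal),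
        (∀ v w : componentOf C S.Dc v₀, VArrow C S.Dc v.1 w.1 ↔ ZAArrow (θ v) (θ w)) ∧
        (∀ v : componentOf C S.Dc v₀, θ ⟨t.vmap v.1, hτ v.1 v.2⟩ = ZATrans (θ v)) ∧
        (∀ (v : componentOf C S.Dc v₀) (M : IndecObj C S.Dc),
          vertexOf C S.Dc M = v.1 → S.phi M.1 = (((θ v).2 : ℕ) : Cardinal) * φ₁)) := by
  have hd := S.two_le_d h2
  have hcomp (v₀ : ARVertex C S.Dc) :
      ∃ (hτ : ∀ v ∈ componentOf C S.Dc v₀, t.vmap v ∈ componentOf C S.Dc v₀)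
        (θ : (componentOf C S.Dc v₀) ≃ ZAVertex) (φ₁ : Cardinal),
        (∀ v w : componentOf C S.Dc v₀, VArrow C S.Dc v.1 w.1 ↔ ZAArrow (θ v) (θ w)) ∧
        (∀ v : componentOf C S.Dc v₀, θ ⟨t.vmap v.1, hτ v.1 v.2⟩ = ZATrans (θ v)) ∧
        (∀ (v : componentOf C S.Dc v₀) (M : IndecObj C S.Dc),
          vertexOf C S.Dc M = v.1 → S.phi M.1 = (((θ v).2 : ℕ) : Cardinal) * φ₁) := by
    obtain ⟨θ, c, harr, hτ, hφ⟩ := (DGSetup.translationData t hd).exists_equiv_ZAVertex v₀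
    refine ⟨fun v hv => ((DGSetup.translationData t hd).conn_τ v).trans hv, θ, (c : Cardinal),
      harr, hτ, fun v M hM => ?_⟩
    have hv : S.phiN M.1 = (θ v).2 * c :=
      (DGSetup.vphi_vertexOf M).symm.trans ((congrArg DGSetup.vphi hM).trans (hφ v))
    exact (S.phi_eq M.2.1).trans ((congrArg Nat.cast hv).trans (Nat.cast_mul _ _))
  refine ⟨fun v₀ => ?_, ?_, hcomp⟩
  · obtain ⟨hτ, θ, -, harr, htr, -⟩ := hcomp v₀
    exact ⟨hτ, θ, harr, htr⟩
  · rintro X Y N f g h hT hN m Ys hYs ⟨e⟩ j j' hne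
    refine ⟨fun i => hne ?_⟩
    have hD := IsDirectSum.of_iso_biproduct e
    have hnd := (DGSetup.translationData t hd).nodup_middle
      (DGSetup.mem_meshMiddle_iff_to t hT hN hD hYs)
      (DGSetup.sum_vphi_meshMiddle t (by omega) hT hN hD hYs)
    exact Multiset.inj_on_of_nodup_map hnd j (Finset.mem_univ_val _) j' (Finset.mem_univ_val _)
      (DGSetup.vertexOf_eq_iff.2 ⟨i⟩)

end Statements
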